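/- Fix integers k, r with k ≥ 3, a k-vertex graph F and a constant η > 0 such that one of the following holds: (1) F = K_k and r = k; (2) F = K_k, r = k−1 and η ≥ 1/k; (3) F is a tree on k vertices and r = 2; (4) F = C_k, r = 2 and η ≥ 1/k. Then for any γ, μ > 0 there exist α, ξ > 0 such that the following holds for all sufficiently large n ∈ ℕ: if G is an n-vertex graph with minimum degree δ(G) ≥ (η+μ)n and α_r(G) ≤ αn, then there is a partition {V_1, …, V_C, A_1, …, A_C, B} of V(G) for some C ≤ ⌊1/η⌋ such that |A_1 ∪ ⋯ ∪ A_C ∪ B| ≤ γn, for each i ∈ [C] the set A_i is a ξ-absorbing set with respect to V_i, and G[B] has a perfect F-tiling. -/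

import Mathlib

open Finset

namespace RTT

variable {k n : ℕ}

/-- `S` spans a copy of the `k`-vertex graph `F` in `G`:
there is an injective graph homomorphism from `F` to `G` with image exactly `S`. -/
def SpansCopy (F : SimpleGraph (Fin k)) (G : SimpleGraph (Fin n))
    (S : Finset (Fin n)) : Prop :=
  ∃ f : Fin k → Fin n, Function.Injective f ∧
    (∀ a b, F.Adj a b → G.Adj (f a) (f b)) ∧ Finset.image f Finset.univ = S

/-- `T` is an `F`-tiling in `G`: a collection of pairwise vertex-disjoint vertex sets,
each spanning a copy of `F`. -/
def IsTiling (F : SimpleGraph (Fin k)) (G : SimpleGraph (Fin n))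
    (T : Finset (Finset (Fin n))) : Prop :=
  (∀ S ∈ T, SpansCopy F G S) ∧ ∀ S ∈ T, ∀ S' ∈ T, S ≠ S' → Disjoint S S'

/-- The induced subgraph of `G` on the vertex set `A` has a perfect `F`-tiling. -/
def PerfTilingOn (F : SimpleGraph (Fin k)) (G : SimpleGraph (Fin n))
    (A : Finset (Fin n)) : Prop :=
  ∃ T : Finset (Finset (Fin n)), IsTiling F G T ∧ T.biUnion id = A

/-- The minimum degree of `G` is at least `x`. -/
def MinDegGE (G : SimpleGraph (Fin n)) (x : ℝ) : Prop :=
  ∀ v : Fin n, x ≤ ((G.neighborSet v).ncard : ℝ)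

/-- The `r`-independence number of `G` is at most `x`: every vertex set whose induced
subgraph contains no copy of `K_r` has size at most `x`. -/
def IndepBound (G : SimpleGraph (Fin n)) (r : ℕ) (x : ℝ) : Prop :=
  ∀ S : Finset (Fin n), (∀ T ⊆ S, ¬ G.IsNClique r T) → (S.card : ℝ) ≤ x

/-- `α*(G) ≤ x`: every bipartite hole of `G` has size at most `x`. -/
def HoleBound (G : SimpleGraph (Fin n)) (x : ℝ) : Prop :=
  ∀ (s : ℕ) (U₁ U₂ : Finset (Fin n)), Disjoint U₁ U₂ → U₁.card = s → U₂.card = s →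
    (∀ u ∈ U₁, ∀ v ∈ U₂, ¬ G.Adj u v) → (s : ℝ) ≤ x

/-- `A` is a `ξ`-absorbing set with respect to `V'` (for the `k`-vertex graph `F`
in the `n`-vertex graph `G`). -/
def IsAbsorbingSet (F : SimpleGraph (Fin k)) (G : SimpleGraph (Fin n)) (ξ : ℝ)
    (V' A : Finset (Fin n)) : Prop :=
  ∀ U : Finset (Fin n), U ⊆ V' \ A → (U.card : ℝ) ≤ ξ * n →
    k ∣ (A ∪ U).card → PerfTilingOn F G (A ∪ U)

/-- `A` is an `(F,t)`-absorber for the `k`-set `S`. -/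
def IsAbsorber (F : SimpleGraph (Fin k)) (G : SimpleGraph (Fin n)) (t : ℕ)
    (S A : Finset (Fin n)) : Prop :=
  Disjoint A S ∧ A.card ≤ k ^ 2 * t ∧ PerfTilingOn F G A ∧ PerfTilingOn F G (A ∪ S)

/-- `S` has a family of at least `x` pairwise vertex-disjoint `(F,t)`-absorbers in `G`. -/
def HasManyAbsorbers (F : SimpleGraph (Fin k)) (G : SimpleGraph (Fin n)) (t : ℕ)
    (S : Finset (Fin n)) (x : ℝ) : Prop :=
  ∃ 𝒜 : Finset (Finset (Fin n)), x ≤ (𝒜.card : ℝ) ∧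
    (∀ A ∈ 𝒜, IsAbsorber F G t S A) ∧
    ∀ A ∈ 𝒜, ∀ A' ∈ 𝒜, A ≠ A' → Disjoint A A'

/-- `𝒮` is an `F`-fan at `v` in `U`: a collection of pairwise disjoint `(k-1)`-sets
`S ⊆ U \ {v}` such that `{v} ∪ S` spans a copy of `F`; its size is `𝒮.card`. -/
def IsFan (F : SimpleGraph (Fin k)) (G : SimpleGraph (Fin n)) (v : Fin n)
    (U : Finset (Fin n)) (𝒮 : Finset (Finset (Fin n))) : Prop :=
  (∀ S ∈ 𝒮, S ⊆ U.erase v ∧ S.card = k - 1 ∧ SpansCopy F G (insert v S)) ∧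
    ∀ S ∈ 𝒮, ∀ S' ∈ 𝒮, S ≠ S' → Disjoint S S'

/-- `u` and `v` are `(F, m, t)`-reachable in `G`. -/
def FReachable (F : SimpleGraph (Fin k)) (G : SimpleGraph (Fin n)) (m : ℝ) (t : ℕ)
    (u v : Fin n) : Prop :=
  ∀ W : Finset (Fin n), (W.card : ℝ) ≤ m →
    ∃ S : Finset (Fin n), Disjoint S W ∧ u ∉ S ∧ v ∉ S ∧ S.card ≤ k * t - 1 ∧
      PerfTilingOn F G (insert u S) ∧ PerfTilingOn F G (insert v S)

/-- `U` is `(F, m, t)`-closed in `G`. -/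
def FClosed (F : SimpleGraph (Fin k)) (G : SimpleGraph (Fin n)) (m : ℝ) (t : ℕ)
    (U : Finset (Fin n)) : Prop :=
  ∀ u ∈ U, ∀ v ∈ U, u ≠ v → FReachable F G m t u v

/-- `P` is a partition of the vertex set of an `n`-vertex graph into `C` parts. -/
def IsPartition {C : ℕ} (P : Fin C → Finset (Fin n)) : Prop :=
  (∀ i j, i ≠ j → Disjoint (P i) (P j)) ∧ Finset.univ.biUnion P = Finset.univ

/-- The `k`-vector `v` is `(F, β)`-robust with respect to the partition `P`:
it has coordinate sum `k`, and avoiding any set `W` of at most `βn` vertices there is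
a copy of `F` whose vertex set has index vector `v`. -/
def RobustVec (F : SimpleGraph (Fin k)) (G : SimpleGraph (Fin n)) {C : ℕ}
    (P : Fin C → Finset (Fin n)) (β : ℝ) (v : Fin C → ℕ) : Prop :=
  (∑ i, v i) = k ∧
    ∀ W : Finset (Fin n), (W.card : ℝ) ≤ β * n →
      ∃ S : Finset (Fin n), Disjoint S W ∧ SpansCopy F G S ∧ ∀ i, (S ∩ P i).card = v i

end RTT

namespace RTT

lemma spans_card {k n : ℕ} {F : SimpleGraph (Fin k)} {G : SimpleGraph (Fin n)}
    {S : Finset (Fin n)} (h : SpansCopy F G S) : S.card = k := by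
  obtain ⟨f, hf, -, rfl⟩ := h
  rw [card_image_of_injective _ hf]; simp

lemma tile_empty {k n : ℕ} (F : SimpleGraph (Fin k)) (G : SimpleGraph (Fin n)) :
    PerfTilingOn F G ∅ :=
  ⟨∅, ⟨by simp, by simp⟩, by simp⟩

lemma tile_of_spans {k n : ℕ} {F : SimpleGraph (Fin k)} {G : SimpleGraph (Fin n)}
    {S : Finset (Fin n)} (h : SpansCopy F G S) : PerfTilingOn F G S :=
  ⟨{S}, ⟨by simpa using h, by simp⟩, by simp⟩

lemma tile_union {k n : ℕ} {F : SimpleGraph (Fin k)} {G : SimpleGraph (Fin n)}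
    {A B : Finset (Fin n)} (hA : PerfTilingOn F G A) (hB : PerfTilingOn F G B)
    (hAB : Disjoint A B) : PerfTilingOn F G (A ∪ B) := by
  obtain ⟨T, ⟨h1, h2⟩, rfl⟩ := hA
  obtain ⟨T', ⟨h1', h2'⟩, rfl⟩ := hB
  have key : ∀ S ∈ T, ∀ S' ∈ T', Disjoint S S' := by
    intro S hS S' hS'
    exact Disjoint.mono (subset_biUnion_of_mem id hS) (subset_biUnion_of_mem id hS') hAB
  refine ⟨T ∪ T', ⟨?_, ?_⟩, ?_⟩
  · intro S hS
    rcases mem_union.1 hS with h | h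
    · exact h1 S h
    · exact h1' S h
  · intro S hS S' hS' hne
    rcases mem_union.1 hS with h | h <;> rcases mem_union.1 hS' with h' | h'
    · exact h2 S h S' h' hne
    · exact key S h S' h'
    · exact (key S' h' S h).symm
    · exact h2' S h S' h' hne
  · rw [union_biUnion]

lemma tile_biUnion {k n : ℕ} {F : SimpleGraph (Fin k)} {G : SimpleGraph (Fin n)}
    {ι : Type*} (I : Finset ι) (A : ι → Finset (Fin n))
    (hA : ∀ i ∈ I, PerfTilingOn F G (A i))
    (hd : ∀ i ∈ I, ∀ j ∈ I, i ≠ j → Disjoint (A i) (A j)) :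
    PerfTilingOn F G (I.biUnion A) := by
  classical
  induction I using Finset.induction_on with
  | empty => simpa using tile_empty F G
  | insert a I ha ih =>
    rw [biUnion_insert]
    refine tile_union (hA a (mem_insert_self _ _))
      (ih (fun i hi => hA i (mem_insert_of_mem hi))
        (fun i hi j hj => hd i (mem_insert_of_mem hi) j (mem_insert_of_mem hj))) ?_
    rw [disjoint_biUnion_right]
    intro i hi
    refine hd a (mem_insert_self _ _) i (mem_insert_of_mem hi) ?_
    rintro rfl; exact ha hi

lemma tile_dvd {k n : ℕ} {F : SimpleGraph (Fin k)} {G : SimpleGraph (Fin n)}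
    {A : Finset (Fin n)} (hA : PerfTilingOn F G A) : k ∣ A.card := by
  obtain ⟨T, ⟨h1, h2⟩, rfl⟩ := hA
  rw [card_biUnion (by intro x hx y hy hxy; exact h2 x hx y hy hxy)]
  refine dvd_sum ?_
  intro S hS
  rw [id, spans_card (h1 S hS)]

lemma greedy {n : ℕ} {ι : Type*} (I : Finset ι) (p : ι → Finset (Fin n) → Prop)
    (W0 : Finset (Fin n)) (s M : ℝ) (hs : 0 ≤ s)
    (h : ∀ i ∈ I, ∀ W : Finset (Fin n), W0 ⊆ W → (W.card : ℝ) ≤ M →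
      ∃ Q : Finset (Fin n), Disjoint Q W ∧ (Q.card : ℝ) ≤ s ∧ p i Q)
    (hM : (W0.card : ℝ) + s * I.card ≤ M) :
    ∃ Q : ι → Finset (Fin n), (∀ i ∈ I, p i (Q i) ∧ Disjoint (Q i) W0 ∧ ((Q i).card : ℝ) ≤ s) ∧
      ∀ i ∈ I, ∀ j ∈ I, i ≠ j → Disjoint (Q i) (Q j) := by
  classical
  induction I using Finset.induction_on with
  | empty => exact ⟨fun _ => ∅, by simp, by simp⟩
  | insert a I ha ih =>
    rw [card_insert_of_notMem ha] at hM
    push_cast at hM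
    obtain ⟨Q, hQ, hd⟩ := ih (fun i hi => h i (mem_insert_of_mem hi)) (by nlinarith)
    have hc : ((I.biUnion Q).card : ℝ) ≤ s * I.card := by
      have : ((I.biUnion Q).card : ℝ) ≤ ∑ i ∈ I, ((Q i).card : ℝ) := by
        exact_mod_cast card_biUnion_le
      refine this.trans ?_
      have := sum_le_card_nsmul I (fun i => ((Q i).card : ℝ)) s (fun i hi => (hQ i hi).2.2)
      rw [nsmul_eq_mul] at this
      linarith
    obtain ⟨R, hR1, hR2, hR3⟩ := h a (mem_insert_self _ _) (W0 ∪ I.biUnion Q) subset_union_left (by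
      have : ((W0 ∪ I.biUnion Q).card : ℝ) ≤ W0.card + (I.biUnion Q).card := by
        exact_mod_cast card_union_le _ _
      nlinarith)
    rw [disjoint_union_right, disjoint_biUnion_right] at hR1
    have hne : ∀ i ∈ I, i ≠ a := by rintro i hi rfl; exact ha hi
    refine ⟨Function.update Q a R, ?_, ?_⟩
    · intro i hi
      rcases mem_insert.1 hi with rfl | hi
      · simp only [Function.update_self]; exact ⟨hR3, hR1.1, hR2⟩
      · rw [Function.update_of_ne (hne i hi)]; exact hQ i hi
    · intro i hi j hj hij
      rcases mem_insert.1 hi with hi' | hi' <;> rcases mem_insert.1 hj with hj' | hj'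
      · exact absurd (hi'.trans hj'.symm) hij
      · rw [hi', Function.update_self, Function.update_of_ne (hne j hj')]; exact hR1.2 j hj'
      · rw [hj', Function.update_self, Function.update_of_ne (hne i hi')]; exact (hR1.2 i hi').symm
      · rw [Function.update_of_ne (hne i hi'), Function.update_of_ne (hne j hj')]
        exact hd i hi' j hj' hij

/-- finite neighbourhood -/
noncomputable def nb {n : ℕ} (G : SimpleGraph (Fin n)) (v : Fin n) : Finset (Fin n) := by
  classical exact univ.filter (fun w => G.Adj v w)

lemma mem_nb {n : ℕ} {G : SimpleGraph (Fin n)} {v w : Fin n} : w ∈ nb G v ↔ G.Adj v w := by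
  classical simp [nb]

lemma nb_card {n : ℕ} (G : SimpleGraph (Fin n)) (v : Fin n) :
    (nb G v).card = (G.neighborSet v).ncard := by
  rw [← Set.ncard_coe_finset]
  congr 1
  ext w; simp [mem_nb]

lemma reach_symm {k n : ℕ} {F : SimpleGraph (Fin k)} {G : SimpleGraph (Fin n)} {m : ℝ} {t : ℕ}
    {u v : Fin n} (h : FReachable F G m t u v) : FReachable F G m t v u := by
  intro W hW
  obtain ⟨S, h1, h2, h3, h4, h5, h6⟩ := h W hW
  exact ⟨S, h1, h3, h2, h4, h6, h5⟩

lemma reach_mono {k n : ℕ} {F : SimpleGraph (Fin k)} {G : SimpleGraph (Fin n)} {m m' : ℝ}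
    {t t' : ℕ} (hm : m' ≤ m) (ht : t ≤ t')
    {u v : Fin n} (h : FReachable F G m t u v) : FReachable F G m' t' u v := by
  intro W hW
  obtain ⟨S, h1, h2, h3, h4, h5, h6⟩ := h W (hW.trans hm)
  exact ⟨S, h1, h2, h3, h4.trans (Nat.sub_le_sub_right (Nat.mul_le_mul_left k ht) 1), h5, h6⟩

/-- Linking many pairs simultaneously. -/
lemma link {k n : ℕ} {F : SimpleGraph (Fin k)} {G : SimpleGraph (Fin n)} {m : ℝ} {t : ℕ}
    {ι : Type*} (I : Finset ι) (x y : ι → Fin n) (W : Finset (Fin n))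
    (hr : ∀ i ∈ I, FReachable F G m t (x i) (y i))
    (hxW : ∀ i ∈ I, x i ∈ W) (hyW : ∀ i ∈ I, y i ∈ W)
    (hx : ∀ i ∈ I, ∀ j ∈ I, i ≠ j → x i ≠ x j) (hy : ∀ i ∈ I, ∀ j ∈ I, i ≠ j → y i ≠ y j)
    (hm : (W.card : ℝ) + (k * t : ℕ) * I.card ≤ m) :
    ∃ Q : Finset (Fin n), Disjoint Q W ∧ Q.card ≤ (k * t - 1) * I.card ∧
      PerfTilingOn F G (I.image x ∪ Q) ∧ PerfTilingOn F G (I.image y ∪ Q) := by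
  classical
  obtain ⟨Q, hQ, hd⟩ := greedy I (fun i Q => Q.card ≤ k * t - 1 ∧
      PerfTilingOn F G (insert (x i) Q) ∧ PerfTilingOn F G (insert (y i) Q)) W (k * t : ℕ) m
      (by positivity) (by
        intro i hi W' _ hW'
        obtain ⟨S, h1, h2, h3, h4, h5, h6⟩ := hr i hi W' hW'
        refine ⟨S, h1, ?_, h4, h5, h6⟩
        exact_mod_cast h4.trans (Nat.sub_le _ _)) hm
  have key : ∀ z : ι → Fin n, (∀ i ∈ I, z i ∈ W) →
      (∀ i ∈ I, ∀ j ∈ I, i ≠ j → z i ≠ z j) →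
      (∀ i ∈ I, PerfTilingOn F G (insert (z i) (Q i))) →
      PerfTilingOn F G (I.image z ∪ I.biUnion Q) := by
    intro z hzW hz ht
    have := tile_biUnion I (fun i => insert (z i) (Q i)) ht (by
      intro i hi j hj hij
      have h1 := hd i hi j hj hij
      have h2 : z i ∉ Q j := fun h => disjoint_left.1 (hQ j hj).2.1 h (hzW i hi)
      have h3 : z j ∉ Q i := fun h => disjoint_left.1 (hQ i hi).2.1 h (hzW j hj)
      rw [disjoint_insert_left, disjoint_insert_right, mem_insert]
      exact ⟨fun h => h.elim (hz i hi j hj hij) h2, h3, h1⟩)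
    convert this using 1
    ext v
    simp only [mem_union, mem_image, mem_biUnion, mem_insert]
    constructor
    · rintro (⟨i, hi, rfl⟩ | ⟨i, hi, h⟩)
      · exact ⟨i, hi, Or.inl rfl⟩
      · exact ⟨i, hi, Or.inr h⟩
    · rintro ⟨i, hi, rfl | h⟩
      · exact Or.inl ⟨i, hi, rfl⟩
      · exact Or.inr ⟨i, hi, h⟩
  refine ⟨I.biUnion Q, ?_, ?_, key x hxW hx fun i hi => (hQ i hi).1.2.1,
    key y hyW hy fun i hi => (hQ i hi).1.2.2⟩
  · rw [disjoint_biUnion_left]; exact fun i hi => (hQ i hi).2.1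
  · refine card_biUnion_le.trans ?_
    have := sum_le_card_nsmul I (fun i => (Q i).card) (k * t - 1) (fun i hi => (hQ i hi).1.1)
    rw [smul_eq_mul] at this
    linarith

end RTT

namespace RTT

/-- every nonempty vertex set contains a vertex with at most one neighbour inside -/
def Deg1 {k : ℕ} (F : SimpleGraph (Fin k)) : Prop :=
  ∀ Q : Finset (Fin k), Q.Nonempty → ∃ x ∈ Q, ∀ y ∈ Q, ∀ z ∈ Q, F.Adj x y → F.Adj x z → y = z

lemma deg1_tree {k : ℕ} {F : SimpleGraph (Fin k)} (hF : F.IsTree) : Deg1 F := by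
  intro Q hQ
  obtain ⟨u, hu⟩ := hQ
  obtain ⟨x, hx, hmax⟩ := exists_max_image Q (fun v => F.dist u v) ⟨u, hu⟩
  obtain ⟨p, hp, hpd⟩ := hF.connected.exists_path_of_dist u x
  have key : ∀ y ∈ Q, F.Adj x y → y = p.penultimate := by
    intro y hy hxy
    refine hF.isAcyclic.eq_penultimate_of_adj_end hp hxy ?_
    obtain ⟨q, hq, hqd⟩ := hF.connected.exists_path_of_dist u y
    by_contra hcon
    have h1 : x ∈ q.support :=
      hF.isAcyclic.mem_support_of_ne_mem_support_of_adj_of_isPath hq hp hxy.symm hcon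
    have h2 := hF.isAcyclic.path_concat hp hq hxy h1
    have h3 := hmax y hy
    rw [← hpd, ← hqd, h2, SimpleGraph.Walk.length_concat] at h3
    omega
  exact ⟨x, hx, fun y hy z hz h1 h2 => (key y hy h1).trans (key z hz h2).symm⟩

/-- delete all edges at vertices of `X` -/
def iso {k : ℕ} (F : SimpleGraph (Fin k)) (X : Finset (Fin k)) : SimpleGraph (Fin k) where
  Adj a b := F.Adj a b ∧ a ∉ X ∧ b ∉ X
  symm := ⟨fun _ _ h => ⟨h.1.symm, h.2.2, h.2.1⟩⟩
  loopless := ⟨fun a h => F.loopless.irrefl a h.1⟩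

lemma deg1_mono {k : ℕ} {F F' : SimpleGraph (Fin k)} (hF : Deg1 F)
    (h : ∀ a b, F'.Adj a b → F.Adj a b) : Deg1 F' := by
  intro Q hQ
  obtain ⟨x, hx, hh⟩ := hF Q hQ
  exact ⟨x, hx, fun y hy z hz h1 h2 => hh y hy z hz (h _ _ h1) (h _ _ h2)⟩

lemma deg1_cycle {k : ℕ} (x0 : Fin k) (hx0 : x0.val = 0) :
    Deg1 (iso (SimpleGraph.cycleGraph k) {x0}) := by
  intro Q hQ
  obtain ⟨x, hx, hmax⟩ := exists_max_image Q (fun v => v.val) hQ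
  have key : ∀ y ∈ Q, (iso (SimpleGraph.cycleGraph k) {x0}).Adj x y → y.val + 1 = x.val := by
    intro y hy hxy
    obtain ⟨h1, h2, h3⟩ := hxy
    have h4 := hmax y hy
    rw [SimpleGraph.cycleGraph_adj'] at h1
    have h5 : y.val ≠ 0 := fun h => h3 (by simp [Fin.ext_iff, h, hx0])
    have hxk := x.isLt
    rw [Fin.sub_def, Fin.sub_def] at h1
    simp only at h1
    rcases h1 with h1 | h1
    · rw [show k - y.val + x.val = (x.val - y.val) + k by omega, Nat.add_mod_right,
        Nat.mod_eq_of_lt (by omega)] at h1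
      omega
    · rcases Nat.lt_or_ge y.val x.val with h | h
      · rw [Nat.mod_eq_of_lt (by omega)] at h1
        omega
      · rw [show k - x.val + y.val = k by omega, Nat.mod_self] at h1
        omega
  refine ⟨x, hx, fun y hy z hz h1 h2 => ?_⟩
  have := key y hy h1
  have := key z hz h2
  apply Fin.ext; omega

lemma embed {k n : ℕ} {F : SimpleGraph (Fin k)} {G : SimpleGraph (Fin n)} (hF : Deg1 F)
    {a : ℝ} (ha : 0 ≤ a) (hG : IndepBound G 2 a) (q : ℕ) :
    ∀ (Q : Finset (Fin k)) (S : Finset (Fin n)), Q.card = q → (q : ℝ) * a < S.card →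
      ∃ f : Fin k → Fin n, (∀ x ∈ Q, f x ∈ S) ∧ (∀ x ∈ Q, ∀ y ∈ Q, f x = f y → x = y) ∧
        ∀ x ∈ Q, ∀ y ∈ Q, F.Adj x y → G.Adj (f x) (f y) := by
  classical
  induction q with
  | zero =>
    intro Q S hQ hS
    rw [card_eq_zero] at hQ
    subst hQ
    have : S.Nonempty := by
      rw [← card_pos]
      have : (0:ℝ) < S.card := by simpa using hS
      exact_mod_cast this
    obtain ⟨s, -⟩ := this
    exact ⟨fun _ => s, by simp, by simp, by simp⟩
  | succ q ih =>
    intro Q S hQ hS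
    obtain ⟨x, hx, hxu⟩ := hF Q (card_pos.1 (by omega))
    -- maximal independent set
    have hne : S.Nonempty := by
      rw [← card_pos]
      have : (0:ℝ) < S.card := lt_of_le_of_lt (by positivity) hS
      exact_mod_cast this
    obtain ⟨I, hI, hImax⟩ := exists_max_image
      (S.powerset.filter (fun I => ∀ v ∈ I, ∀ w ∈ I, ¬ G.Adj v w)) card
      ⟨∅, by simp⟩
    simp only [mem_filter, mem_powerset] at hI hImax
    have hIa : (I.card : ℝ) ≤ a := by
      apply hG
      intro T hT hcl
      rw [SimpleGraph.isNClique_iff] at hcl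
      obtain ⟨v, w, hvw, rfl⟩ := card_eq_two.1 hcl.2
      exact hI.2 v (hT (by simp)) w (hT (by simp)) (hcl.1 (by simp) (by simp) hvw)
    have hdom : ∀ v ∈ S \ I, ∃ w ∈ I, G.Adj v w := by
      intro v hv
      by_contra hcon
      push Not at hcon
      rw [mem_sdiff] at hv
      have := hImax (insert v I) ⟨insert_subset hv.1 hI.1, by
        intro a ha b hb
        rcases mem_insert.1 ha with rfl | ha' <;> rcases mem_insert.1 hb with rfl | hb'
        · exact G.loopless.irrefl _
        · exact hcon b hb'
        · exact fun h => hcon a ha' h.symm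
        · exact hI.2 a ha' b hb'⟩
      rw [card_insert_of_notMem hv.2] at this
      omega
    have hIne : I.Nonempty := by
      rw [nonempty_iff_ne_empty]
      rintro rfl
      obtain ⟨s, hs⟩ := hne
      obtain ⟨w, hw, -⟩ := hdom s (by simpa using hs)
      simp at hw
    have hcS : ((S \ I).card : ℝ) = S.card - I.card := by
      rw [card_sdiff_of_subset hI.1, Nat.cast_sub (card_le_card hI.1)]
    obtain ⟨f, hf1, hf2, hf3⟩ := ih (Q.erase x) (S \ I) (by rw [card_erase_of_mem hx]; omega) (by
      push_cast at hS; linarith)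
    -- place x
    have : ∃ w ∈ I, ∀ y ∈ Q, F.Adj x y → G.Adj w (f y) := by
      by_cases h : ∃ y ∈ Q, F.Adj x y
      · obtain ⟨y, hy, hxy⟩ := h
        obtain ⟨w, hw, hyw⟩ := hdom (f y) (hf1 y (mem_erase.2 ⟨hxy.ne', hy⟩))
        refine ⟨w, hw, fun z hz hxz => ?_⟩
        rw [hxu z hz y hy hxz hxy]
        exact hyw.symm
      · push Not at h
        obtain ⟨w, hw⟩ := hIne
        exact ⟨w, hw, fun y hy hxy => absurd hxy (h y hy)⟩
    obtain ⟨w, hwI, hw⟩ := this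
    have hfI : ∀ y ∈ Q, y ≠ x → f y ≠ w := by
      intro y hy hyx h
      have := hf1 y (mem_erase.2 ⟨hyx, hy⟩)
      rw [h, mem_sdiff] at this
      exact this.2 hwI
    refine ⟨Function.update f x w, ?_, ?_, ?_⟩
    · intro y hy
      by_cases h : y = x
      · subst h; simpa using hI.1 hwI
      · rw [Function.update_of_ne h]
        exact (mem_sdiff.1 (hf1 y (mem_erase.2 ⟨h, hy⟩))).1
    · intro y hy z hz hyz
      by_cases h : y = x <;> by_cases h' : z = x
      · rw [h, h']
      · subst h; rw [Function.update_self, Function.update_of_ne h'] at hyz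
        exact absurd hyz.symm (hfI z hz h')
      · subst h'; rw [Function.update_self, Function.update_of_ne h] at hyz
        exact absurd hyz (hfI y hy h)
      · rw [Function.update_of_ne h, Function.update_of_ne h'] at hyz
        exact hf2 y (mem_erase.2 ⟨h, hy⟩) z (mem_erase.2 ⟨h', hz⟩) hyz
    · intro y hy z hz hyz
      by_cases h : y = x <;> by_cases h' : z = x
      · subst h; subst h'; exact absurd hyz (F.loopless.irrefl _)
      · subst h; rw [Function.update_self, Function.update_of_ne h']
        exact hw z hz hyz
      · subst h'; rw [Function.update_self, Function.update_of_ne h]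
        exact (hw y hy hyz.symm).symm
      · rw [Function.update_of_ne h, Function.update_of_ne h']
        exact hf3 y (mem_erase.2 ⟨h, hy⟩) z (mem_erase.2 ⟨h', hz⟩) hyz

lemma embed_all {k n : ℕ} {F : SimpleGraph (Fin k)} {G : SimpleGraph (Fin n)} (hF : Deg1 F)
    {a : ℝ} (ha : 0 ≤ a) (hG : IndepBound G 2 a) (S : Finset (Fin n))
    (hS : (k : ℝ) * a < S.card) :
    ∃ f : Fin k → Fin n, (∀ x, f x ∈ S) ∧ Function.Injective f ∧
        ∀ x y, F.Adj x y → G.Adj (f x) (f y) := by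
  obtain ⟨f, h1, h2, h3⟩ := embed hF ha hG k univ S (by simp) hS
  exact ⟨f, fun x => h1 x (mem_univ _), fun x y h => h2 x (mem_univ _) y (mem_univ _) h,
    fun x y h => h3 x (mem_univ _) y (mem_univ _) h⟩

def HH0 {k n : ℕ} (F : SimpleGraph (Fin k)) (G : SimpleGraph (Fin n)) (ε : ℝ) : Prop :=
  ∀ S : Finset (Fin n), ε * n ≤ S.card → ∃ g : Fin k → Fin n, Function.Injective g ∧
    SpansCopy F G (univ.image g) ∧ ∀ a, g a ∈ S

def HH1 {k n : ℕ} (F : SimpleGraph (Fin k)) (G : SimpleGraph (Fin n)) (x0 : Fin k)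
    (ε : ℝ) : Prop :=
  ∀ S : Finset (Fin n), ε * n ≤ S.card → ∃ T ⊆ S, T.card = k - 1 ∧
    ∀ v, (∀ w ∈ T, G.Adj v w) → ∃ g : Fin k → Fin n, Function.Injective g ∧
    SpansCopy F G (univ.image g) ∧ g x0 = v ∧ (∀ a, a ≠ x0 → g a ∈ T) ∧
    univ.image g = insert v T

def HH2 {k n : ℕ} (F : SimpleGraph (Fin k)) (G : SimpleGraph (Fin n)) (x0 x1 : Fin k)
    (ε : ℝ) : Prop :=
  ∀ S : Finset (Fin n), ε * n ≤ S.card → ∃ T ⊆ S, T.card = k - 1 ∧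
    ∀ a ∈ T, ∀ b ∈ T, a ≠ b → ∀ S' : Finset (Fin n), ε * n ≤ S'.card →
    (∀ w ∈ S', G.Adj a w ∧ G.Adj b w) → ∃ g : Fin k → Fin n, Function.Injective g ∧
    SpansCopy F G (univ.image g) ∧ g x0 = a ∧ g x1 = b ∧
    (∀ c, c ≠ x0 → c ≠ x1 → g c ∈ S')

lemma enum2 {k n : ℕ} (S : Finset (Fin n)) (hS : S.card = k) {a b : Fin n} (ha : a ∈ S)
    (hb : b ∈ S) (hab : a ≠ b) {x0 x1 : Fin k} (hx : x0 ≠ x1) :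
    ∃ g : Fin k → Fin n, Function.Injective g ∧ univ.image g = S ∧ g x0 = a ∧ g x1 = b := by
  classical
  let e : Fin k ≃ S := (S.equivFinOfCardEq hS).symm
  let e1 : Fin k ≃ S := e.trans (Equiv.swap (e x0) ⟨a, ha⟩)
  let e2 : Fin k ≃ S := e1.trans (Equiv.swap (e1 x1) ⟨b, hb⟩)
  have h1 : e1 x0 = ⟨a, ha⟩ := by simp [e1]
  have h2 : e2 x1 = ⟨b, hb⟩ := by simp [e2]
  have h3 : e2 x0 = ⟨a, ha⟩ := by
    simp only [e2, Equiv.trans_apply, h1]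
    apply Equiv.swap_apply_of_ne_of_ne
    · rw [← h1]; exact fun h => hx (e1.injective h)
    · simpa using hab
  refine ⟨fun x => (e2 x).1, fun x y h => e2.injective (Subtype.ext h), ?_, by simp [h3],
    by simp [h2]⟩
  ext v
  simp only [mem_image, mem_univ, true_and]
  constructor
  · rintro ⟨x, rfl⟩; exact (e2 x).2
  · intro hv; exact ⟨e2.symm ⟨v, hv⟩, by simp⟩

lemma spans_top {k n : ℕ} {G : SimpleGraph (Fin n)} {g : Fin k → Fin n}
    (hg : Function.Injective g) (h : G.IsClique (univ.image g : Finset (Fin n))) :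
    SpansCopy (⊤ : SimpleGraph (Fin k)) G (univ.image g) :=
  ⟨g, hg, fun a b hab => h (by simp) (by simp) (fun h => hab (hg h)), rfl⟩

lemma exists_clique {n r : ℕ} {G : SimpleGraph (Fin n)} {a : ℝ} (hG : IndepBound G r a)
    {S : Finset (Fin n)} (hS : a < S.card) : ∃ T ⊆ S, G.IsNClique r T := by
  by_contra hcon
  push Not at hcon
  exact absurd (hG S hcon) (not_le.2 hS)

/-- a clique of order `k-1` in each large set is enough for `HH1`, `HH2` when `F` is complete. -/
lemma top_HH1 {k n : ℕ} (hk : 3 ≤ k) {G : SimpleGraph (Fin n)} {x0 : Fin k} {ε : ℝ}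
    (h : ∀ S : Finset (Fin n), ε * n ≤ S.card → ∃ T ⊆ S, G.IsNClique (k - 1) T) :
    HH1 (⊤ : SimpleGraph (Fin k)) G x0 ε := by
  classical
  intro S hS
  obtain ⟨T, hTS, hT⟩ := h S hS
  rw [SimpleGraph.isNClique_iff] at hT
  refine ⟨T, hTS, hT.2, fun v hv => ?_⟩
  have hvT : v ∉ T := fun hh => G.loopless.irrefl _ (hv v hh)
  obtain ⟨b, hb⟩ : T.Nonempty := card_pos.1 (by omega)
  have : Nontrivial (Fin k) := Fin.nontrivial_iff_two_le.2 (by omega)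
  obtain ⟨x1, hx1⟩ := exists_ne x0
  obtain ⟨g, hg1, hg2, hg3, hg4⟩ := enum2 (insert v T) (by rw [card_insert_of_notMem hvT]; omega)
    (mem_insert_self v T) (mem_insert_of_mem hb) (fun h => hvT (h ▸ hb)) hx1.symm
  refine ⟨g, hg1, spans_top hg1 ?_, hg3, ?_, hg2⟩
  · rw [hg2, coe_insert, SimpleGraph.isClique_insert]
    exact ⟨hT.1, fun b hb _ => hv b hb⟩
  · intro a ha
    have : g a ∈ insert v T := hg2 ▸ mem_image_of_mem g (mem_univ a)
    rcases mem_insert.1 this with h | h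
    · exact absurd (hg1 (h.trans hg3.symm)) ha
    · exact h

lemma top_HH2 {k n : ℕ} (hk : 3 ≤ k) {G : SimpleGraph (Fin n)} {x0 x1 : Fin k} (hx : x0 ≠ x1)
    {ε : ℝ}
    (h : ∀ S : Finset (Fin n), ε * n ≤ S.card → ∃ T ⊆ S, G.IsNClique (k - 1) T) :
    HH2 (⊤ : SimpleGraph (Fin k)) G x0 x1 ε := by
  classical
  intro S hS
  obtain ⟨T, hTS, hT⟩ := h S hS
  rw [SimpleGraph.isNClique_iff] at hT
  refine ⟨T, hTS, hT.2, fun a ha b hb hab S' hS' hadj => ?_⟩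
  obtain ⟨T1, hT1S, hT1⟩ := h S' hS'
  rw [SimpleGraph.isNClique_iff] at hT1
  obtain ⟨T', hT'1, hT'⟩ := exists_subset_card_eq (s := T1) (n := k - 2) (by omega)
  have hbT : b ∉ T' := fun hh => G.loopless.irrefl _ (hadj b (hT1S (hT'1 hh))).2
  have haT : a ∉ insert b T' := by
    rw [mem_insert]
    rintro (h | h)
    · exact hab h
    · exact G.loopless.irrefl _ (hadj a (hT1S (hT'1 h))).1
  obtain ⟨g, hg1, hg2, hg3, hg4⟩ := enum2 (insert a (insert b T'))
    (by rw [card_insert_of_notMem haT, card_insert_of_notMem hbT]; omega)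
    (mem_insert_self _ _) (mem_insert_of_mem (mem_insert_self _ _)) hab hx
  refine ⟨g, hg1, spans_top hg1 ?_, hg3, hg4, ?_⟩
  · rw [hg2, coe_insert, SimpleGraph.isClique_insert, coe_insert, SimpleGraph.isClique_insert]
    refine ⟨⟨hT1.1.subset (by exact_mod_cast hT'1),
      fun c hc _ => (hadj c (hT1S (hT'1 hc))).2⟩, ?_⟩
    intro c hc _
    rcases hc with rfl | hc
    · exact hT.1 ha hb hab
    · exact (hadj c (hT1S (hT'1 hc))).1
  · intro c hc0 hc1
    have : g c ∈ insert a (insert b T') := hg2 ▸ mem_image_of_mem g (mem_univ c)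
    rcases mem_insert.1 this with h | h
    · exact absurd (hg1 (h.trans hg3.symm)) hc0
    · rcases mem_insert.1 h with h | h
      · exact absurd (hg1 (h.trans hg4.symm)) hc1
      · exact hT1S (hT'1 h)

lemma deg_HH1 {k n : ℕ} {F : SimpleGraph (Fin k)} {G : SimpleGraph (Fin n)} {x0 : Fin k}
    {ε : ℝ}
    (h : ∀ S : Finset (Fin n), ε * n ≤ S.card → ∃ f : Fin k → Fin n, (∀ x, f x ∈ S) ∧
      Function.Injective f ∧ ∀ x y, (iso F {x0}).Adj x y → G.Adj (f x) (f y)) :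
    HH1 F G x0 ε := by
  classical
  intro S hS
  obtain ⟨f, hf1, hf2, hf3⟩ := h S hS
  refine ⟨(univ.erase x0).image f, ?_, ?_, ?_⟩
  · intro v hv; obtain ⟨x, -, rfl⟩ := mem_image.1 hv; exact hf1 x
  · rw [card_image_of_injective _ hf2, card_erase_of_mem (mem_univ _)]; simp
  · intro v hv
    have hv' : ∀ a, a ≠ x0 → G.Adj v (f a) := fun a ha =>
      hv _ (mem_image_of_mem f (mem_erase.2 ⟨ha, mem_univ _⟩))
    have hinj : Function.Injective (Function.update f x0 v) := by
      intro a b hab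
      by_cases ha : a = x0 <;> by_cases hb : b = x0
      · rw [ha, hb]
      · subst ha; rw [Function.update_self, Function.update_of_ne hb] at hab
        exact absurd hab (hv' b hb).ne
      · subst hb; rw [Function.update_self, Function.update_of_ne ha] at hab
        exact absurd hab.symm (hv' a ha).ne
      · rw [Function.update_of_ne ha, Function.update_of_ne hb] at hab
        exact hf2 hab
    refine ⟨Function.update f x0 v, hinj, ⟨_, hinj, ?_, rfl⟩, by simp, ?_, ?_⟩
    · intro a b hab
      by_cases ha : a = x0 <;> by_cases hb : b = x0
      · subst ha; subst hb; exact absurd hab (F.loopless.irrefl _)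
      · subst ha; rw [Function.update_self, Function.update_of_ne hb]; exact hv' b hb
      · subst hb; rw [Function.update_self, Function.update_of_ne ha]; exact (hv' a ha).symm
      · rw [Function.update_of_ne ha, Function.update_of_ne hb]
        exact hf3 a b ⟨hab, by simpa using ha, by simpa using hb⟩
    · intro a ha
      rw [Function.update_of_ne ha]
      exact mem_image_of_mem f (mem_erase.2 ⟨ha, mem_univ _⟩)
    · ext w
      simp only [mem_image, mem_univ, true_and, mem_insert, mem_erase, and_true]
      constructor
      · rintro ⟨a, rfl⟩
        by_cases ha : a = x0
        · left; rw [ha, Function.update_self]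
        · right; exact ⟨a, ha, (Function.update_of_ne ha _ _).symm⟩
      · rintro (rfl | ⟨a, ha, rfl⟩)
        · exact ⟨x0, by simp⟩
        · exact ⟨a, Function.update_of_ne ha _ _⟩

lemma deg_HH2 {k n : ℕ} {F : SimpleGraph (Fin k)} {G : SimpleGraph (Fin n)} {x0 x1 : Fin k}
    (hx : x0 ≠ x1) (hF : ¬ F.Adj x0 x1) {ε : ℝ}
    (h : ∀ S : Finset (Fin n), ε * n ≤ S.card → ∃ f : Fin k → Fin n, (∀ x, f x ∈ S) ∧
      Function.Injective f ∧ ∀ x y, (iso F {x0}).Adj x y → G.Adj (f x) (f y)) :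
    HH2 F G x0 x1 ε := by
  classical
  intro S hS
  obtain ⟨f, hf1, hf2, hf3⟩ := h S hS
  refine ⟨(univ.erase x0).image f, ?_, ?_, ?_⟩
  · intro v hv; obtain ⟨x, -, rfl⟩ := mem_image.1 hv; exact hf1 x
  · rw [card_image_of_injective _ hf2, card_erase_of_mem (mem_univ _)]; simp
  · intro a _ b _ hab S' hS' hadj
    obtain ⟨f, hf1, hf2, hf3⟩ := h S' hS'
    have ha : ∀ c, G.Adj a (f c) := fun c => (hadj _ (hf1 c)).1
    have hb : ∀ c, G.Adj b (f c) := fun c => (hadj _ (hf1 c)).2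
    obtain ⟨g, hg⟩ : ∃ g : Fin k → Fin n, g = fun c => if c = x0 then a else if c = x1 then b
      else f c := ⟨_, rfl⟩
    have g0 : g x0 = a := by rw [hg]; simp
    have g1 : g x1 = b := by rw [hg]; simp [hx.symm]
    have g2 : ∀ c, c ≠ x0 → c ≠ x1 → g c = f c := by intro c h0 h1; rw [hg]; simp [h0, h1]
    have hinj : Function.Injective g := by
      intro c d hcd
      have A := fun c => (ha c).ne
      have B := fun c => (hb c).ne
      by_cases c0 : c = x0 <;> by_cases c1 : c = x1 <;> by_cases d0 : d = x0 <;>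
        by_cases d1 : d = x1 <;> grind
    refine ⟨g, hinj, ⟨g, hinj, ?_, rfl⟩, g0, g1, fun c h0 h1 => by rw [g2 c h0 h1]; exact hf1 c⟩
    intro c d hcd
    by_cases c0 : c = x0
    · subst c0
      have d0 : d ≠ c := hcd.ne'
      have d1 : d ≠ x1 := by rintro rfl; exact hF hcd
      rw [g0, g2 d d0 d1]; exact ha d
    by_cases d0 : d = x0
    · subst d0
      have c1 : c ≠ x1 := by rintro rfl; exact hF hcd.symm
      rw [g0, g2 c c0 c1]; exact (ha c).symm
    by_cases c1 : c = x1
    · subst c1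
      rw [g1, g2 d d0 hcd.ne']; exact hb d
    by_cases d1 : d = x1
    · subst d1
      rw [g1, g2 c c0 c1]; exact (hb c).symm
    rw [g2 c c0 c1, g2 d d0 d1]
    exact hf3 c d ⟨hcd, by simpa using c0, by simpa using d0⟩

lemma main_H {k r : ℕ} (hk : 3 ≤ k) {F : SimpleGraph (Fin k)} {η : ℝ}
    (hcase : (F = ⊤ ∧ r = k) ∨
     (F = ⊤ ∧ r = k - 1 ∧ 1 / (k : ℝ) ≤ η) ∨
     (F.IsTree ∧ r = 2) ∨
     (F = SimpleGraph.cycleGraph k ∧ r = 2 ∧ 1 / (k : ℝ) ≤ η)) :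
    ∃ x0 x1 : Fin k, x0 ≠ x1 ∧ ∀ ε : ℝ, 0 < ε → ∃ α : ℝ, 0 < α ∧ ∀ n : ℕ, 1 ≤ n →
      ∀ G : SimpleGraph (Fin n), IndepBound G r (α * n) →
      HH1 F G x0 ε ∧ (HH0 F G ε ∨ (HH2 F G x0 x1 ε ∧ 1 / (k : ℝ) ≤ η)) := by
  classical
  refine ⟨⟨0, by omega⟩, ⟨2, by omega⟩, by simp, fun ε hε => ⟨ε / (k + 1), by positivity, ?_⟩⟩
  intro n hn G hG
  have hkR : (3:ℝ) ≤ k := by exact_mod_cast hk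
  have hnR : (1:ℝ) ≤ n := by exact_mod_cast hn
  have hpos : 0 < ε * n := by positivity
  have hlt : ∀ S : Finset (Fin n), ε * n ≤ S.card → (k:ℝ) * (ε / (k + 1) * n) < S.card := by
    intro S hS
    refine lt_of_lt_of_le ?_ hS
    rw [show (k:ℝ) * (ε / (k + 1) * n) = (ε * n) * (k / (k + 1)) by ring]
    have : (k:ℝ) / (k + 1) < 1 := by rw [div_lt_one (by positivity)]; linarith
    nlinarith
  have ha : 0 ≤ ε / (k + 1) * n := by positivity
  have hlt1 : ∀ S : Finset (Fin n), ε * n ≤ S.card → (ε / (k + 1) * n) < S.card := by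
    intro S hS
    refine lt_of_le_of_lt ?_ (hlt S hS)
    nlinarith
  have caseK : F = ⊤ ∧ r = k - 1 ∧ 1 / (k : ℝ) ≤ η →
      HH1 F G ⟨0, by omega⟩ ε ∧ (HH0 F G ε ∨ (HH2 F G ⟨0, by omega⟩ ⟨2, by omega⟩ ε ∧
        1 / (k : ℝ) ≤ η)) := by
    rintro ⟨rfl, rfl, hη⟩
    have hc : ∀ S : Finset (Fin n), ε * n ≤ S.card → ∃ T ⊆ S, G.IsNClique (k - 1) T :=
      fun S hS => exists_clique hG (hlt1 S hS)
    exact ⟨top_HH1 hk hc, Or.inr ⟨top_HH2 hk (by simp) hc, hη⟩⟩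
  rcases hcase with ⟨rfl, rfl⟩ | h | ⟨hF, rfl⟩ | ⟨rfl, rfl, hη⟩
  · refine ⟨top_HH1 hk ?_, Or.inl ?_⟩
    · intro S hS
      obtain ⟨T, hT1, hT2⟩ := exists_clique hG (hlt1 S hS)
      rw [SimpleGraph.isNClique_iff] at hT2
      obtain ⟨T', hT'1, hT'⟩ := exists_subset_card_eq (s := T) (n := r - 1) (by omega)
      refine ⟨T', hT'1.trans hT1, ?_⟩
      rw [SimpleGraph.isNClique_iff]
      exact ⟨hT2.1.subset (by exact_mod_cast hT'1), hT'⟩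
    · intro S hS
      obtain ⟨T, hT1, hT2⟩ := exists_clique hG (hlt1 S hS)
      rw [SimpleGraph.isNClique_iff] at hT2
      let e : Fin r ≃ T := (T.equivFinOfCardEq hT2.2).symm
      have hinj : Function.Injective (fun x => (e x).1) :=
        fun x y h => e.injective (Subtype.ext h)
      refine ⟨fun x => (e x).1, hinj, spans_top hinj (hT2.1.subset ?_), fun a => hT1 (e a).2⟩
      intro v hv
      simp only [coe_image, coe_univ, Set.image_univ, Set.mem_range] at hv
      obtain ⟨x, rfl⟩ := hv
      exact (e x).2
  · exact caseK h
  · have hD := deg1_tree hF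
    refine ⟨deg_HH1 fun S hS => embed_all (deg1_mono (F' := iso F {⟨0, by omega⟩}) hD fun a b h => h.1) ha hG S (hlt S hS),
      Or.inl fun S hS => ?_⟩
    obtain ⟨f, h1, h2, h3⟩ := embed_all hD ha hG S (hlt S hS)
    exact ⟨f, h2, ⟨f, h2, h3, rfl⟩, h1⟩
  · rcases Nat.lt_or_ge 3 k with h3 | h3
    · have hh : ∀ S : Finset (Fin n), ε * n ≤ S.card → ∃ f : Fin k → Fin n, (∀ x, f x ∈ S) ∧
        Function.Injective f ∧ ∀ x y, (iso (SimpleGraph.cycleGraph k) {⟨0, by omega⟩}).Adj x y →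
          G.Adj (f x) (f y) :=
        fun S hS => embed_all (deg1_cycle _ rfl) ha hG S (hlt S hS)
      refine ⟨deg_HH1 hh, Or.inr ⟨deg_HH2 (by simp) ?_ hh, hη⟩⟩
      rw [SimpleGraph.cycleGraph_adj', Fin.sub_def, Fin.sub_def]
      simp only
      rintro (h | h)
      · rw [Nat.mod_eq_of_lt (by omega)] at h; omega
      · rw [show k - 0 + 2 = 2 + k by omega, Nat.add_mod_right, Nat.mod_eq_of_lt (by omega)] at h
        omega
    · obtain rfl : k = 3 := by omega
      exact caseK ⟨SimpleGraph.cycleGraph_three_eq_top, rfl, hη⟩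

end RTT

namespace RTT

lemma two_step {k n : ℕ} {F : SimpleGraph (Fin k)} {G : SimpleGraph (Fin n)} {m m' : ℝ} {t t' : ℕ}
    (hk : 3 ≤ k) (ht : 1 ≤ t) {u v : Fin n} (huv : u ≠ v) (X : Finset (Fin n))
    (hX : ∀ x ∈ X, FReachable F G m t x u ∧ FReachable F G m t x v)
    (hXc : m' + 2 < X.card) (hm : m' + 3 + (k * t : ℕ) ≤ m) (ht' : 2 * t ≤ t') :
    FReachable F G m' t' u v := by
  classical
  intro W hW
  have hc1 : ((W ∪ {u, v} : Finset (Fin n)).card : ℝ) ≤ m' + 2 := by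
    have : (W ∪ {u, v} : Finset (Fin n)).card ≤ W.card + 2 :=
      (card_union_le _ _).trans (by gcongr; exact card_le_two)
    have : ((W ∪ {u, v} : Finset (Fin n)).card : ℝ) ≤ W.card + 2 := by exact_mod_cast this
    linarith
  obtain ⟨x, hx, hxW⟩ : ∃ x ∈ X, x ∉ W ∪ {u, v} := by
    by_contra hcon
    push Not at hcon
    have := card_le_card (show X ⊆ W ∪ {u, v} from hcon)
    have : (X.card : ℝ) ≤ (W ∪ {u, v} : Finset (Fin n)).card := by exact_mod_cast this
    linarith
  simp only [mem_union, mem_insert, mem_singleton, not_or] at hxW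
  have hc2 : ((insert x (W ∪ {u, v} : Finset (Fin n))).card : ℝ) ≤ m' + 3 := by
    have : ((insert x (W ∪ {u, v} : Finset (Fin n))).card : ℝ) ≤
      (W ∪ {u, v} : Finset (Fin n)).card + 1 := by exact_mod_cast card_insert_le _ _
    linarith
  have hkt : (0 : ℝ) ≤ (k * t : ℕ) := by positivity
  obtain ⟨S1, a1, a2, a3, a4, a5, a6⟩ := (hX x hx).1 (insert x (W ∪ {u, v})) (by linarith)
  have hc3 : ((S1 ∪ insert x (W ∪ {u, v} : Finset (Fin n))).card : ℝ) ≤ m := by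
    have h1 : ((S1 ∪ insert x (W ∪ {u, v} : Finset (Fin n))).card : ℝ) ≤
      S1.card + (insert x (W ∪ {u, v} : Finset (Fin n))).card := by exact_mod_cast card_union_le _ _
    have h2 : (S1.card : ℝ) ≤ (k * t : ℕ) := by exact_mod_cast a4.trans (Nat.sub_le _ _)
    linarith
  obtain ⟨S2, b1, b2, b3, b4, b5, b6⟩ := (hX x hx).2 (S1 ∪ insert x (W ∪ {u, v})) hc3
  simp only [disjoint_union_right, disjoint_insert_right, disjoint_singleton_right] at a1 b1
  obtain ⟨a7, a8, a9, a10⟩ := a1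
  obtain ⟨b7, b8, b9, b10, b11⟩ := b1
  have hkt2 : 1 ≤ k * t := Nat.mul_pos (by omega) ht
  refine ⟨insert x (S1 ∪ S2), ?_, ?_, ?_, ?_, ?_, ?_⟩
  · rw [disjoint_insert_left, disjoint_union_left]; exact ⟨hxW.1, a8, b9⟩
  · simp only [mem_insert, mem_union, not_or]; exact ⟨Ne.symm hxW.2.1, a3, b10⟩
  · simp only [mem_insert, mem_union, not_or]; exact ⟨Ne.symm hxW.2.2, a10, b3⟩
  · have h1 := card_insert_le x (S1 ∪ S2)
    have h2 := card_union_le S1 S2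
    have h3 : k * (2 * t) ≤ k * t' := Nat.mul_le_mul_left k ht'
    have h4 : k * (2 * t) = 2 * (k * t) := by ring
    omega
  · have : insert u (insert x (S1 ∪ S2)) = insert u S1 ∪ insert x S2 := by ext z; simp only [mem_insert, mem_union]; tauto
    rw [this]
    refine tile_union a6 b5 ?_
    simp only [disjoint_insert_left, disjoint_insert_right, mem_insert, not_or]
    have := b7.symm; have := Ne.symm hxW.2.1; tauto
  · have : insert v (insert x (S1 ∪ S2)) = insert x S1 ∪ insert v S2 := by ext z; simp only [mem_insert, mem_union]; tauto
    rw [this]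
    refine tile_union a5 b6 ?_
    simp only [disjoint_insert_left, disjoint_insert_right, mem_insert, not_or]
    have := b7.symm; have := Ne.symm hxW.2.2; tauto

def Rob {k n d : ℕ} (F : SimpleGraph (Fin k)) (G : SimpleGraph (Fin n))
    (P : Fin d → Finset (Fin n)) (m : ℝ) (p : Fin k → Fin d) : Prop :=
  ∀ W : Finset (Fin n), (W.card : ℝ) ≤ m → ∃ g : Fin k → Fin n, Function.Injective g ∧
    SpansCopy F G (univ.image g) ∧ ∀ a, g a ∈ P (p a) ∧ g a ∉ W

lemma card_im {k n : ℕ} (g : Fin k → Fin n) : (univ.image g).card ≤ k := by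
  simpa using card_image_le (s := (univ : Finset (Fin k))) (f := g)

lemma merge {k n d : ℕ} {F : SimpleGraph (Fin k)} {G : SimpleGraph (Fin n)} {m m' M : ℝ}
    {t t' : ℕ} (hk : 3 ≤ k) (ht : 1 ≤ t) {P : Fin d → Finset (Fin n)}
    (hcl : ∀ i, FClosed F G m t (P i))
    {p q : Fin k → Fin d} (a0 : Fin k) (hpq : ∀ a, a ≠ a0 → p a = q a)
    (hp : Rob F G P M p) (hq : Rob F G P M q)
    (hM : m' + 2 + k ≤ M) (hm : m' + 2 + 2 * k + (k * t : ℕ) * (k + 1) ≤ m)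
    (ht' : (k + 3) * t ≤ t') {u w : Fin n} (huw : u ≠ w) (hu : u ∈ P (p a0)) (hw : w ∈ P (q a0)) :
    FReachable F G m' t' u w := by
  classical
  intro W hW
  have hc1 : ((W ∪ {u, w} : Finset (Fin n)).card : ℝ) ≤ m' + 2 := by
    have : (W ∪ {u, w} : Finset (Fin n)).card ≤ W.card + 2 :=
      (card_union_le _ _).trans (by gcongr; exact card_le_two)
    have : ((W ∪ {u, w} : Finset (Fin n)).card : ℝ) ≤ W.card + 2 := by exact_mod_cast this
    linarith
  have hk0 : (0 : ℝ) ≤ k := by positivity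
  obtain ⟨g, hg1, hg2, hg3⟩ := hp (W ∪ {u, w}) (by linarith)
  have hc2 : ((univ.image g ∪ (W ∪ {u, w}) : Finset (Fin n)).card : ℝ) ≤ m' + 2 + k := by
    have h1 : ((univ.image g ∪ (W ∪ {u, w}) : Finset (Fin n)).card : ℝ) ≤
      (univ.image g).card + (W ∪ {u, w} : Finset (Fin n)).card := by
        exact_mod_cast card_union_le _ _
    have h2 : ((univ.image g).card : ℝ) ≤ k := by exact_mod_cast card_im g
    linarith
  obtain ⟨g', hg1', hg2', hg3'⟩ := hq (univ.image g ∪ (W ∪ {u, w})) (by linarith)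
  have hc3 : ((univ.image g' ∪ (univ.image g ∪ (W ∪ {u, w})) : Finset (Fin n)).card : ℝ)
      ≤ m' + 2 + 2 * k := by
    have h1 : ((univ.image g' ∪ (univ.image g ∪ (W ∪ {u, w})) : Finset (Fin n)).card : ℝ) ≤
      (univ.image g').card + (univ.image g ∪ (W ∪ {u, w}) : Finset (Fin n)).card := by
        exact_mod_cast card_union_le _ _
    have h2 : ((univ.image g').card : ℝ) ≤ k := by exact_mod_cast card_im g'
    linarith
  simp only [mem_union, mem_insert, mem_singleton, mem_image, mem_univ, true_and, not_or,
    not_exists] at hg3 hg3'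
  have hgg : ∀ a b, g a ≠ g' b := fun a b h => (hg3' b).2.1 a h
  let x : Option (Fin k) → Fin n := fun o => o.elim (g' a0) (fun a => if a = a0 then u else g' a)
  let y : Option (Fin k) → Fin n := fun o => o.elim w g
  obtain ⟨Q, q1, q2, q3, q4⟩ := link (F := F) (G := G) (m := m) (t := t) univ x y
    (univ.image g' ∪ (univ.image g ∪ (W ∪ {u, w}))) (by
      rintro (_ | a) -
      · exact hcl (q a0) _ (hg3' a0).1 _ hw (hg3' a0).2.2.2.2
      · by_cases ha : a = a0
        · subst ha
          simp only [x, y, Option.elim_some, if_true]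
          exact hcl _ _ hu _ (hg3 a).1 (Ne.symm (hg3 a).2.2.1)
        · simp only [x, y, Option.elim_some, if_neg ha]
          refine hcl (q a) _ (hg3' a).1 _ ?_ (Ne.symm (hgg _ _))
          rw [← hpq a ha]; exact (hg3 a).1)
    (by
      rintro (_ | a) -
      · simp [x]
      · by_cases ha : a = a0 <;> simp [x, ha])
    (by
      rintro (_ | a) - <;> simp [y])
    (by
      rintro (_ | a) - (_ | b) - hab
      · exact absurd rfl hab
      · by_cases hb : b = a0
        · simp only [x, hb, Option.elim_none, Option.elim_some, if_true]; exact (hg3' a0).2.2.2.1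
        · simp only [x, hb, Option.elim_none, Option.elim_some, if_false]
          exact fun h => hb (hg1' h).symm
      · by_cases hb : a = a0
        · simp only [x, hb, Option.elim_none, Option.elim_some, if_true]
          exact Ne.symm (hg3' a0).2.2.2.1
        · simp only [x, hb, Option.elim_none, Option.elim_some, if_false]
          exact fun h => hb (hg1' h)
      · have hab' : a ≠ b := fun h => hab (by rw [h])
        by_cases ha : a = a0 <;> by_cases hb : b = a0
        · exact absurd (ha.trans hb.symm) hab'
        · simp only [x, ha, hb, Option.elim_some, if_true, if_false]
          exact Ne.symm (hg3' b).2.2.2.1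
        · simp only [x, ha, hb, Option.elim_some, if_true, if_false]
          exact (hg3' a).2.2.2.1
        · simp only [x, ha, hb, Option.elim_some, if_false]
          exact fun h => hab' (hg1' h))
    (by
      rintro (_ | a) - (_ | b) - hab
      · exact absurd rfl hab
      · exact Ne.symm (hg3 b).2.2.2
      · exact (hg3 a).2.2.2
      · exact fun h => hab (by rw [hg1 h]))
    (by
      simp only [card_univ, Fintype.card_option, Fintype.card_fin]
      push_cast at hm ⊢
      linarith)
  have hX : univ.image x = insert u (univ.image g') := by
    ext z
    simp only [mem_image, mem_univ, true_and, mem_insert, x]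
    constructor
    · rintro ⟨_ | a, rfl⟩
      · exact Or.inr ⟨a0, rfl⟩
      · by_cases ha : a = a0
        · left; simp [ha]
        · right; exact ⟨a, by simp [ha]⟩
    · rintro (rfl | ⟨a, rfl⟩)
      · exact ⟨some a0, by simp⟩
      · by_cases ha : a = a0
        · exact ⟨none, by simp [ha]⟩
        · exact ⟨some a, by simp [ha]⟩
  have hY : univ.image y = insert w (univ.image g) := by
    ext z
    simp only [mem_image, mem_univ, true_and, mem_insert, y]
    constructor
    · rintro ⟨_ | a, rfl⟩
      · exact Or.inl rfl
      · exact Or.inr ⟨a, rfl⟩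
    · rintro (rfl | ⟨a, rfl⟩)
      · exact ⟨none, by simp⟩
      · exact ⟨some a, by simp⟩
  rw [hX] at q3
  rw [hY] at q4
  simp only [disjoint_union_right, disjoint_insert_right, disjoint_singleton_right] at q1
  obtain ⟨c1, c2, c3, c4, c5⟩ := q1
  have hdis : Disjoint (univ.image g) (univ.image g') := by
    rw [disjoint_left]
    simp only [mem_image, mem_univ, true_and, not_exists]
    rintro _ ⟨a, rfl⟩ b h
    exact hgg a b h.symm
  have hug : u ∉ univ.image g := by
    simp only [mem_image, mem_univ, true_and, not_exists]; exact fun a => (hg3 a).2.2.1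
  have hwg : w ∉ univ.image g := by
    simp only [mem_image, mem_univ, true_and, not_exists]; exact fun a => (hg3 a).2.2.2
  have hug' : u ∉ univ.image g' := by
    simp only [mem_image, mem_univ, true_and, not_exists]; exact fun a => (hg3' a).2.2.2.1
  have hwg' : w ∉ univ.image g' := by
    simp only [mem_image, mem_univ, true_and, not_exists]; exact fun a => (hg3' a).2.2.2.2
  have hWg : Disjoint (univ.image g) W := by
    rw [disjoint_left]
    simp only [mem_image, mem_univ, true_and]
    rintro _ ⟨a, rfl⟩
    exact (hg3 a).2.1
  have hWg' : Disjoint (univ.image g') W := by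
    rw [disjoint_left]
    simp only [mem_image, mem_univ, true_and]
    rintro _ ⟨a, rfl⟩
    exact (hg3' a).2.2.1
  refine ⟨univ.image g ∪ univ.image g' ∪ Q, ?_, ?_, ?_, ?_, ?_, ?_⟩
  · rw [disjoint_union_left, disjoint_union_left]; exact ⟨⟨hWg, hWg'⟩, c3⟩
  · rw [mem_union, mem_union]; tauto
  · rw [mem_union, mem_union]; tauto
  · have h1 := card_union_le (univ.image g ∪ univ.image g') Q
    have h2 := card_union_le (univ.image g) (univ.image g')
    have h3 := card_im g
    have h4 := card_im g'
    simp only [card_univ, Fintype.card_option, Fintype.card_fin] at q2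
    have h5 : k * ((k + 3) * t) ≤ k * t' := Nat.mul_le_mul_left k ht'
    obtain ⟨s, hs⟩ : ∃ s, k * t = s + 1 := ⟨k * t - 1, by
      have := Nat.mul_pos (show 0 < k by omega) ht; omega⟩
    have h6 : k * ((k + 3) * t) = (k + 3) * (s + 1) := by rw [← hs]; ring
    rw [hs, Nat.add_sub_cancel] at q2
    have h7 : (k + 3) * (s + 1) = s * (k + 1) + 2 * s + k + 3 := by ring
    have h8 : k ≤ s + 1 := by rw [← hs]; exact Nat.le_mul_of_pos_right k ht
    have h9 : 2 * k + s * (k + 1) ≤ k * t' - 1 := by omega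
    omega
  · have : insert u (univ.image g ∪ univ.image g' ∪ Q) =
        univ.image g ∪ (insert u (univ.image g') ∪ Q) := by
      ext z; simp only [mem_insert, mem_union]; tauto
    rw [this]
    refine tile_union (tile_of_spans hg2) q3 ?_
    rw [disjoint_union_right, disjoint_insert_right]
    exact ⟨⟨hug, hdis⟩, c2.symm⟩
  · have : insert w (univ.image g ∪ univ.image g' ∪ Q) =
        univ.image g' ∪ (insert w (univ.image g) ∪ Q) := by
      ext z; simp only [mem_insert, mem_union]; tauto
    rw [this]
    refine tile_union (tile_of_spans hg2') q4 ?_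
    rw [disjoint_union_right, disjoint_insert_right]
    exact ⟨⟨hwg', hdis.symm⟩, c1.symm⟩

end RTT

namespace RTT

lemma part_abs {V : Type*} [Fintype V] [DecidableEq V] (R : ℕ → V → V → Prop)
    (hsymm : ∀ j x y, R j x y → R j y x) (hmono : ∀ j x y, R j x y → R (j + 1) x y) (c : ℕ)
    (h0 : ∀ I : Finset V, (∀ x ∈ I, ∀ y ∈ I, x ≠ y → ¬ R 0 x y) → I.card ≤ c) :
    ∃ j ≤ c, ∃ d ≤ c, ∃ v : Fin d → V, ∃ P : Fin d → Finset V,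
      (∀ a b, a ≠ b → v a ≠ v b ∧ ¬ R (j + 1) (v a) (v b)) ∧ (∀ a, v a ∈ P a) ∧
      (∀ a, ∀ x ∈ P a, ∀ y ∈ P a, x ≠ y → R j x y) ∧ (∀ a b, a ≠ b → Disjoint (P a) (P b)) ∧
      ∀ x, (∃ a, x ∈ P a) ∨ ∃ a b, a ≠ b ∧ R j x (v a) ∧ R j x (v b) := by
  classical
  let Q : ℕ → ℕ → Prop := fun j d => ∃ I : Finset V, I.card = d ∧
    ∀ x ∈ I, ∀ y ∈ I, x ≠ y → ¬ R j x y
  have hmono' : ∀ j x y, R 0 x y → R j x y := by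
    intro j x y h
    induction j with
    | zero => exact h
    | succ j ih => exact hmono _ _ _ ih
  obtain ⟨j, hj, d, hP, hnP⟩ : ∃ j ≤ c, ∃ d, Q (j + 1) d ∧ ¬ Q j (d + 1) := by
    by_contra hcon
    push Not at hcon
    have key : ∀ i, i ≤ c + 1 → Q (c + 1 - i) i := by
      intro i
      induction i with
      | zero => intro _; exact ⟨∅, by simp, by simp⟩
      | succ i ih =>
        intro hi
        refine hcon (c + 1 - (i + 1)) (by omega) i ?_
        have := ih (by omega)
        rwa [show c + 1 - (i + 1) + 1 = c + 1 - i by omega]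
    obtain ⟨I, hI, hI2⟩ := key (c + 1) le_rfl
    rw [Nat.sub_self] at hI2
    have := h0 I hI2
    omega
  obtain ⟨I, hI, hI2⟩ := hP
  have hI1 : ∀ x ∈ I, ∀ y ∈ I, x ≠ y → ¬ R j x y := fun x hx y hy hxy h =>
    hI2 x hx y hy hxy (hmono _ _ _ h)
  have hd : d ≤ c := by
    rw [← hI]
    exact h0 I fun x hx y hy hxy h => hI2 x hx y hy hxy (hmono' _ _ _ h)
  let e : Fin d ≃ I := (I.equivFinOfCardEq hI).symm
  let v : Fin d → V := fun a => (e a).1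
  have hvI : ∀ a, v a ∈ I := fun a => (e a).2
  have hvinj : ∀ a b, a ≠ b → v a ≠ v b := fun a b hab h => hab (e.injective (Subtype.ext h))
  have hvsur : ∀ x ∈ I, ∃ a, v a = x := fun x hx => ⟨e.symm ⟨x, hx⟩, by simp [v]⟩
  let rel : V → Fin d → Prop := fun x a => x = v a ∨ R j x (v a)
  let P : Fin d → Finset V := fun a => univ.filter fun x => rel x a ∧ ∀ b, b ≠ a → ¬ rel x b
  have hP : ∀ a x, x ∈ P a ↔ rel x a ∧ ∀ b, b ≠ a → ¬ rel x b := by intro a x; simp [P]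
  refine ⟨j, hj, d, hd, v, P, fun a b hab => ⟨hvinj a b hab, hI2 _ (hvI a) _ (hvI b) (hvinj a b hab)⟩,
    ?_, ?_, ?_, ?_⟩
  · intro a
    rw [hP]
    refine ⟨Or.inl rfl, ?_⟩
    rintro b hb (h | h)
    · exact hvinj b a hb h.symm
    · exact hI1 _ (hvI a) _ (hvI b) (hvinj a b hb.symm) h
  · intro a x hx y hy hxy
    rw [hP] at hx hy
    by_contra hR
    apply hnP
    have hx' : ∀ z ∈ I.erase (v a), x ≠ z ∧ ¬ R j x z := by
      intro z hz
      obtain ⟨hz1, hz2⟩ := mem_erase.1 hz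
      obtain ⟨b, rfl⟩ := hvsur z hz2
      have := hx.2 b (fun h => hz1 (by rw [h]))
      simpa only [rel, not_or] using this
    have hy' : ∀ z ∈ I.erase (v a), y ≠ z ∧ ¬ R j y z := by
      intro z hz
      obtain ⟨hz1, hz2⟩ := mem_erase.1 hz
      obtain ⟨b, rfl⟩ := hvsur z hz2
      have := hy.2 b (fun h => hz1 (by rw [h]))
      simpa only [rel, not_or] using this
    refine ⟨insert x (insert y (I.erase (v a))), ?_, ?_⟩
    · rw [card_insert_of_notMem, card_insert_of_notMem, card_erase_of_mem (hvI a), hI]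
      · have : 0 < d := a.pos
        omega
      · exact fun h => (hy' _ h).1 rfl
      · rw [mem_insert, not_or]
        exact ⟨hxy, fun h => (hx' _ h).1 rfl⟩
    · intro z hz w hw hzw
      rw [mem_insert, mem_insert] at hz hw
      rcases hz with rfl | rfl | hz <;> rcases hw with rfl | rfl | hw
      · exact absurd rfl hzw
      · exact hR
      · exact (hx' _ hw).2
      · exact fun h => hR (hsymm _ _ _ h)
      · exact absurd rfl hzw
      · exact (hy' _ hw).2
      · exact fun h => (hx' _ hz).2 (hsymm _ _ _ h)
      · exact fun h => (hy' _ hz).2 (hsymm _ _ _ h)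
      · exact hI1 _ (mem_of_mem_erase hz) _ (mem_of_mem_erase hw) hzw
  · intro a b hab
    rw [disjoint_left]
    intro x hx hx'
    rw [hP] at hx hx'
    exact hx.2 b hab.symm hx'.1
  · intro x
    by_cases h1 : ∃ a, rel x a
    · obtain ⟨a, ha⟩ := h1
      by_cases h2 : ∀ b, b ≠ a → ¬ rel x b
      · exact Or.inl ⟨a, (hP a x).2 ⟨ha, h2⟩⟩
      · push Not at h2
        obtain ⟨b, hb, hb2⟩ := h2
        right
        refine ⟨a, b, hb.symm, ?_, ?_⟩
        · rcases ha with rfl | h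
          · exfalso
            rcases hb2 with h | h
            · exact hvinj a b hb.symm h
            · exact hI1 _ (hvI a) _ (hvI b) (hvinj a b hb.symm) h
          · exact h
        · rcases hb2 with rfl | h
          · exfalso
            rcases ha with h | h
            · exact hvinj b a hb h
            · exact hI1 _ (hvI b) _ (hvI a) (hvinj b a hb) h
          · exact h
    · exfalso
      push Not at h1
      have hx' : ∀ z ∈ I, x ≠ z ∧ ¬ R j x z := by
        intro z hz
        obtain ⟨b, rfl⟩ := hvsur z hz
        have := h1 b
        simpa only [rel, not_or] using this
      apply hnP
      refine ⟨insert x I, ?_, ?_⟩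
      · rw [card_insert_of_notMem (fun h => (hx' _ h).1 rfl), hI]
      · intro z hz w hw hzw
        rw [mem_insert] at hz hw
        rcases hz with rfl | hz <;> rcases hw with rfl | hw
        · exact absurd rfl hzw
        · exact (hx' _ hw).2
        · exact fun h => (hx' _ hz).2 (hsymm _ _ _ h)
        · exact hI1 _ hz _ hw hzw

/-- Base reachability from a large common neighbourhood. -/
lemma base_reach {k n : ℕ} {F : SimpleGraph (Fin k)} {G : SimpleGraph (Fin n)} {x0 : Fin k}
    {ε m : ℝ} (hH : HH1 F G x0 ε) (hk : 3 ≤ k) {u v : Fin n}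
    (hc : m + 2 + ε * n ≤ ((nb G u ∩ nb G v).card : ℝ)) : FReachable F G m 1 u v := by
  classical
  intro W hW
  have h1 : ((nb G u ∩ nb G v).card : ℝ) ≤ ((nb G u ∩ nb G v) \ W).card + W.card := by
    exact_mod_cast card_le_card_sdiff_add_card
  obtain ⟨T, hT, hTc, hT2⟩ := hH ((nb G u ∩ nb G v) \ W) (by linarith)
  have hT' : ∀ w ∈ T, G.Adj u w ∧ G.Adj v w ∧ w ∉ W := by
    intro w hw
    have := hT hw
    simp only [mem_sdiff, mem_inter, mem_nb] at this
    tauto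
  refine ⟨T, disjoint_left.2 fun w hw => (hT' w hw).2.2, fun h => G.irrefl (hT' u h).1,
    fun h => G.irrefl (hT' v h).2.1, by omega, ?_, ?_⟩
  · obtain ⟨g, -, g2, -, -, g3⟩ := hT2 u fun w hw => (hT' w hw).1
    rw [← g3]; exact tile_of_spans g2
  · obtain ⟨g, -, g2, -, -, g3⟩ := hT2 v fun w hw => (hT' w hw).2.1
    rw [← g3]; exact tile_of_spans g2

/-- inclusion-exclusion style bound -/
lemma sum_card_le {ι V : Type*} [DecidableEq V] [DecidableEq ι] (I : Finset ι) (N : ι → Finset V) (U : Finset V)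
    (hU : ∀ i ∈ I, N i ⊆ U) (s : ℝ) (hs : 0 ≤ s)
    (hN : ∀ i ∈ I, ∀ j ∈ I, i ≠ j → ((N i ∩ N j).card : ℝ) ≤ s) :
    ∑ i ∈ I, ((N i).card : ℝ) ≤ U.card + I.card ^ 2 * s := by
  suffices h : ∑ i ∈ I, ((N i).card : ℝ) ≤ (I.biUnion N).card + I.card ^ 2 * s by
    have h2 : ((I.biUnion N).card : ℝ) ≤ U.card := by
      exact_mod_cast card_le_card (biUnion_subset.2 hU)
    linarith
  clear hU
  induction I using Finset.induction_on with
  | empty => simp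
  | insert a I ha ih =>
    have ih' := ih fun i hi j hj => hN i (mem_insert_of_mem hi) j (mem_insert_of_mem hj)
    rw [sum_insert ha, biUnion_insert, card_insert_of_notMem ha]
    have h1 : ((N a).card : ℝ) + (I.biUnion N).card =
        ((N a ∪ I.biUnion N).card : ℝ) + (N a ∩ I.biUnion N).card := by
      exact_mod_cast (card_union_add_card_inter _ _).symm
    have h2 : ((N a ∩ I.biUnion N).card : ℝ) ≤ I.card * s := by
      rw [inter_biUnion]
      have h3 : ((I.biUnion fun i => N a ∩ N i).card : ℝ) ≤ ∑ i ∈ I, ((N a ∩ N i).card : ℝ) := by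
        exact_mod_cast card_biUnion_le
      refine h3.trans ?_
      have := sum_le_card_nsmul I (fun i => ((N a ∩ N i).card : ℝ)) s (fun i hi =>
        hN a (mem_insert_self _ _) i (mem_insert_of_mem hi) (by rintro rfl; exact ha hi))
      rwa [nsmul_eq_mul] at this
    push_cast
    nlinarith [mul_nonneg (Nat.cast_nonneg (α := ℝ) I.card) hs]

end RTT

namespace RTT

lemma partition {k n : ℕ} {F : SimpleGraph (Fin k)} {G : SimpleGraph (Fin n)} {x0 : Fin k}
    {ε η μ β : ℝ} (hk : 3 ≤ k) (hη : 0 < η) (hμ : 0 < μ) (hβ : 0 < β) (c : ℕ) (hc : c = ⌊1 / η⌋₊)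
    (hβμ : 3 * (c + 1) * β ≤ μ) (hε : ε ≤ β) (hH : HH1 F G x0 ε)
    (hmin : MinDegGE G ((η + μ) * n))
    (hn : 10 * (k : ℝ) + k * (k + 3) ^ c * (k + 1) ≤ β / 2 ^ (c + 1) * n) :
    ∃ d ≤ c, ∃ P : Fin d → Finset (Fin n),
      (∀ a, FClosed F G (β / 2 ^ (c + 1) * n) ((k + 3) ^ c) (P a)) ∧
      (∀ a b, a ≠ b → Disjoint (P a) (P b)) ∧
      ((univ \ univ.biUnion P).card : ℝ) ≤ c ^ 2 * (β * n) ∧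
      ∀ p q : Fin k → Fin d, ∀ a0, (∀ a, a ≠ a0 → p a = q a) → p a0 ≠ q a0 →
        Rob F G P (β * n) p → Rob F G P (β * n) q → False := by
  classical
  have hk0 : (3 : ℝ) ≤ k := by exact_mod_cast hk
  have hpow : ∀ j : ℕ, (0 : ℝ) < 2 ^ j := fun j => by positivity
  have hK : (0 : ℝ) ≤ k * (k + 3) ^ c * (k + 1) := by positivity
  have hn0 : (0 : ℝ) < n := by
    rcases Nat.eq_zero_or_pos n with h | h
    · subst h; push_cast at hn; rw [mul_zero] at hn; linarith
    · exact_mod_cast h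
  have hle : ∀ j ≤ c + 1, β / 2 ^ (c + 1) ≤ β / 2 ^ j := fun j hj =>
    div_le_div_of_nonneg_left hβ.le (hpow j) (pow_le_pow_right₀ (by norm_num) hj)
  have hhalf : ∀ j : ℕ, β / 2 ^ j * n = 2 * (β / 2 ^ (j + 1) * n) := by
    intro j; rw [pow_succ]; field_simp
  have hle1 : ∀ j ≤ c + 1, 10 * (k : ℝ) + k * (k + 3) ^ c * (k + 1) ≤ β / 2 ^ j * n := fun j hj =>
    hn.trans (mul_le_mul_of_nonneg_right (hle j hj) hn0.le)
  have hbig : 10 * (k : ℝ) + k * (k + 3) ^ c * (k + 1) ≤ β * n := by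
    simpa using hle1 0 (by omega)
  obtain ⟨j, hj, d, hd, v, P, h1, h2, h3, h4, h5⟩ := part_abs
    (fun j u v => FReachable F G (β / 2 ^ j * n) ((k + 3) ^ j) u v)
    (fun j x y => reach_symm)
    (fun j x y => reach_mono (by
      have := hhalf j
      have : 0 < β / 2 ^ (j + 1) * n := by positivity
      linarith) (Nat.pow_le_pow_right (by omega) (by omega))) c (by
      intro I hI
      by_contra hcon
      push Not at hcon
      obtain ⟨I', hI', hIc⟩ := exists_subset_card_eq (show c + 1 ≤ I.card by omega)
      have hsum := sum_card_le I' (nb G) univ (fun _ _ => subset_univ _) (3 * β * n) (by positivity)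
        (by
          intro x hx y hy hxy
          by_contra hcon2
          push Not at hcon2
          refine hI x (hI' hx) y (hI' hy) hxy ?_
          simp only [pow_zero, div_one]
          refine base_reach hH hk ?_
          have : ε * n ≤ β * n := mul_le_mul_of_nonneg_right hε hn0.le
          linarith)
      have hsum2 := card_nsmul_le_sum I' (fun x => ((nb G x).card : ℝ)) ((η + μ) * n) (by
        intro x _; rw [nb_card]; exact hmin x)
      rw [nsmul_eq_mul, hIc] at hsum2
      rw [hIc, card_univ, Fintype.card_fin] at hsum
      push_cast at hsum hsum2
      have h6 : 1 < (c + 1 : ℝ) * η := by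
        have := Nat.lt_floor_add_one (1 / η)
        rw [← hc, div_lt_iff₀ hη] at this
        exact this
      have h7 : (c + 1 : ℝ) ^ 2 * (3 * β * n) ≤ (c + 1) * μ * n := by
        have : (c + 1 : ℝ) ^ 2 * (3 * β * n) = (3 * (c + 1) * β) * ((c + 1) * n) := by ring
        rw [this]
        have : (c + 1) * μ * n = μ * ((c + 1) * n) := by ring
        rw [this]
        exact mul_le_mul_of_nonneg_right hβμ (by positivity)
      have h8 : (n : ℝ) * 1 < n * ((c + 1 : ℝ) * η) := mul_lt_mul_of_pos_left h6 hn0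
      nlinarith)
  have ht1 : 1 ≤ (k + 3) ^ j := Nat.one_le_pow _ _ (by omega)
  have htc : (k + 3) ^ j ≤ (k + 3) ^ c := Nat.pow_le_pow_right (by omega) hj
  have htc' : (((k + 3) ^ j : ℕ) : ℝ) ≤ (k + 3) ^ c := by exact_mod_cast htc
  have hkt : ((k * (k + 3) ^ j : ℕ) : ℝ) ≤ k * (k + 3) ^ c := by
    push_cast at htc' ⊢
    exact mul_le_mul_of_nonneg_left htc' (by linarith)
  have hj1 := hle1 (j + 1) (by omega)
  have hj2 := hhalf j
  have hj3 : β / 2 ^ (j + 1) * n ≤ β * n / 2 := by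
    have : β / 2 ^ (j + 1) ≤ β / 2 ^ 1 :=
      div_le_div_of_nonneg_left hβ.le (hpow 1) (pow_le_pow_right₀ (by norm_num) (by omega))
    have := mul_le_mul_of_nonneg_right this hn0.le
    rw [pow_one] at this
    linarith
  refine ⟨d, hd, P, ?_, h4, ?_, ?_⟩
  · intro a x hx y hy hxy
    exact reach_mono (mul_le_mul_of_nonneg_right (hle j (by omega)) hn0.le) htc (h3 a x hx y hy hxy)
  · let X : Fin d × Fin d → Finset (Fin n) := fun ab => univ.filter fun x => ab.1 ≠ ab.2 ∧
      FReachable F G (β / 2 ^ j * n) ((k + 3) ^ j) x (v ab.1) ∧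
      FReachable F G (β / 2 ^ j * n) ((k + 3) ^ j) x (v ab.2)
    have hX : ∀ ab, ((X ab).card : ℝ) ≤ β * n := by
      rintro ⟨a, b⟩
      by_contra hcon
      push Not at hcon
      have hab : a ≠ b := by
        intro hab
        have : X (a, b) = ∅ := by simp [X, hab]
        rw [this] at hcon
        have : 0 < β * n := by positivity
        simp at hcon; linarith
      refine (h1 a b hab).2 (two_step (m := β / 2 ^ j * n) (t := (k + 3) ^ j) hk ht1
        (h1 a b hab).1 (X (a, b)) ?_ ?_ ?_ ?_)
      · intro x hx
        simp only [X, mem_filter] at hx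
        exact hx.2.2
      · linarith
      · have : (0 : ℝ) ≤ k * (k + 3) ^ c := by positivity
        nlinarith
      · rw [pow_succ]; nlinarith
    have hsub : univ \ univ.biUnion P ⊆ univ.biUnion X := by
      intro x hx
      simp only [mem_sdiff, mem_univ, mem_biUnion, true_and, not_exists] at hx
      rcases h5 x with ⟨a, ha⟩ | ⟨a, b, hab, ha, hb⟩
      · exact absurd ha (hx a)
      · simp only [mem_biUnion, mem_univ, true_and]
        exact ⟨(a, b), by simp only [X, mem_filter, mem_univ, true_and]; exact ⟨hab, ha, hb⟩⟩
    have e1 : ((univ \ univ.biUnion P).card : ℝ) ≤ ∑ ab, ((X ab).card : ℝ) := by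
      exact_mod_cast (card_le_card hsub).trans card_biUnion_le
    have e2 := sum_le_card_nsmul univ (fun ab => ((X ab).card : ℝ)) (β * n) (fun ab _ => hX ab)
    rw [nsmul_eq_mul, card_univ, Fintype.card_prod, Fintype.card_fin] at e2
    push_cast at e2
    have e3 : (d : ℝ) ≤ c := by exact_mod_cast hd
    have e4 : (d : ℝ) * d ≤ c ^ 2 := by
      rw [sq]; exact mul_le_mul e3 e3 (by positivity) (by positivity)
    have e5 : (d : ℝ) * d * (β * n) ≤ c ^ 2 * (β * n) :=
      mul_le_mul_of_nonneg_right e4 (by positivity)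
    linarith
  · intro p q a0 hpq hne hp hq
    obtain ⟨h6, h7⟩ := h1 _ _ hne
    refine h7 (merge (m := β / 2 ^ j * n) (t := (k + 3) ^ j) hk ht1 (P := P) h3 a0 hpq hp hq ?_ ?_ ?_
      h6 (h2 _) (h2 _))
    · linarith
    · have : ((k * (k + 3) ^ j : ℕ) : ℝ) * (k + 1) ≤ k * (k + 3) ^ c * (k + 1) :=
        mul_le_mul_of_nonneg_right hkt (by linarith)
      linarith
    · rw [pow_succ]; exact le_of_eq (mul_comm _ _)

end RTT

namespace RTT

noncomputable def gd {n d : ℕ} (G : SimpleGraph (Fin n)) (P : Fin d → Finset (Fin n)) (θ : ℝ)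
    (i j : Fin d) : Finset (Fin n) := by
  classical exact (P i).filter fun v => θ * n ≤ ((nb G v ∩ P j).card : ℝ)

lemma mem_gd {n d : ℕ} {G : SimpleGraph (Fin n)} {P : Fin d → Finset (Fin n)} {θ : ℝ}
    {i j : Fin d} {v : Fin n} :
    v ∈ gd G P θ i j ↔ v ∈ P i ∧ θ * n ≤ ((nb G v ∩ P j).card : ℝ) := by
  classical simp [gd]

lemma rob_of_gd {k n d : ℕ} {F : SimpleGraph (Fin k)} {G : SimpleGraph (Fin n)} {x0 : Fin k}
    {P : Fin d → Finset (Fin n)} {θ ρ β ε : ℝ} (hH : HH1 F G x0 ε) (hn : (0 : ℝ) < n)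
    (h1 : β < ρ) (h2 : β + ε ≤ θ) {i j : Fin d} (h : ρ * n ≤ (gd G P θ i j).card) :
    Rob F G P (β * n) (Function.update (fun _ => j) x0 i) := by
  classical
  intro W hW
  obtain ⟨v, hv, hvW⟩ : ∃ v ∈ gd G P θ i j, v ∉ W := by
    by_contra hcon
    push Not at hcon
    have := card_le_card (show gd G P θ i j ⊆ W from hcon)
    have : ((gd G P θ i j).card : ℝ) ≤ W.card := by exact_mod_cast this
    nlinarith
  rw [mem_gd] at hv
  have h3 : ((nb G v ∩ P j).card : ℝ) ≤ ((nb G v ∩ P j) \ W).card + W.card := by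
    exact_mod_cast card_le_card_sdiff_add_card
  obtain ⟨T, hT, hTc, hT2⟩ := hH ((nb G v ∩ P j) \ W) (by nlinarith)
  have hT' : ∀ w ∈ T, G.Adj v w ∧ w ∈ P j ∧ w ∉ W := by
    intro w hw
    have := hT hw
    simp only [mem_sdiff, mem_inter, mem_nb] at this
    tauto
  obtain ⟨g, g1, g2, g3, g4, g5⟩ := hT2 v fun w hw => (hT' w hw).1
  refine ⟨g, g1, g2, fun a => ?_⟩
  by_cases ha : a = x0
  · subst ha; rw [Function.update_self, g3]; exact ⟨hv.1, hvW⟩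
  · rw [Function.update_of_ne ha]; exact (hT' _ (g4 a ha)).2

lemma gd_flip {n d : ℕ} {G : SimpleGraph (Fin n)}
    {P : Fin d → Finset (Fin n)} {θ ρ θ' ρ' : ℝ} (hn : (0 : ℝ) < n)
    (hθ : 0 < θ) (hθ' : 0 < θ') (h3 : θ' + ρ' ≤ ρ * θ)
    {i j : Fin d} (h : ρ * n ≤ (gd G P θ i j).card) : ρ' * n ≤ (gd G P θ' j i).card := by
  classical
  by_contra hcon
  push Not at hcon
  have hcc : ∑ v ∈ P i, ((nb G v ∩ P j).card : ℝ) = ∑ w ∈ P j, ((nb G w ∩ P i).card : ℝ) := by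
    have h5 := sum_card_bipartiteAbove_eq_sum_card_bipartiteBelow (s := P i) (t := P j) (fun v w => G.Adj v w)
    have e1 : ∀ v, bipartiteAbove (fun v w => G.Adj v w) (P j) v = nb G v ∩ P j := by
      intro v; ext w; simp [bipartiteAbove, mem_nb, and_comm]
    have e2 : ∀ w, bipartiteBelow (fun v w => G.Adj v w) (P i) w = nb G w ∩ P i := by
      intro v; ext w; simp [bipartiteBelow, mem_nb, and_comm, G.adj_comm]
    simp only [e1, e2] at h5
    exact_mod_cast h5
  have l1 : ρ * n * (θ * n) ≤ ∑ v ∈ P i, ((nb G v ∩ P j).card : ℝ) := by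
    have a1 : ∑ v ∈ gd G P θ i j, ((nb G v ∩ P j).card : ℝ) ≤ ∑ v ∈ P i, ((nb G v ∩ P j).card : ℝ) :=
      sum_le_sum_of_subset_of_nonneg (fun v hv => (mem_gd.1 hv).1) (by intros; positivity)
    have a2 := card_nsmul_le_sum (gd G P θ i j) (fun v => ((nb G v ∩ P j).card : ℝ)) (θ * n)
      (fun v hv => (mem_gd.1 hv).2)
    rw [nsmul_eq_mul] at a2
    have := mul_le_mul_of_nonneg_right h (show 0 ≤ θ * n by positivity)
    linarith
  have l2 : ∑ w ∈ P j, ((nb G w ∩ P i).card : ℝ) ≤ (gd G P θ' j i).card * n + n * (θ' * n) := by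
    have a1 : ∀ w ∈ P j, ((nb G w ∩ P i).card : ℝ) ≤
        (if w ∈ gd G P θ' j i then (n : ℝ) else 0) + θ' * n := by
      intro w hw
      split_ifs with hh
      · have : ((nb G w ∩ P i).card : ℝ) ≤ n := by
          have := card_le_univ (nb G w ∩ P i)
          rw [Fintype.card_fin] at this
          exact_mod_cast this
        have : 0 ≤ θ' * n := by positivity
        linarith
      · rw [mem_gd] at hh
        push Not at hh
        have := hh hw
        linarith
    refine (sum_le_sum a1).trans ?_
    rw [sum_add_distrib, sum_ite, sum_const_zero, add_zero, sum_const, sum_const, nsmul_eq_mul,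
      nsmul_eq_mul]
    have b1 : ((P j).filter fun w => w ∈ gd G P θ' j i).card ≤ (gd G P θ' j i).card :=
      card_le_card fun w hw => (mem_filter.1 hw).2
    have b2 : (P j).card ≤ n := by
      have := card_le_univ (P j)
      rwa [Fintype.card_fin] at this
    have b1' : (((P j).filter fun w => w ∈ gd G P θ' j i).card : ℝ) ≤ (gd G P θ' j i).card := by
      exact_mod_cast b1
    have b2' : ((P j).card : ℝ) ≤ n := by exact_mod_cast b2
    gcongr
  have l3 : ((gd G P θ' j i).card : ℝ) * n < ρ' * n * n := mul_lt_mul_of_pos_right hcon hn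
  have l4 : (θ' + ρ') * (n * n) ≤ ρ * θ * (n * n) := mul_le_mul_of_nonneg_right h3 (by positivity)
  nlinarith

lemma gd_mono {n d : ℕ} {G : SimpleGraph (Fin n)}
    {P : Fin d → Finset (Fin n)} {θ ρ θ' ρ' : ℝ} (h1 : θ' ≤ θ) (h2 : ρ' ≤ ρ)
    {i j : Fin d} (h : ρ * n ≤ (gd G P θ i j).card) : ρ' * n ≤ (gd G P θ' i j).card := by
  have hn : (0 : ℝ) ≤ n := by positivity
  have : (gd G P θ i j).card ≤ (gd G P θ' i j).card := by
    refine card_le_card fun v hv => ?_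
    rw [mem_gd] at hv ⊢
    exact ⟨hv.1, (mul_le_mul_of_nonneg_right h1 hn).trans hv.2⟩
  have : ((gd G P θ i j).card : ℝ) ≤ (gd G P θ' i j).card := by exact_mod_cast this
  have := mul_le_mul_of_nonneg_right h2 hn
  linarith

lemma card_biUnion_bound {V : Type*} {d c : ℕ} [DecidableEq V] (hd : d ≤ c) (I : Finset (Fin d))
    (X : Fin d → Finset V) (s : ℝ) (hs : 0 ≤ s) (h : ∀ i ∈ I, ((X i).card : ℝ) ≤ s) :
    ((I.biUnion X).card : ℝ) ≤ c * s := by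
  have h1 : ((I.biUnion X).card : ℝ) ≤ ∑ i ∈ I, ((X i).card : ℝ) := by
    exact_mod_cast card_biUnion_le
  have h2 := sum_le_card_nsmul I (fun i => ((X i).card : ℝ)) s h
  rw [nsmul_eq_mul] at h2
  have h3 : I.card ≤ c := (card_le_univ I).trans (by simpa using hd)
  have h4 : (I.card : ℝ) ≤ c := by exact_mod_cast h3
  have := mul_le_mul_of_nonneg_right h4 hs
  linarith

end RTT

namespace RTT

set_option maxHeartbeats 1000000 in
lemma structure_lem {k n c d : ℕ} {F : SimpleGraph (Fin k)} {G : SimpleGraph (Fin n)}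
    {x0 x1 : Fin k} {P : Fin d → Finset (Fin n)} {η μ θ ρ lam θ' ρ' β ε τ : ℝ}
    (hk : 3 ≤ k) (hx : x0 ≠ x1) (hn : (0 : ℝ) < n) (hη : 0 < η) (hμ : 0 < μ) (hd : d ≤ c)
    (hH1 : HH1 F G x0 ε) (hH : HH0 F G ε ∨ (HH2 F G x0 x1 ε ∧ 1 / (k : ℝ) ≤ η))
    (hmin : MinDegGE G ((η + μ) * n))
    (hdis : ∀ a b, a ≠ b → Disjoint (P a) (P b))
    (hV0 : ((univ \ univ.biUnion P).card : ℝ) ≤ c ^ 2 * (β * n))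
    (hno : ∀ p q : Fin k → Fin d, ∀ a0, (∀ a, a ≠ a0 → p a = q a) → p a0 ≠ q a0 →
        Rob F G P (β * n) p → Rob F G P (β * n) q → False)
    (hθ : 0 < θ) (hρ : 0 < ρ) (hθ' : 0 < θ') (hβ : 0 < β) (hε : 0 < ε)
    (p1 : c ^ 2 * β + c * θ ≤ μ / 2) (p2 : lam ≤ θ)
    (p3 : θ' + ρ' ≤ ρ * θ) (p3' : θ' ≤ θ) (p3'' : ρ' ≤ ρ) (p4 : β < ρ') (p4' : β + ε ≤ θ')
    (p5 : c * ρ + β + ε ≤ lam) (p6 : 4 * k * β < μ) (p6' : ε ≤ β)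
    (p7 : c ^ 2 * β + 2 * c * lam ≤ τ) :
    ∃ D : Fin d → Finset (Fin n), (∀ i, D i ⊆ P i) ∧
      (∀ i, ∀ v ∈ D i, Rob F G P (β * n) (fun _ => i) ∧ (η + μ / 2) * n ≤ ((nb G v ∩ P i).card : ℝ)) ∧
      ((univ \ univ.biUnion D).card : ℝ) ≤ τ * n := by
  classical
  have hk0 : (3 : ℝ) ≤ k := by exact_mod_cast hk
  have hc0 : (0 : ℝ) ≤ c := by positivity
  have hlam : 0 < lam := by nlinarith [mul_nonneg hc0 hρ.le]
  -- degree distribution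
  have hdeg : ∀ (j : Fin d) (v : Fin n), (∀ l, l ≠ j → ((nb G v ∩ P l).card : ℝ) ≤ θ * n) →
      (η + μ / 2) * n ≤ ((nb G v ∩ P j).card : ℝ) := by
    intro j v hl
    have hsub : nb G v ⊆ (nb G v ∩ P j) ∪ ((univ \ univ.biUnion P) ∪
        (univ.erase j).biUnion fun l => nb G v ∩ P l) := by
      intro w hw
      by_cases h1 : w ∈ P j
      · simp [hw, h1]
      · by_cases h2 : w ∈ univ.biUnion P
        · simp only [mem_biUnion, mem_univ, true_and] at h2
          obtain ⟨l, hwl⟩ := h2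
          refine mem_union_right _ (mem_union_right _ ?_)
          simp only [mem_biUnion, mem_erase, mem_univ, and_true, mem_inter]
          exact ⟨l, by rintro rfl; exact h1 hwl, hw, hwl⟩
        · exact mem_union_right _ (mem_union_left _ (by simp only [mem_sdiff, mem_univ, true_and]; exact h2))
    have h1 := hmin v
    rw [← nb_card] at h1
    have h2 := (card_le_card hsub).trans ((card_union_le _ _).trans
      (Nat.add_le_add_left (card_union_le _ _) _))
    have h2' : ((nb G v).card : ℝ) ≤ (nb G v ∩ P j).card + ((univ \ univ.biUnion P).card +
        ((univ.erase j).biUnion fun l => nb G v ∩ P l).card) := by exact_mod_cast h2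
    have h3 := card_biUnion_bound hd (univ.erase j) (fun l => nb G v ∩ P l) (θ * n) (by positivity)
      (fun l hl' => hl l (ne_of_mem_erase hl'))
    have h4 := mul_le_mul_of_nonneg_right p1 hn.le
    nlinarith
  have hbadc : ∀ i j : Fin d, (∀ l, ρ * n ≤ (gd G P θ i l).card → l = j) →
      (((univ.erase j).biUnion fun l => gd G P θ i l).card : ℝ) ≤ c * (ρ * n) := by
    intro i j h
    refine card_biUnion_bound hd _ _ _ (by positivity) ?_
    intro l hl
    by_contra hcon
    push Not at hcon
    exact ne_of_mem_erase hl (h l hcon.le)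
  have hbadd : ∀ i j : Fin d, ∀ v ∈ P i, v ∉ ((univ.erase j).biUnion fun l => gd G P θ i l) →
      (η + μ / 2) * n ≤ ((nb G v ∩ P j).card : ℝ) := by
    intro i j v hv hv2
    apply hdeg
    intro l hl
    simp only [mem_biUnion, mem_erase, mem_univ, and_true, not_exists, not_and, mem_gd, not_le] at hv2
    exact (hv2 l hl hv).le
  have hL4 : ∀ i, lam * n ≤ (P i).card → ∃ j, ρ * n ≤ (gd G P θ i j).card := by
    intro i hi
    by_contra hcon
    push Not at hcon
    have h1 := hbadc i i fun l hl => absurd hl (not_le.2 (hcon l))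
    obtain ⟨v, hv, hv2⟩ : ∃ v ∈ P i, v ∉ ((univ.erase i).biUnion fun l => gd G P θ i l) ∪
        gd G P θ i i := by
      by_contra hcon2
      push Not at hcon2
      have h2 : P i ⊆ univ.biUnion fun l => gd G P θ i l := by
        intro v hv
        have := hcon2 v hv
        simp only [mem_union, mem_biUnion, mem_erase, mem_univ, and_true, true_and] at this ⊢
        rcases this with ⟨l, -, h⟩ | h
        · exact ⟨l, h⟩
        · exact ⟨i, h⟩
      have h3 : ((P i).card : ℝ) ≤ (univ.biUnion fun l => gd G P θ i l).card := by
        exact_mod_cast card_le_card h2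
      have h4 := card_biUnion_bound hd univ (fun l => gd G P θ i l) (ρ * n) (by positivity)
        (fun l _ => (hcon l).le)
      nlinarith
    rw [mem_union, not_or] at hv2
    have h2 := hbadd i i v hv hv2.1
    have h3 : ¬ θ * n ≤ ((nb G v ∩ P i).card : ℝ) := fun h => hv2.2 (mem_gd.2 ⟨hv, h⟩)
    push Not at h3
    have h5 : θ ≤ μ / 2 := by
      have : (1 : ℝ) ≤ c := by
        have : 1 ≤ c := le_trans (Nat.succ_le_of_lt i.pos) hd
        exact_mod_cast this
      nlinarith [mul_nonneg (sq_nonneg (c : ℝ)) hβ.le]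
    nlinarith
  have hbig : ∀ i j, ρ * n ≤ (gd G P θ i j).card → lam * n ≤ (P j).card := by
    intro i j h
    have : 0 < (gd G P θ i j).card := by
      have : (0 : ℝ) < ρ * n := by positivity
      have : (0 : ℝ) < (gd G P θ i j).card := by linarith
      exact_mod_cast this
    obtain ⟨v, hv⟩ := card_pos.1 this
    rw [mem_gd] at hv
    have h1 : ((nb G v ∩ P j).card : ℝ) ≤ (P j).card := by
      exact_mod_cast card_le_card inter_subset_right
    have := mul_le_mul_of_nonneg_right p2 hn.le
    linarith [hv.2]
  have hrob : ∀ i j, ρ' * n ≤ (gd G P θ' i j).card →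
      Rob F G P (β * n) (Function.update (fun _ => j) x0 i) :=
    fun i j h => rob_of_gd hH1 hn p4 p4' h
  have hL3 : ∀ i l j, ρ' * n ≤ (gd G P θ' i j).card → ρ' * n ≤ (gd G P θ' l j).card → i = l := by
    intro i l j h1 h2
    by_contra hil
    refine hno _ _ x0 ?_ ?_ (hrob i j h1) (hrob l j h2)
    · intro a ha; rw [Function.update_of_ne ha, Function.update_of_ne ha]
    · simpa using hil
  have hflip : ∀ i j, ρ * n ≤ (gd G P θ i j).card → ρ' * n ≤ (gd G P θ' j i).card :=
    fun i j h => gd_flip hn hθ hθ' p3 h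
  have hmono : ∀ i j, ρ * n ≤ (gd G P θ i j).card → ρ' * n ≤ (gd G P θ' i j).card :=
    fun i j h => gd_mono p3' p3'' h
  have hclaim : ∀ i, lam * n ≤ (P i).card → Rob F G P (β * n) (fun _ => i) := by
    intro i hi
    rcases hH with hH0 | ⟨hH2, hkη⟩
    · intro W hW
      have h3 : ((P i).card : ℝ) ≤ (P i \ W).card + W.card := by
        exact_mod_cast card_le_card_sdiff_add_card
      obtain ⟨g, g1, g2, g3⟩ := hH0 (P i \ W) (by nlinarith [mul_nonneg hc0 hρ.le])
      exact ⟨g, g1, g2, fun a => mem_sdiff.1 (g3 a)⟩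
    obtain ⟨j, hj⟩ := hL4 i hi
    by_cases hij : i = j
    · subst hij
      have := hrob i i (hmono i i hj)
      rwa [Function.update_eq_self_iff.2 rfl] at this
    exfalso
    have hj' := hbig i j hj
    obtain ⟨j', hj2⟩ := hL4 j hj'
    have hji : j' = i := hL3 _ _ j (hflip j j' hj2) (hmono i j hj)
    subst hji
    have hi1 : ∀ l, ρ * n ≤ (gd G P θ j' l).card → l = j := fun l hl =>
      hL3 _ _ j' (hflip _ _ hl) (hmono _ _ hj2)
    have hj1 : ∀ l, ρ * n ≤ (gd G P θ j l).card → l = j' := fun l hl =>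
      hL3 _ _ j (hflip _ _ hl) (hmono _ _ hj)
    have c1 := hbadc j' j hi1
    have c2 := hbadc j j' hj1
    have hPi : (η + μ / 2) * n ≤ (P j').card := by
      obtain ⟨v, hv, hv2⟩ : ∃ v ∈ P j, v ∉ ((univ.erase j').biUnion fun l => gd G P θ j l) := by
        by_contra hcon
        push Not at hcon
        have : ((P j).card : ℝ) ≤ ((univ.erase j').biUnion fun l => gd G P θ j l).card := by
          exact_mod_cast card_le_card (show P j ⊆ _ from hcon)
        nlinarith
      have h1 := hbadd j j' v hv hv2
      have h2 : ((nb G v ∩ P j').card : ℝ) ≤ (P j').card := by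
        exact_mod_cast card_le_card inter_subset_right
      linarith
    have hPj : ((P j).card : ℝ) ≤ n - (η + μ / 2) * n := by
      have h1 : ((P j' ∪ P j).card : ℝ) = (P j').card + (P j).card := by
        exact_mod_cast card_union_of_disjoint (hdis _ _ hij)
      have h2 : ((P j' ∪ P j).card : ℝ) ≤ n := by
        have := card_le_univ (P j' ∪ P j)
        rw [Fintype.card_fin] at this
        exact_mod_cast this
      linarith
    refine hno (Function.update (fun _ => j) x0 j') (fun a => if a = x0 ∨ a = x1 then j' else j) x1
      ?_ ?_ (hrob _ _ (hmono _ _ hj)) ?_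
    · intro a ha
      by_cases ha0 : a = x0
      · simp [ha0]
      · simp [ha0, ha]
    · rw [Function.update_of_ne hx.symm]
      simp [Ne.symm hij]
    intro W hW
    have d1 : ((P j').card : ℝ) ≤
        (P j' \ (((univ.erase j).biUnion fun l => gd G P θ j' l) ∪ W)).card +
        (((univ.erase j).biUnion fun l => gd G P θ j' l) ∪ W).card := by
      exact_mod_cast card_le_card_sdiff_add_card
    have d2 : ((((univ.erase j).biUnion fun l => gd G P θ j' l) ∪ W).card : ℝ) ≤
        (((univ.erase j).biUnion fun l => gd G P θ j' l)).card + W.card := by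
      exact_mod_cast card_union_le _ _
    have d3 := mul_le_mul_of_nonneg_right p5 hn.le
    obtain ⟨T, hT, hTc, hT2⟩ := hH2 (P j' \ (((univ.erase j).biUnion fun l => gd G P θ j' l) ∪ W))
      (by linarith)
    obtain ⟨a, ha, b, hb, hab, hS⟩ : ∃ a ∈ T, ∃ b ∈ T, a ≠ b ∧
        2 * (β * n) < (((nb G a ∩ P j) ∩ (nb G b ∩ P j)).card : ℝ) := by
      by_contra hcon
      push Not at hcon
      have e1 := sum_card_le T (fun v => nb G v ∩ P j) (P j) (fun _ _ => inter_subset_right)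
        (2 * (β * n)) (by positivity) hcon
      have e2 := card_nsmul_le_sum T (fun v => ((nb G v ∩ P j).card : ℝ)) ((η + μ / 2) * n) (by
        intro v hv
        have := hT hv
        rw [mem_sdiff, mem_union, not_or] at this
        exact hbadd j' j v this.1 this.2.1)
      rw [nsmul_eq_mul, hTc] at e2
      rw [hTc] at e1
      rw [Nat.cast_sub (by omega)] at e1 e2
      push_cast at e1 e2
      have e3 : 1 ≤ (k : ℝ) * η := by
        rw [div_le_iff₀ (by linarith)] at hkη
        linarith
      have e4 : (k : ℝ) * (η + μ / 2) * n ≤ n + (k - 1) ^ 2 * (2 * (β * n)) := by linarith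
      have e5 : (k : ℝ) * μ / 2 * n ≤ (k - 1) ^ 2 * (2 * (β * n)) := by
        have := mul_le_mul_of_nonneg_right e3 hn.le
        linarith
      have e6 : ((k : ℝ) - 1) ^ 2 * (2 * (β * n)) ≤ k ^ 2 * (2 * (β * n)) := by
        apply mul_le_mul_of_nonneg_right _ (by positivity)
        nlinarith
      have e7 : k * (4 * k * β) * n < k * μ * n := by
        apply mul_lt_mul_of_pos_right _ hn
        apply mul_lt_mul_of_pos_left p6 (by linarith)
      linarith
    have f1 : (((nb G a ∩ P j) ∩ (nb G b ∩ P j)).card : ℝ) ≤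
        (((nb G a ∩ P j) ∩ (nb G b ∩ P j)) \ W).card + W.card := by
      exact_mod_cast card_le_card_sdiff_add_card
    obtain ⟨g, g1, g2, g3, g4, g5⟩ := hT2 a ha b hb hab (((nb G a ∩ P j) ∩ (nb G b ∩ P j)) \ W)
      (by nlinarith) (by
        intro w hw
        simp only [mem_sdiff, mem_inter, mem_nb] at hw
        exact ⟨hw.1.1.1, hw.1.2.1⟩)
    refine ⟨g, g1, g2, fun z => ?_⟩
    have hTm : ∀ v ∈ T, v ∈ P j' ∧ v ∉ W := by
      intro v hv
      have := hT hv
      rw [mem_sdiff, mem_union, not_or] at this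
      exact ⟨this.1, this.2.2⟩
    by_cases hz0 : z = x0
    · simp only [hz0, true_or, if_true, g3]; exact hTm a ha
    by_cases hz1 : z = x1
    · simp only [hz1, or_true, if_true, g4]; exact hTm b hb
    have := g5 z hz0 hz1
    simp only [mem_sdiff, mem_inter] at this
    simp only [hz0, hz1, or_self, if_false]
    exact ⟨this.1.1.2, this.2⟩
  have hself : ∀ i j, ρ * n ≤ (gd G P θ i j).card → j = i := by
    intro i j h
    by_contra hij
    refine hno _ _ x0 ?_ ?_ (hclaim j (hbig i j h)) (hrob i j (hmono i j h))
    · intro a ha; rw [Function.update_of_ne ha]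
    · simpa using hij
  refine ⟨fun i => if lam * n ≤ (P i).card then
    P i \ ((univ.erase i).biUnion fun l => gd G P θ i l) else ∅, ?_, ?_, ?_⟩
  · intro i
    dsimp only
    split_ifs
    · exact sdiff_subset
    · exact empty_subset _
  · intro i v hv
    dsimp only at hv
    split_ifs at hv with hi
    · rw [mem_sdiff] at hv
      exact ⟨hclaim i hi, hbadd i i v hv.1 hv.2⟩
    · simp at hv
  · have hcov : (univ \ univ.biUnion fun i => if lam * n ≤ (P i).card then
        P i \ ((univ.erase i).biUnion fun l => gd G P θ i l) else ∅) ⊆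
        (univ \ univ.biUnion P) ∪ univ.biUnion fun i => if lam * n ≤ (P i).card then
          ((univ.erase i).biUnion fun l => gd G P θ i l) else P i := by
      intro v hv
      by_cases h1 : v ∈ univ.biUnion P
      · refine mem_union_right _ ?_
        simp only [mem_biUnion, mem_univ, true_and] at h1 ⊢
        obtain ⟨i, hi⟩ := h1
        refine ⟨i, ?_⟩
        have h2 : v ∉ (if lam * n ≤ (P i).card then
          P i \ ((univ.erase i).biUnion fun l => gd G P θ i l) else ∅) := by
          intro h
          rw [mem_sdiff] at hv
          exact hv.2 (mem_biUnion.2 ⟨i, mem_univ _, h⟩)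
        split_ifs at h2 ⊢ with h3
        · rw [mem_sdiff] at h2
          by_contra h4
          exact h2 ⟨hi, h4⟩
        · exact hi
      · exact mem_union_left _ (by rw [mem_sdiff]; exact ⟨mem_univ _, h1⟩)
    have a1 : (((univ \ univ.biUnion fun i => if lam * n ≤ (P i).card then
        P i \ ((univ.erase i).biUnion fun l => gd G P θ i l) else ∅)).card : ℝ) ≤
        (univ \ univ.biUnion P).card + (univ.biUnion fun i => if lam * n ≤ (P i).card then
          ((univ.erase i).biUnion fun l => gd G P θ i l) else P i).card := by
      exact_mod_cast (card_le_card hcov).trans (card_union_le _ _)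
    have a2 := card_biUnion_bound hd univ (fun i => if lam * n ≤ (P i).card then
          ((univ.erase i).biUnion fun l => gd G P θ i l) else P i) (lam * n) (by positivity) (by
        intro i _
        split_ifs with h
        · have := hbadc i i (hself i)
          nlinarith
        · exact (not_le.1 h).le)
    have a3 := mul_le_mul_of_nonneg_right p7 hn.le
    have a4 : 0 ≤ c * (lam * n) := by positivity
    linarith

end RTT

namespace RTT

lemma choose_mul_pow (p s : ℕ) : (p.choose s : ℝ) * (s : ℝ) ^ s ≤ (3 * p) ^ s := by
  have h1 : (p.choose s : ℝ) ≤ (p : ℝ) ^ s / (s.factorial : ℝ) := Nat.choose_le_pow_div s p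
  have h2 : (s : ℝ) ^ s / (s.factorial : ℝ) ≤ Real.exp s :=
    Real.pow_div_factorial_le_exp _ (by positivity) s
  have h3 : Real.exp s ≤ 3 ^ s := by
    have : Real.exp (s : ℝ) = Real.exp 1 ^ s := by rw [← Real.exp_nat_mul, mul_one]
    rw [this]
    exact pow_le_pow_left₀ (Real.exp_pos 1).le (by linarith [Real.exp_one_lt_d9]) s
  have hf : (0 : ℝ) < s.factorial := by exact_mod_cast s.factorial_pos
  calc (p.choose s : ℝ) * (s : ℝ) ^ s ≤ (p : ℝ) ^ s / (s.factorial : ℝ) * (s : ℝ) ^ s := by gcongr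
    _ = (p : ℝ) ^ s * ((s : ℝ) ^ s / (s.factorial : ℝ)) := by ring
    _ ≤ (p : ℝ) ^ s * 3 ^ s := by gcongr; exact h2.trans h3
    _ = (3 * p) ^ s := by rw [mul_pow]; ring

lemma term_bound (p q s : ℕ) (hs : 4 * s ≤ 3 * q) (hp : p ≤ 2 * q) (hsp : s ≤ p) :
    (p.choose s : ℝ) * q.choose s * ((s : ℝ) ^ (18 * s) * (q : ℝ) ^ (18 * (p - s))) ≤
      (1 / 4) ^ s * (q : ℝ) ^ (18 * p) := by
  have h1 := choose_mul_pow p s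
  have h2 := choose_mul_pow q s
  have h3 : (s : ℝ) ≤ 3 / 4 * q := by
    have : (4 * s : ℝ) ≤ 3 * q := by exact_mod_cast hs
    linarith
  have h4 : (s : ℝ) ^ (16 * s) ≤ (3 / 4 * q) ^ (16 * s) := pow_le_pow_left₀ (by positivity) h3 _
  have h5 : (3 * p : ℝ) ^ s ≤ (6 * q) ^ s := by
    apply pow_le_pow_left₀ (by positivity)
    have : (p : ℝ) ≤ 2 * q := by exact_mod_cast hp
    linarith
  have e1 : (p.choose s : ℝ) * q.choose s * ((s : ℝ) ^ (18 * s) * (q : ℝ) ^ (18 * (p - s))) =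
      ((p.choose s : ℝ) * (s : ℝ) ^ s) * ((q.choose s : ℝ) * (s : ℝ) ^ s) * (s : ℝ) ^ (16 * s) *
        (q : ℝ) ^ (18 * (p - s)) := by
    rw [show 18 * s = s + s + 16 * s by ring, pow_add, pow_add]; ring
  rw [e1]
  calc ((p.choose s : ℝ) * (s : ℝ) ^ s) * ((q.choose s : ℝ) * (s : ℝ) ^ s) * (s : ℝ) ^ (16 * s) *
        (q : ℝ) ^ (18 * (p - s)) ≤ (6 * q) ^ s * (3 * q) ^ s * (3 / 4 * q) ^ (16 * s) *
        (q : ℝ) ^ (18 * (p - s)) := by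
        have := h1.trans h5
        gcongr
    _ = (18 * (3 / 4) ^ 16) ^ s * (q : ℝ) ^ (18 * p) := by
        have e2 : (q : ℝ) ^ (18 * p) = ((q : ℝ) ^ 18) ^ s * (q : ℝ) ^ (18 * (p - s)) := by
          rw [← pow_mul, ← pow_add]; congr 1; omega
        rw [e2, pow_mul (3 / 4 * (q : ℝ)) 16 s, ← mul_pow, ← mul_pow,
          ← mul_assoc ((18 * (3 / 4) ^ 16 : ℝ) ^ s), ← mul_pow (18 * (3 / 4) ^ 16 : ℝ)]
        congr 2
        ring
    _ ≤ (1 / 4) ^ s * (q : ℝ) ^ (18 * p) := by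
        gcongr
        norm_num

lemma expander (p q : ℕ) (hq : 0 < q) (hp : p ≤ 2 * q) : ∃ f : Fin p → Fin 18 → Fin q,
    ∀ S : Finset (Fin p), 4 * S.card ≤ 3 * q →
      S.card ≤ (S.biUnion fun x => univ.image (f x)).card := by
  classical
  by_contra hcon
  push Not at hcon
  let Om : Finset (Fin p) → Finset (Fin q) → Finset (Fin p × Fin 18 → Fin q) := fun S B =>
    Fintype.piFinset fun xi => if xi.1 ∈ S then B else univ
  let I : ℕ → Finset (Finset (Fin p) × Finset (Fin q)) := fun s =>
    if 4 * s ≤ 3 * q ∧ s ≤ p then (powersetCard s univ) ×ˢ (powersetCard s univ) else ∅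
  have hcov : (univ : Finset (Fin p × Fin 18 → Fin q)) ⊆
      (Icc 1 q).biUnion fun s => (I s).biUnion fun SB => Om SB.1 SB.2 := by
    intro f _
    obtain ⟨S, hS, hS2⟩ := hcon fun x i => f (x, i)
    obtain ⟨B, hB, hBc⟩ := exists_superset_card_eq (s := S.biUnion fun x => univ.image fun i => f (x, i))
      (n := S.card) hS2.le (by rw [Fintype.card_fin]; omega)
    simp only [mem_biUnion]
    refine ⟨S.card, ?_, (S, B), ?_, ?_⟩
    · rw [mem_Icc]; omega
    · have : S.card ≤ p := by simpa using card_le_univ S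
      simp only [I]
      rw [if_pos ⟨hS, this⟩, mem_product, mem_powersetCard, mem_powersetCard]
      exact ⟨⟨subset_univ _, rfl⟩, subset_univ _, hBc⟩
    · simp only [Om, Fintype.mem_piFinset]
      rintro ⟨x, i⟩
      split_ifs with h
      · apply hB
        simp only [mem_biUnion, mem_image, mem_univ, true_and]
        exact ⟨x, h, i, rfl⟩
      · exact mem_univ _
  have hOm : ∀ S B, (Om S B).card = B.card ^ (18 * S.card) * q ^ (18 * (p - S.card)) := by
    intro S B
    simp only [Om, Fintype.card_piFinset]
    rw [Fintype.prod_prod_type]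
    have : ∀ x : Fin p, (∏ _i : Fin 18, (if x ∈ S then B else univ).card) =
        if x ∈ S then B.card ^ 18 else q ^ 18 := by
      intro x; rw [prod_const]; split_ifs <;> simp
    rw [prod_congr rfl fun x _ => this x]
    rw [prod_ite, prod_const, prod_const, ← pow_mul, ← pow_mul]
    have a1 : (univ.filter fun x => x ∈ S) = S := by ext; simp
    have a2 : (univ.filter fun x => x ∉ S).card = p - S.card := by
      have : (univ.filter fun x => x ∉ S) = Sᶜ := by ext; simp
      rw [this, card_compl, Fintype.card_fin]
    rw [a1, a2]
  have hcard := ((card_le_card hcov).trans card_biUnion_le).trans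
    (sum_le_sum fun s _ => card_biUnion_le)
  rw [card_univ, Fintype.card_fun, Fintype.card_prod, Fintype.card_fin, Fintype.card_fin,
    Fintype.card_fin] at hcard
  have hcard' : (q : ℝ) ^ (p * 18) ≤ ∑ s ∈ Icc 1 q, ∑ SB ∈ I s, ((Om SB.1 SB.2).card : ℝ) := by
    exact_mod_cast hcard
  have hsum : ∀ s ∈ Icc 1 q, ∑ SB ∈ I s, ((Om SB.1 SB.2).card : ℝ) ≤
      (1 / 4 : ℝ) ^ s * (q : ℝ) ^ (18 * p) := by
    intro s _
    simp only [I]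
    split_ifs with h
    · have : ∀ SB ∈ (powersetCard s (univ : Finset (Fin p))) ×ˢ (powersetCard s (univ : Finset (Fin q))),
          ((Om SB.1 SB.2).card : ℝ) = (s : ℝ) ^ (18 * s) * (q : ℝ) ^ (18 * (p - s)) := by
        intro SB hSB
        rw [mem_product, mem_powersetCard, mem_powersetCard] at hSB
        rw [hOm, hSB.1.2, hSB.2.2]
        push_cast; rfl
      rw [sum_congr rfl this, sum_const, card_product, card_powersetCard, card_powersetCard,
        nsmul_eq_mul, card_univ, card_univ, Fintype.card_fin, Fintype.card_fin]
      push_cast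
      exact term_bound p q s h.1 hp h.2
    · rw [sum_empty]; positivity
  have h1 := hcard'.trans (sum_le_sum hsum)
  rw [← sum_mul, mul_comm p 18] at h1
  have h2 : (0 : ℝ) < (q : ℝ) ^ (18 * p) := by positivity
  have h3 : ∀ N : ℕ, ∑ s ∈ Icc 1 N, (1 / 4 : ℝ) ^ s ≤ 1 / 3 - (1 / 3) * (1 / 4) ^ N := by
    intro N
    induction N with
    | zero => simp
    | succ N ih =>
      rw [sum_Icc_succ_top (by omega), pow_succ]
      linarith
  have h4 : (0 : ℝ) < (1 / 4) ^ q := by positivity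
  nlinarith [h3 q]

end RTT

namespace RTT

lemma template (m h : ℕ) (hm : 1 ≤ m) (hh : h ≤ m) :
    ∃ E : Fin (3 * m) → Finset (Fin (m + h) ⊕ Fin (2 * m)),
      (∑ z, (E z).card) ≤ 126 * m ∧
      ∀ X' : Finset (Fin (m + h)), X'.card = m →
        ∃ φ : Fin (3 * m) → Fin (m + h) ⊕ Fin (2 * m), Function.Injective φ ∧
          (∀ z, φ z ∈ E z) ∧ univ.image φ = X'.disjSum univ := by
  classical
  obtain ⟨f, hf⟩ := expander (3 * m) (2 * m) (by omega) (by omega)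
  obtain ⟨f', hf'⟩ := expander (m + h + 2 * m) (3 * m) (by omega) (by omega)
  let e : Fin (m + h) ⊕ Fin (2 * m) ≃ Fin (m + h + 2 * m) := finSumFinEquiv
  let E : Fin (3 * m) → Finset (Fin (m + h) ⊕ Fin (2 * m)) := fun z =>
    (univ.image fun i => Sum.inr (f z i)) ∪ univ.filter fun w => z ∈ univ.image (f' (e w))
  refine ⟨E, ?_, ?_⟩
  · have h1 : ∀ z, (E z).card ≤ 18 + (univ.filter fun w => z ∈ univ.image (f' (e w))).card := by
      intro z
      refine (card_union_le _ _).trans ?_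
      gcongr
      simpa using card_image_le (s := (univ : Finset (Fin 18))) (f := fun i => (Sum.inr (f z i) : Fin (m + h) ⊕ Fin (2 * m)))
    refine (sum_le_sum fun z _ => h1 z).trans ?_
    rw [sum_add_distrib, sum_const, card_univ, Fintype.card_fin, smul_eq_mul]
    have h2 := sum_card_bipartiteAbove_eq_sum_card_bipartiteBelow (s := (univ : Finset (Fin (3 * m))))
      (t := (univ : Finset (Fin (m + h) ⊕ Fin (2 * m)))) (fun z w => z ∈ univ.image (f' (e w)))
    simp only [bipartiteAbove, bipartiteBelow] at h2
    rw [h2]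
    have h3 : ∀ w, (univ.filter fun z => z ∈ univ.image (f' (e w))).card ≤ 18 := by
      intro w
      have : (univ.filter fun z => z ∈ univ.image (f' (e w))) = univ.image (f' (e w)) := by
        ext; simp
      rw [this]
      simpa using card_image_le (s := (univ : Finset (Fin 18))) (f := f' (e w))
    have h4 := sum_le_card_nsmul univ _ 18 (fun w _ => h3 w)
    rw [card_univ, Fintype.card_sum, Fintype.card_fin, Fintype.card_fin, smul_eq_mul] at h4
    omega
  · intro X' hX'
    have hA : (X'.disjSum (univ : Finset (Fin (2 * m)))).card = 3 * m := by
      rw [card_disjSum, hX', card_univ, Fintype.card_fin]; omega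
    have hall := (all_card_le_biUnion_card_iff_exists_injective
      (fun z => E z ∩ X'.disjSum (univ : Finset (Fin (2 * m))))).1 (by
        intro S
        by_contra hcon
        push Not at hcon
        rcases le_or_gt (2 * S.card) (3 * m) with hS | hS
        · have h1 := hf S (by omega)
          have h2 : ((S.biUnion fun x => univ.image (f x)).map
              ⟨(Sum.inr : Fin (2 * m) → Fin (m + h) ⊕ Fin (2 * m)), Sum.inr_injective⟩) ⊆
              S.biUnion fun z => E z ∩ X'.disjSum (univ : Finset (Fin (2 * m))) := by
            intro w hw
            simp only [mem_map, mem_biUnion, mem_image, mem_univ, true_and,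
              Function.Embedding.coeFn_mk] at hw
            obtain ⟨y, ⟨z, hz, i, rfl⟩, rfl⟩ := hw
            simp only [mem_biUnion, mem_inter, E, mem_union, mem_image, mem_univ, true_and,
              inr_mem_disjSum, and_true]
            exact ⟨z, hz, Or.inl ⟨i, rfl⟩⟩
          have h3 := card_le_card h2
          rw [card_map] at h3
          omega
        · have hSc : S.card ≤ 3 * m := by simpa using card_le_univ S
          have h1 : 3 * m - S.card + 1 ≤ (X'.disjSum univ \
              S.biUnion fun z => E z ∩ X'.disjSum (univ : Finset (Fin (2 * m)))).card := by
            have := card_le_card_sdiff_add_card (s := S.biUnion fun z => E z ∩ X'.disjSum (univ : Finset (Fin (2 * m))))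
              (t := X'.disjSum (univ : Finset (Fin (2 * m))))
            have := le_card_sdiff (S.biUnion fun z => E z ∩ X'.disjSum (univ : Finset (Fin (2 * m))))
              (X'.disjSum (univ : Finset (Fin (2 * m))))
            omega
          obtain ⟨M, hM, hMc⟩ := exists_subset_card_eq h1
          have h2 := hf' (M.map e.toEmbedding) (by rw [card_map]; omega)
          rw [card_map, hMc] at h2
          obtain ⟨z, hz⟩ : ((M.map e.toEmbedding).biUnion (fun x => univ.image (f' x)) ∩ S).Nonempty := by
            rw [nonempty_iff_ne_empty]
            intro h3
            have h4 := card_union_of_disjoint (disjoint_iff_inter_eq_empty.2 h3)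
            have h5 : ((M.map e.toEmbedding).biUnion (fun x => univ.image (f' x)) ∪ S).card ≤ 3 * m := by
              simpa using card_le_univ ((M.map e.toEmbedding).biUnion (fun x => univ.image (f' x)) ∪ S)
            omega
          rw [mem_inter] at hz
          simp only [mem_biUnion, mem_map, Equiv.coe_toEmbedding] at hz
          obtain ⟨⟨_, ⟨w, hw, rfl⟩, hz1⟩, hzS⟩ := hz
          have := hM hw
          rw [mem_sdiff] at this
          refine this.2 (mem_biUnion.2 ⟨z, hzS, mem_inter.2 ⟨?_, this.1⟩⟩)
          simp only [E]
          exact mem_union_right _ (mem_filter.2 ⟨mem_univ _, hz1⟩))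
    obtain ⟨φ, hφ, hφ2⟩ := hall
    refine ⟨φ, hφ, fun z => (mem_inter.1 (hφ2 z)).1, ?_⟩
    apply eq_of_subset_of_card_le
    · intro w hw
      obtain ⟨z, -, rfl⟩ := mem_image.1 hw
      exact (mem_inter.1 (hφ2 z)).2
    · rw [card_image_of_injective _ hφ, hA]; simp

end RTT

namespace RTT

lemma sample_abs {V : Type*} [DecidableEq V] {M : ℕ} (hM : 0 < M) (D : Finset V)
    (Good : V → Finset (Fin M)) (κ : ℝ) (hκ : κ ≤ 1) (h : ∀ u ∈ D, κ * M ≤ (Good u).card) (T : ℕ) :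
    ∃ J : Finset (Fin M), J.card ≤ T ∧
      ((D.filter fun u => Disjoint J (Good u)).card : ℝ) ≤ (1 - κ) ^ T * D.card := by
  induction T with
  | zero =>
    refine ⟨∅, by simp, ?_⟩
    simp
  | succ T ih =>
    obtain ⟨J, hJ, hJ2⟩ := ih
    set B := D.filter fun u => Disjoint J (Good u) with hB
    have hM' : (0 : ℝ) < M := by exact_mod_cast hM
    obtain ⟨c, hc⟩ : ∃ c : Fin M, κ * B.card ≤ ((B.filter fun u => c ∈ Good u).card : ℝ) := by
      by_contra hcon
      push Not at hcon
      have h1 : ∑ c : Fin M, ((B.filter fun u => c ∈ Good u).card : ℝ) =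
          ∑ u ∈ B, ((Good u).card : ℝ) := by
        have h2 := sum_card_bipartiteAbove_eq_sum_card_bipartiteBelow
          (s := B) (t := (univ : Finset (Fin M))) (fun u c => c ∈ Good u)
        simp only [bipartiteAbove, bipartiteBelow] at h2
        have h3 : ∀ u, (univ.filter fun c => c ∈ Good u) = Good u := by intro u; ext; simp
        simp only [h3] at h2
        exact_mod_cast h2.symm
      have h2 := card_nsmul_le_sum B (fun u => ((Good u).card : ℝ)) (κ * M) (fun u hu =>
        h u (mem_filter.1 hu).1)
      have h3 : ∑ c : Fin M, ((B.filter fun u => c ∈ Good u).card : ℝ) < ∑ _c : Fin M, κ * B.card := by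
        apply sum_lt_sum_of_nonempty
        · exact ⟨⟨0, hM⟩, mem_univ _⟩
        · exact fun c _ => hcon c
      rw [sum_const, card_univ, Fintype.card_fin, nsmul_eq_mul] at h3
      rw [nsmul_eq_mul] at h2
      nlinarith
    refine ⟨insert c J, (card_insert_le _ _).trans (by omega), ?_⟩
    have h1 : (D.filter fun u => Disjoint (insert c J) (Good u)) = B \ B.filter fun u => c ∈ Good u := by
      ext u
      simp only [hB, mem_filter, mem_sdiff, disjoint_insert_left]
      tauto
    rw [h1]
    have h2 := card_sdiff_add_card_eq_card (filter_subset (fun u => c ∈ Good u) B)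
    have h2' : ((B \ B.filter fun u => c ∈ Good u).card : ℝ) + (B.filter fun u => c ∈ Good u).card
      = B.card := by exact_mod_cast h2
    rw [pow_succ]
    nlinarith

lemma sample (θ δ ε₁ : ℝ) (hθ : 0 < θ) (hδ : 0 < δ) (hε₁ : 0 < ε₁) :
    ∃ ε' : ℝ, 0 < ε' ∧ ∃ N : ℕ, ∀ n : ℕ, N ≤ n → ∀ (G : SimpleGraph (Fin n)) (Q D : Finset (Fin n)),
      (∀ v ∈ D, 2 * θ * n ≤ ((nb G v ∩ Q).card : ℝ)) →
      ∃ X0 ⊆ Q, (X0.card : ℝ) ≤ δ * n ∧ ∃ D' ⊆ D, (D'.card : ℝ) ≤ ε₁ * n ∧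
        ∀ v ∈ D \ D', ε' * n ≤ ((nb G v ∩ X0).card : ℝ) := by
  classical
  by_cases hθ1 : 1 < θ
  · refine ⟨1, one_pos, 1, fun n hn G Q D hD => ⟨∅, empty_subset _, by simp; positivity, ∅,
      empty_subset _, by simp; positivity, ?_⟩⟩
    intro v hv
    exfalso
    have h1 := hD v (mem_sdiff.1 hv).1
    have h2 : (nb G v ∩ Q).card ≤ n := by simpa using card_le_univ (nb G v ∩ Q)
    have h2' : ((nb G v ∩ Q).card : ℝ) ≤ n := by exact_mod_cast h2
    have h3 : (1 : ℝ) ≤ n := by exact_mod_cast hn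
    nlinarith
  push Not at hθ1
  obtain ⟨T, hT⟩ := exists_pow_lt_of_lt_one hε₁ (show 1 - θ / 2 < 1 by linarith)
  obtain ⟨M, hM⟩ := exists_nat_gt (2 * T / δ + 1)
  have hM0 : (1 : ℝ) < M := by
    have : 0 ≤ 2 * T / δ := by positivity
    linarith
  have hM1 : 0 < M := by
    have : (0 : ℝ) < M := by linarith
    exact_mod_cast this
  have hMd : 2 * T < δ * M := by
    have : 2 * T / δ < M := by linarith
    rw [div_lt_iff₀ hδ] at this
    linarith
  refine ⟨θ / M, by positivity, M, ?_⟩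
  intro n hn G Q D hD
  have hn' : (M : ℝ) ≤ n := by exact_mod_cast hn
  have hn0 : (0 : ℝ) < n := by linarith
  let cl : Fin M → Finset (Fin n) := fun c => univ.filter fun v => v.val % M = c.val
  have hcl : ∀ c, ((cl c).card : ℝ) ≤ 2 * n / M := by
    intro c
    have h1 : (cl c).card ≤ n / M + 1 := by
      have : (cl c).card ≤ (range (n / M + 1)).card := by
        apply card_le_card_of_injOn (fun v => v.val / M)
        · intro v hv
          simp only [coe_range, Set.mem_Iio]
          have := Nat.div_le_div_right (c := M) v.2.le
          omega
        · intro v hv w hw hvw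
          simp only [cl, coe_filter, mem_univ, true_and, Set.mem_setOf_eq] at hv hw
          have e1 := Nat.div_add_mod v.val M
          have e2 := Nat.div_add_mod w.val M
          simp only at hvw
          rw [hv, hvw] at e1
          rw [hw] at e2
          exact Fin.ext (e1.symm.trans e2)
      rwa [card_range] at this
    have h2 : ((cl c).card : ℝ) ≤ (n / M : ℕ) + 1 := by exact_mod_cast h1
    have h3 : ((n / M : ℕ) : ℝ) ≤ n / M := Nat.cast_div_le
    have h4 : (1 : ℝ) ≤ n / M := by rw [le_div_iff₀ (by linarith)]; linarith
    have h5 : (2 * n / M : ℝ) = n / M + n / M := by ring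
    linarith
  let Good : Fin n → Finset (Fin M) := fun v =>
    univ.filter fun c => θ / M * n ≤ ((nb G v ∩ (Q ∩ cl c)).card : ℝ)
  obtain ⟨J, hJ, hJ2⟩ := sample_abs hM1 D Good (θ / 2) (by linarith) (by
    intro v hv
    have h1 := hD v hv
    have h2 : nb G v ∩ Q ⊆ univ.biUnion fun c => nb G v ∩ (Q ∩ cl c) := by
      intro w hw
      rw [mem_inter] at hw
      simp only [mem_biUnion, mem_univ, true_and, mem_inter, cl, mem_filter]
      exact ⟨⟨w.val % M, Nat.mod_lt _ hM1⟩, hw.1, hw.2, rfl⟩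
    have h3 : ((nb G v ∩ Q).card : ℝ) ≤ ∑ c, ((nb G v ∩ (Q ∩ cl c)).card : ℝ) := by
      exact_mod_cast (card_le_card h2).trans card_biUnion_le
    have h4 : ∀ c ∈ (univ : Finset (Fin M)), ((nb G v ∩ (Q ∩ cl c)).card : ℝ) ≤
        (if c ∈ Good v then (2 * n / M : ℝ) else 0) + θ / M * n := by
      intro c _
      split_ifs with hc
      · have : ((nb G v ∩ (Q ∩ cl c)).card : ℝ) ≤ (cl c).card := by
          exact_mod_cast card_le_card (inter_subset_right.trans inter_subset_right)
        have := hcl c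
        have : 0 ≤ θ / M * n := by positivity
        linarith
      · simp only [Good, mem_filter, mem_univ, true_and, not_le] at hc
        linarith
    have h5 := h3.trans (sum_le_sum h4)
    rw [sum_add_distrib, sum_ite_mem, univ_inter, sum_const, sum_const, card_univ, Fintype.card_fin,
      nsmul_eq_mul, nsmul_eq_mul] at h5
    have h6 : (M : ℝ) * (θ / M * n) = θ * n := by field_simp
    have h7 : (Good v).card * (2 * n / M : ℝ) = ((Good v).card * 2 / M) * n := by ring
    have h8 : θ * n ≤ ((Good v).card * 2 / M) * n := by linarith
    have h9 := le_of_mul_le_mul_right h8 hn0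
    rw [le_div_iff₀ (by linarith)] at h9
    linarith) T
  refine ⟨Q ∩ J.biUnion cl, inter_subset_left, ?_, D.filter fun u => Disjoint J (Good u),
    filter_subset _ _, ?_, ?_⟩
  · have h1 : ((Q ∩ J.biUnion cl).card : ℝ) ≤ (J.biUnion cl).card := by
      exact_mod_cast card_le_card inter_subset_right
    have h2 : ((J.biUnion cl).card : ℝ) ≤ ∑ c ∈ J, ((cl c).card : ℝ) := by
      exact_mod_cast card_biUnion_le
    have h3 := sum_le_card_nsmul J (fun c => ((cl c).card : ℝ)) (2 * n / M) (fun c _ => hcl c)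
    rw [nsmul_eq_mul] at h3
    have h4 : (J.card : ℝ) ≤ T := by exact_mod_cast hJ
    have h5 : (J.card : ℝ) * (2 * n / M) ≤ T * (2 * n / M) :=
      mul_le_mul_of_nonneg_right h4 (by positivity)
    have h6 : T * (2 * n / M : ℝ) = (2 * T / M) * n := by ring
    have h7 : (2 * T / M : ℝ) ≤ δ := by rw [div_le_iff₀ (by linarith)]; linarith
    have h8 := mul_le_mul_of_nonneg_right h7 hn0.le
    linarith
  · refine hJ2.trans ?_
    have h1 : (D.card : ℝ) ≤ n := by
      have : D.card ≤ n := by simpa using card_le_univ D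
      exact_mod_cast this
    exact mul_le_mul hT.le h1 (by positivity) hε₁.le
  · intro v hv
    simp only [mem_sdiff, mem_filter, not_and] at hv
    have h1 := hv.2 hv.1
    rw [not_disjoint_iff] at h1
    obtain ⟨c, hcJ, hcG⟩ := h1
    simp only [Good, mem_filter, mem_univ, true_and] at hcG
    refine hcG.trans ?_
    have : nb G v ∩ (Q ∩ cl c) ⊆ nb G v ∩ (Q ∩ J.biUnion cl) := by
      intro w hw
      simp only [mem_inter, mem_biUnion] at hw ⊢
      exact ⟨hw.1, hw.2.1, c, hcJ, hw.2.2⟩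
    exact_mod_cast card_le_card this

/-- absorbers for k-sets inside a closed part -/
lemma absorber {k n : ℕ} {F : SimpleGraph (Fin k)} {G : SimpleGraph (Fin n)} {m : ℝ} {t : ℕ}
    {P : Finset (Fin n)} (hcl : FClosed F G m t P)
    (hrob : ∀ W : Finset (Fin n), (W.card : ℝ) ≤ m → ∃ S1 ⊆ P, Disjoint S1 W ∧ SpansCopy F G S1)
    (S W : Finset (Fin n)) (hS : S ⊆ P) (hSc : S.card = k)
    (hW : (W.card : ℝ) + 2 * k + (k * t : ℕ) * k ≤ m) (ht : 1 ≤ t) :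
    ∃ A : Finset (Fin n), Disjoint A W ∧ Disjoint A S ∧ A.card ≤ k ^ 2 * t ∧
      PerfTilingOn F G A ∧ PerfTilingOn F G (A ∪ S) := by
  classical
  have hk0 : (0 : ℝ) ≤ k := by positivity
  have hkt : (0 : ℝ) ≤ (k * t : ℕ) * k := by positivity
  have c1 : ((W ∪ S).card : ℝ) ≤ W.card + k := by
    have : (W ∪ S).card ≤ W.card + S.card := card_union_le _ _
    rw [hSc] at this
    exact_mod_cast this
  obtain ⟨S1, hS1P, hS1W, hS1⟩ := hrob (W ∪ S) (by linarith)
  have hS1c := spans_card hS1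
  rw [disjoint_union_right] at hS1W
  let e : Fin k ≃ S := (S.equivFinOfCardEq hSc).symm
  let e1 : Fin k ≃ S1 := (S1.equivFinOfCardEq hS1c).symm
  have c2 : ((S1 ∪ (W ∪ S)).card : ℝ) ≤ W.card + 2 * k := by
    have : (S1 ∪ (W ∪ S)).card ≤ S1.card + (W ∪ S).card := card_union_le _ _
    rw [hS1c] at this
    have : ((S1 ∪ (W ∪ S)).card : ℝ) ≤ k + (W ∪ S).card := by exact_mod_cast this
    linarith
  obtain ⟨Q, q1, q2, q3, q4⟩ := link (F := F) (G := G) (m := m) (t := t) univ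
    (fun a => (e a).1) (fun a => (e1 a).1) (S1 ∪ (W ∪ S))
    (by
      intro a _
      refine hcl _ (hS (e a).2) _ (hS1P (e1 a).2) ?_
      intro h
      exact disjoint_left.1 hS1W.2 (e1 a).2 (h ▸ (e a).2))
    (by intro a _; simp) (by intro a _; simp)
    (by intro a _ b _ hab h; exact hab (e.injective (Subtype.ext h)))
    (by intro a _ b _ hab h; exact hab (e1.injective (Subtype.ext h)))
    (by rw [card_univ, Fintype.card_fin]; linarith)
  have i1 : univ.image (fun a => (e a).1) = S := by
    ext v
    simp only [mem_image, mem_univ, true_and]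
    exact ⟨fun ⟨a, h⟩ => h ▸ (e a).2, fun h => ⟨e.symm ⟨v, h⟩, by simp⟩⟩
  have i2 : univ.image (fun a => (e1 a).1) = S1 := by
    ext v
    simp only [mem_image, mem_univ, true_and]
    exact ⟨fun ⟨a, h⟩ => h ▸ (e1 a).2, fun h => ⟨e1.symm ⟨v, h⟩, by simp⟩⟩
  rw [i1] at q3
  rw [i2] at q4
  simp only [disjoint_union_right] at q1
  refine ⟨S1 ∪ Q, ?_, ?_, ?_, q4, ?_⟩
  · rw [disjoint_union_left]; exact ⟨hS1W.1, q1.2.1⟩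
  · rw [disjoint_union_left]; exact ⟨hS1W.2, q1.2.2⟩
  · have h1 := card_union_le S1 Q
    rw [card_univ, Fintype.card_fin] at q2
    have h2 : k ^ 2 * t = (k * t) * k := by ring
    rw [h2]
    rcases Nat.eq_zero_or_pos k with h0 | h0
    · subst h0; omega
    · obtain ⟨s, hs⟩ : ∃ s, k * t = s + 1 := ⟨k * t - 1, by
        have := Nat.mul_pos h0 ht; omega⟩
      rw [hs, Nat.add_sub_cancel] at q2
      rw [hs]
      have : (s + 1) * k = s * k + k := by ring
      omega
  · have : S1 ∪ Q ∪ S = S1 ∪ (S ∪ Q) := by ext z; simp only [mem_union]; tauto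
    rw [this]
    refine tile_union (tile_of_spans hS1) q3 ?_
    rw [disjoint_union_right]
    exact ⟨hS1W.2, q1.1.symm⟩

end RTT

namespace RTT

/-- realising the template inside a closed part -/
lemma flex_core {k n : ℕ} {F : SimpleGraph (Fin k)} {G : SimpleGraph (Fin n)} {m : ℝ} {t : ℕ}
    (hk : 3 ≤ k) (ht : 1 ≤ t)
    {P : Finset (Fin n)} (hcl : FClosed F G m t P)
    (hrob : ∀ W : Finset (Fin n), (W.card : ℝ) ≤ m → ∃ S1 ⊆ P, Disjoint S1 W ∧ SpansCopy F G S1)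
    (X W : Finset (Fin n)) (hXP : X ⊆ P) (hXW : X ⊆ W) (a h : ℕ) (ha : 1 ≤ a) (hh : h ≤ a)
    (hX : X.card = a + h)
    (hW : (W.card : ℝ) + 131 * (k ^ 2 * t) * a + 2 * k + (k * t : ℕ) * k ≤ m) :
    ∃ R : Finset (Fin n), Disjoint R W ∧ (R.card : ℝ) ≤ 131 * (k ^ 2 * t) * a ∧
      ∀ X' ⊆ X, X'.card = a → PerfTilingOn F G (X' ∪ R) := by
  classical
  obtain ⟨E, hE, hT⟩ := template a h ha hh
  have hkR : (3:ℝ) ≤ k := by exact_mod_cast hk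
  have htR : (1:ℝ) ≤ t := by exact_mod_cast ht
  have haR : (1:ℝ) ≤ a := by exact_mod_cast ha
  have hkk : (3:ℝ) * k ≤ k ^ 2 * t := by nlinarith
  have hk2 : (0:ℝ) ≤ k ^ 2 * t := by positivity
  have hak : (3:ℝ) * k * a ≤ k ^ 2 * t * a := by nlinarith
  have hktk : (0:ℝ) ≤ (k * t : ℕ) * k := by positivity
  have hb : (2:ℝ) * a + 3 * k * a + 126 * (k ^ 2 * t) * a ≤ 131 * (k ^ 2 * t) * a := by nlinarith
  have hb1 : (0:ℝ) ≤ 126 * (k ^ 2 * t) * a := by positivity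
  have hb2 : (0:ℝ) ≤ 3 * k * a := by positivity
  -- Y
  obtain ⟨Y, hY, hYd⟩ := greedy (univ : Finset (Fin (2 * a))) (fun _ Q => ∃ y ∈ P, Q = {y}) W 1 m
    (by norm_num) (by
      intro i _ W' _ hW'
      obtain ⟨S, hSP, hSW, hS⟩ := hrob W' hW'
      have hc := spans_card hS
      obtain ⟨y, hy⟩ : S.Nonempty := by rw [← card_pos]; omega
      exact ⟨{y}, by simpa using disjoint_left.1 hSW hy, by simp, y, hSP hy, rfl⟩)
    (by rw [card_univ, Fintype.card_fin]; push_cast; linarith)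
  choose y hyP hyY using fun i => (hY i (mem_univ i)).1
  have hyW : ∀ i, y i ∉ W := fun i hi => by
    have := (hY i (mem_univ i)).2.1
    rw [hyY i] at this
    exact disjoint_left.1 this (mem_singleton_self _) hi
  have hyinj : Function.Injective y := by
    intro i j hij
    by_contra hne
    have := hYd i (mem_univ _) j (mem_univ _) hne
    rw [hyY i, hyY j, hij] at this
    simp at this
  set W1 := W ∪ univ.image y with hW1
  have hW1c : (W1.card : ℝ) ≤ W.card + 2 * a := by
    have h2 : (univ.image y).card ≤ 2 * a := card_image_le.trans (by simp)
    have : W1.card ≤ W.card + 2 * a := (card_union_le _ _).trans (by omega)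
    exact_mod_cast this
  obtain ⟨Z, hZ, hZd⟩ := greedy (univ : Finset (Fin (3 * a))) (fun _ Q => Q ⊆ P ∧ Q.card = k - 1)
    W1 k m (by positivity) (by
      intro i _ W' _ hW'
      obtain ⟨S, hSP, hSW, hS⟩ := hrob W' hW'
      have hc := spans_card hS
      obtain ⟨Q, hQ, hQc⟩ := exists_subset_card_eq (s := S) (n := k - 1) (by omega)
      refine ⟨Q, disjoint_of_subset_left hQ hSW, ?_, hQ.trans hSP, hQc⟩
      rw [hQc]; exact_mod_cast Nat.sub_le _ _)
    (by rw [card_univ, Fintype.card_fin]; push_cast; linarith)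
  set W2 := W1 ∪ univ.biUnion Z with hW2
  have hZc : ((univ.biUnion Z).card : ℝ) ≤ 3 * k * a := by
    have h1 : (univ.biUnion Z).card ≤ ∑ z : Fin (3 * a), k :=
      card_biUnion_le.trans (sum_le_sum fun z _ => by
        have := (hZ z (mem_univ z)).2.2; exact_mod_cast this)
    rw [sum_const, card_univ, Fintype.card_fin, smul_eq_mul] at h1
    have h2 : ((univ.biUnion Z).card : ℝ) ≤ ((3 * a * k : ℕ) : ℝ) := by exact_mod_cast h1
    push_cast at h2
    linarith
  have hW2c : (W2.card : ℝ) ≤ W.card + 2 * a + 3 * k * a := by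
    have h1 : (W2.card : ℝ) ≤ W1.card + (univ.biUnion Z).card := by
      exact_mod_cast card_union_le _ _
    linarith
  let e := (X.equivFinOfCardEq hX).symm
  let w : Fin (a + h) ⊕ Fin (2 * a) → Fin n := Sum.elim (fun i => (e i).val) y
  have hwinj : Function.Injective w := by
    rintro (i | i) (j | j) hij
    · have : e i = e j := Subtype.ext hij
      rw [e.injective this]
    · exact absurd (hXW (e i).2) (by
        have h1 : (e i).val = y j := hij
        rw [h1]; exact hyW j)
    · exact absurd (hXW (e j).2) (by
        have h1 : y i = (e j).val := hij
        rw [← h1]; exact hyW i)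
    · rw [hyinj (show y i = y j from hij)]
  have hwP : ∀ q, w q ∈ P := by
    rintro (i | i)
    · exact hXP (e i).2
    · exact hyP i
  have hwW : ∀ q, w q ∈ W1 := by
    rintro (i | i)
    · exact mem_union_left _ (hXW (e i).2)
    · exact mem_union_right _ (mem_image_of_mem _ (mem_univ i))
  have hwZ : ∀ q z, w q ∉ Z z := fun q z hq =>
    disjoint_left.1 (hZ z (mem_univ z)).2.1 hq (hwW q)
  let I : Finset (Σ _ : Fin (3 * a), Fin (a + h) ⊕ Fin (2 * a)) := univ.sigma E
  have hIc : (I.card : ℝ) ≤ 126 * a := by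
    have : I.card ≤ 126 * a := by rw [card_sigma]; exact hE
    exact_mod_cast this
  have hkt2 : (k:ℝ) ^ 2 * t * I.card ≤ 126 * (k ^ 2 * t) * a := by
    nlinarith
  obtain ⟨A, hA, hAd⟩ := greedy I (fun q Q => PerfTilingOn F G Q ∧
      PerfTilingOn F G (Q ∪ insert (w q.2) (Z q.1))) W2 ((k:ℝ) ^ 2 * t)
      (W.card + 131 * (k ^ 2 * t) * a) hk2 (by
      intro q _ W' hWW' hW'
      have hZq := (hZ q.1 (mem_univ _)).1
      obtain ⟨A, h1, h2, h3, h4, h5⟩ := absorber hcl hrob (insert (w q.2) (Z q.1)) W'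
        (insert_subset (hwP _) hZq.1)
        (by rw [card_insert_of_notMem (hwZ _ _), hZq.2]; omega) (by linarith) ht
      exact ⟨A, h1, by exact_mod_cast h3, h4, h5⟩) (by linarith)
  refine ⟨univ.image y ∪ univ.biUnion Z ∪ I.biUnion A, ?_, ?_, ?_⟩
  · rw [disjoint_union_left, disjoint_union_left]
    refine ⟨⟨?_, ?_⟩, ?_⟩
    · rw [disjoint_left]; intro v hv
      obtain ⟨i, _, rfl⟩ := mem_image.1 hv
      exact hyW i
    · rw [disjoint_biUnion_left]; intro z _
      exact disjoint_of_subset_right subset_union_left (hZ z (mem_univ z)).2.1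
    · rw [disjoint_biUnion_left]; intro q hq
      exact disjoint_of_subset_right (subset_union_left.trans subset_union_left) (hA q hq).2.1
  · have h1 : ((univ.image y ∪ univ.biUnion Z ∪ I.biUnion A).card : ℝ) ≤
        (univ.image y).card + (univ.biUnion Z).card + (I.biUnion A).card := by
      have h1 := card_union_le (univ.image y ∪ univ.biUnion Z) (I.biUnion A)
      have h2 := card_union_le (univ.image y) (univ.biUnion Z)
      have : (univ.image y ∪ univ.biUnion Z ∪ I.biUnion A).card ≤
        (univ.image y).card + (univ.biUnion Z).card + (I.biUnion A).card := by omega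
      exact_mod_cast this
    have h2 : ((univ.image y).card : ℝ) ≤ 2 * a := by
      have : (univ.image y).card ≤ 2 * a := card_image_le.trans (by simp)
      exact_mod_cast this
    have h3 : ((I.biUnion A).card : ℝ) ≤ (k:ℝ) ^ 2 * t * I.card := by
      have h4 : ((I.biUnion A).card : ℝ) ≤ ∑ q ∈ I, ((A q).card : ℝ) := by
        exact_mod_cast card_biUnion_le
      have h5 := sum_le_sum (fun q hq => (hA q hq).2.2)
      rw [sum_const, nsmul_eq_mul] at h5
      linarith
    linarith
  · intro X' hX' hX'c
    obtain ⟨φ, hφ, hφE, hφi⟩ := hT (univ.filter fun i => (e i).val ∈ X') (by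
      refine Eq.trans ?_ hX'c
      refine card_bij (fun i _ => (e i).val) (fun i hi => (mem_filter.1 hi).2) ?_ ?_
      · intro i _ j _ hij
        exact e.injective (Subtype.ext hij)
      · intro v hv
        refine ⟨e.symm ⟨v, hX' hv⟩, ?_, by simp⟩
        simpa using hv)
    have hI : ∀ z, (⟨z, φ z⟩ : Σ _ : Fin (3 * a), Fin (a + h) ⊕ Fin (2 * a)) ∈ I := fun z =>
      mem_sigma.2 ⟨mem_univ _, hφE z⟩
    let B : (Σ _ : Fin (3 * a), Fin (a + h) ⊕ Fin (2 * a)) → Finset (Fin n) := fun q =>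
      if φ q.1 = q.2 then A q ∪ insert (w q.2) (Z q.1) else A q
    have hsup : ∀ q, A q ⊆ B q := by
      intro q; simp only [B]; split_ifs
      · exact subset_union_left
      · exact subset_rfl
    have hin : ∀ z, insert (w (φ z)) (Z z) ⊆ B ⟨z, φ z⟩ := by
      intro z; simp only [B]
      rw [if_pos trivial]; exact subset_union_right
    have hW2in : ∀ q z, insert (w q) (Z z) ⊆ W2 := by
      intro q z
      refine insert_subset (mem_union_left _ (hwW q)) ?_
      exact (subset_biUnion_of_mem Z (mem_univ z)).trans subset_union_right
    have heq : X' ∪ (univ.image y ∪ univ.biUnion Z ∪ I.biUnion A) = I.biUnion B := by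
      apply subset_antisymm
      · refine union_subset ?_ (union_subset (union_subset ?_ ?_) ?_)
        · intro v hv
          have h1 : (Sum.inl (e.symm ⟨v, hX' hv⟩) : Fin (a + h) ⊕ Fin (2 * a)) ∈ univ.image φ := by
            rw [hφi, inl_mem_disjSum]; simpa using hv
          obtain ⟨z, _, hz⟩ := mem_image.1 h1
          refine mem_biUnion.2 ⟨_, hI z, hin z ?_⟩
          rw [hz, mem_insert]; left
          simp [w]
        · intro v hv
          obtain ⟨i, _, rfl⟩ := mem_image.1 hv
          have h1 : (Sum.inr i : Fin (a + h) ⊕ Fin (2 * a)) ∈ univ.image φ := by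
            rw [hφi, inr_mem_disjSum]; exact mem_univ _
          obtain ⟨z, _, hz⟩ := mem_image.1 h1
          refine mem_biUnion.2 ⟨_, hI z, hin z ?_⟩
          rw [hz, mem_insert]; left
          simp [w]
        · exact biUnion_subset.2 fun z _ =>
            ((subset_insert _ _).trans (hin z)).trans (subset_biUnion_of_mem B (hI z))
        · exact biUnion_subset.2 fun q hq => (hsup q).trans (subset_biUnion_of_mem B hq)
      · refine biUnion_subset.2 fun q hq => ?_
        have hAq : A q ⊆ X' ∪ (univ.image y ∪ univ.biUnion Z ∪ I.biUnion A) :=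
          (subset_biUnion_of_mem A hq).trans (subset_union_right.trans subset_union_right)
        simp only [B]
        split_ifs with hc
        · refine union_subset hAq (insert_subset ?_ ?_)
          · have h1 : φ q.1 ∈ univ.image φ := mem_image_of_mem _ (mem_univ _)
            rw [hφi, hc] at h1
            rcases hq2 : q.2 with i | i
            · rw [hq2, inl_mem_disjSum] at h1
              exact mem_union_left _ (by simpa [w] using h1)
            · exact mem_union_right _ (mem_union_left _ (mem_union_left _
                (mem_image_of_mem _ (mem_univ i))))
          · exact (subset_biUnion_of_mem Z (mem_univ _)).trans
              ((subset_union_right.trans subset_union_left).trans subset_union_right)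
        · exact hAq
    rw [heq]
    refine tile_biUnion I B ?_ ?_
    · intro q hq
      simp only [B]; split_ifs
      · exact (hA q hq).1.2
      · exact (hA q hq).1.1
    · intro q hq q' hq' hne
      have h1 := hAd q hq q' hq' hne
      have h2 : ∀ s z, Disjoint (A q) (insert (w s) (Z z)) := fun s z =>
        disjoint_of_subset_right (hW2in s z) (hA q hq).2.1
      have h3 : ∀ s z, Disjoint (insert (w s) (Z z)) (A q') := fun s z =>
        (disjoint_of_subset_right (hW2in s z) (hA q' hq').2.1).symm
      simp only [B]
      split_ifs with hc hc'
      · rw [disjoint_union_left, disjoint_union_right, disjoint_union_right]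
        refine ⟨⟨h1, h2 _ _⟩, h3 _ _, ?_⟩
        have hz : q.1 ≠ q'.1 := by
          intro hz
          apply hne
          have h5 : q.2 = q'.2 := by rw [← hc, ← hc', hz]
          exact Sigma.ext hz (heq_of_eq h5)
        rw [disjoint_insert_left, disjoint_insert_right]
        refine ⟨?_, hwZ _ _, hZd _ (mem_univ _) _ (mem_univ _) hz⟩
        rw [mem_insert, not_or]
        refine ⟨?_, hwZ _ _⟩
        intro h5
        have h6 := hwinj h5
        rw [← hc, ← hc'] at h6
        exact hz (hφ h6)
      · rw [disjoint_union_left]; exact ⟨h1, h3 _ _⟩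
      · rw [disjoint_union_right]; exact ⟨h1, h2 _ _⟩
      · exact h1

end RTT

namespace RTT

lemma set_aux {V : Type*} [DecidableEq V] {X R U T J : Finset V} (h : T ∪ J ⊆ X) :
    X ∪ R ∪ U = (X \ (T ∪ J) ∪ R) ∪ ((U ∪ T) ∪ J) := by
  ext v
  have h1 := @h v
  simp only [mem_union, mem_sdiff] at h1 ⊢
  tauto

lemma absorb_det {k n : ℕ} {F : SimpleGraph (Fin k)} {G : SimpleGraph (Fin n)} {m : ℝ} {t : ℕ}
    (hk : 3 ≤ k) (ht : 1 ≤ t) {x0 : Fin k} {ε ε' ξ : ℝ} (hH : HH1 F G x0 ε)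
    {P : Finset (Fin n)} (hcl : FClosed F G m t P)
    (hrob : ∀ W : Finset (Fin n), (W.card : ℝ) ≤ m → ∃ S1 ⊆ P, Disjoint S1 W ∧ SpansCopy F G S1)
    (X0 W D1 : Finset (Fin n)) (hXP : X0 ⊆ P) (hXW : Disjoint X0 W) (a : ℕ) (ha : 1 ≤ a)
    (hX0 : X0.card = a) (hD1 : ∀ v ∈ D1, ε' * n ≤ ((nb G v ∩ X0).card : ℝ))
    (hξ : k * ξ + ε ≤ ε') (hξa : ξ * n ≤ ((a / k : ℕ) : ℝ))
    (hW : (W.card : ℝ) + 133 * (k ^ 2 * t) * a + 2 * k + (k * t : ℕ) * k ≤ m) :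
    ∃ A : Finset (Fin n), Disjoint A W ∧ (A.card : ℝ) ≤ 133 * (k ^ 2 * t) * a ∧
      ∀ V' ⊆ D1, IsAbsorbingSet F G ξ V' A := by
  classical
  have hkR : (3:ℝ) ≤ k := by exact_mod_cast hk
  have htR : (1:ℝ) ≤ t := by exact_mod_cast ht
  have haR : (1:ℝ) ≤ a := by exact_mod_cast ha
  have hkk : (3:ℝ) * k ≤ k ^ 2 * t := by nlinarith
  have hk2 : (0:ℝ) ≤ k ^ 2 * t := by positivity
  have hak : (a:ℝ) ≤ k ^ 2 * t * a := by nlinarith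
  have hktk : (0:ℝ) ≤ (k * t : ℕ) * k := by positivity
  obtain ⟨h', hh'⟩ : ∃ h', h' = a / k := ⟨_, rfl⟩
  have hkh : k * h' ≤ a := by rw [hh']; exact Nat.mul_div_le a k
  have hkhR : (k:ℝ) * h' ≤ a := by exact_mod_cast hkh
  rw [← hh'] at hξa
  have hWX : ((W ∪ X0).card : ℝ) ≤ W.card + a := by
    have := card_union_le W X0
    rw [hX0] at this
    exact_mod_cast this
  obtain ⟨C, hC, hCd⟩ := greedy (univ : Finset (Fin h')) (fun _ Q => Q ⊆ P ∧ SpansCopy F G Q)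
    (W ∪ X0) k m (by positivity) (by
      intro i _ W' _ hW'
      obtain ⟨S, hSP, hSW, hS⟩ := hrob W' hW'
      exact ⟨S, hSW, by rw [spans_card hS], hSP, hS⟩)
    (by rw [card_univ, Fintype.card_fin]; linarith)
  have hCc : ∀ J : Finset (Fin h'), (J.biUnion C).card = J.card * k := by
    intro J
    rw [card_biUnion (fun i _ j _ hij => hCd i (mem_univ _) j (mem_univ _) hij),
      sum_congr rfl (fun i _ => spans_card (hC i (mem_univ _)).1.2), sum_const, smul_eq_mul]
  have hCX0 : ∀ J : Finset (Fin h'), Disjoint (J.biUnion C) (W ∪ X0) := by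
    intro J
    rw [disjoint_biUnion_left]; intro i _
    exact (hC i (mem_univ i)).2.1
  obtain ⟨X1, hX1⟩ : ∃ X1, X1 = univ.biUnion C := ⟨_, rfl⟩
  have hX1c : X1.card = h' * k := by rw [hX1, hCc, card_univ, Fintype.card_fin]
  have hX01 : Disjoint X0 X1 := by
    rw [hX1]; exact (disjoint_of_subset_right subset_union_right (hCX0 univ)).symm
  have hX1W : Disjoint X1 W := by
    rw [hX1]; exact disjoint_of_subset_right subset_union_left (hCX0 univ)
  have hX1P : X1 ⊆ P := by
    rw [hX1]; exact biUnion_subset.2 fun i _ => (hC i (mem_univ i)).1.1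
  have hXc : (X0 ∪ X1).card = a + k * h' := by
    rw [card_union_of_disjoint hX01, hX0, hX1c, mul_comm]
  have hXcR : ((X0 ∪ X1).card : ℝ) ≤ 2 * a := by
    rw [hXc]; push_cast; linarith
  obtain ⟨R, hRW, hRc, hR⟩ := flex_core hk ht hcl hrob (X0 ∪ X1) (W ∪ (X0 ∪ X1))
    (union_subset hXP hX1P) subset_union_right a (k * h') ha hkh hXc (by
      have h1 : ((W ∪ (X0 ∪ X1)).card : ℝ) ≤ W.card + (X0 ∪ X1).card := by
        exact_mod_cast card_union_le _ _
      linarith)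
  rw [disjoint_union_right] at hRW
  refine ⟨X0 ∪ X1 ∪ R, ?_, ?_, ?_⟩
  · rw [disjoint_union_left, disjoint_union_left]
    exact ⟨⟨hXW, hX1W⟩, hRW.1⟩
  · have h1 : ((X0 ∪ X1 ∪ R).card : ℝ) ≤ (X0 ∪ X1).card + R.card := by
      exact_mod_cast card_union_le _ _
    linarith
  · intro V' hV' U hU hUc hdvd
    have hUA : Disjoint (X0 ∪ X1 ∪ R) U := by
      rw [disjoint_right]; intro v hv
      exact (mem_sdiff.1 (hU hv)).2
    have hXR : Disjoint (X0 ∪ X1) R := hRW.2.symm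
    have hd1 : k ∣ a + R.card := by
      have h1 := tile_dvd (hR X0 subset_union_left hX0)
      rwa [card_union_of_disjoint (disjoint_of_subset_left subset_union_left hXR), hX0] at h1
    have hd2 : k ∣ U.card := by
      rw [card_union_of_disjoint hUA, card_union_of_disjoint hXR, hXc] at hdvd
      have h2 : a + k * h' + R.card + U.card = (a + R.card) + (k * h' + U.card) := by ring
      rw [h2, Nat.dvd_add_right hd1, Nat.dvd_add_right (dvd_mul_right _ _)] at hdvd
      exact hdvd
    obtain ⟨u, hu⟩ := hd2
    obtain ⟨T, hT, hTd⟩ := greedy U (fun v Q => Q ⊆ X0 ∧ Q.card = k - 1 ∧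
        SpansCopy F G (insert v Q)) ∅ k (k * ξ * n) (by positivity) (by
      intro v hv W' _ hW'
      have h1 := hD1 v (hV' (mem_sdiff.1 (hU hv)).1)
      have h2 : ((nb G v ∩ X0).card : ℝ) ≤ ((nb G v ∩ X0) \ W').card + W'.card := by
        exact_mod_cast (by
          have := le_card_sdiff W' (nb G v ∩ X0)
          omega : (nb G v ∩ X0).card ≤ ((nb G v ∩ X0) \ W').card + W'.card)
      have hn0 : (0:ℝ) ≤ n := by positivity
      have h5 : (k * ξ + ε) * n ≤ ε' * n := mul_le_mul_of_nonneg_right hξ hn0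
      obtain ⟨Q, hQ, hQc, hQg⟩ := hH ((nb G v ∩ X0) \ W') (by linarith)
      obtain ⟨g, _, hg, _, _, hgi⟩ := hQg v (fun w hw =>
        mem_nb.1 (mem_inter.1 (mem_sdiff.1 (hQ hw)).1).1)
      refine ⟨Q, ?_, ?_, ?_, hQc, by rw [← hgi]; exact hg⟩
      · rw [disjoint_left]; intro w hw; exact (mem_sdiff.1 (hQ hw)).2
      · rw [hQc]; exact_mod_cast Nat.sub_le _ _
      · intro w hw; exact (mem_inter.1 (mem_sdiff.1 (hQ hw)).1).2)
      (by rw [card_empty]; push_cast; nlinarith)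
    have hTc : (U.biUnion T).card = U.card * (k - 1) := by
      rw [card_biUnion (fun i hi j hj hij => hTd i hi j hj hij),
        sum_congr rfl (fun i hi => (hT i hi).1.2.1), sum_const, smul_eq_mul]
    have hTX : U.biUnion T ⊆ X0 := biUnion_subset.2 fun v hv => (hT v hv).1.1
    have hUh : U.card ≤ h' := by
      have := hUc.trans hξa
      exact_mod_cast this
    have hku : (k - 1) * u ≤ h' := by
      have : (k - 1) * u ≤ k * u := Nat.mul_le_mul_right _ (Nat.sub_le _ _)
      omega
    obtain ⟨J, hJ, hJc⟩ := exists_subset_card_eq (s := (univ : Finset (Fin h')))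
      (n := h' - (k - 1) * u) (by rw [card_univ, Fintype.card_fin]; exact Nat.sub_le _ _)
    have hJX : J.biUnion C ⊆ X1 := by
      rw [hX1]; exact biUnion_subset_biUnion_of_subset_left _ (subset_univ _)
    have hTJ : Disjoint (U.biUnion T) (J.biUnion C) :=
      disjoint_of_subset_left hTX (disjoint_of_subset_right hJX hX01)
    have hTJX : U.biUnion T ∪ J.biUnion C ⊆ X0 ∪ X1 := union_subset_union hTX hJX
    have hcard : ((X0 ∪ X1) \ (U.biUnion T ∪ J.biUnion C)).card = a := by
      rw [card_sdiff_of_subset hTJX, card_union_of_disjoint hTJ, hTc, hCc, hJc, hXc, hu]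
      have h1 : k * u * (k - 1) = k * ((k - 1) * u) := by ring
      rw [h1]
      generalize (k - 1) * u = q at hku
      have h2 : k * q ≤ k * h' := Nat.mul_le_mul_left _ hku
      rw [Nat.sub_mul, mul_comm h' k, mul_comm q k]
      omega
    have ht1 := hR _ sdiff_subset hcard
    have hUX : ∀ v ∈ U, v ∉ X0 := fun v hv h =>
      disjoint_left.1 hUA (mem_union_left _ (mem_union_left _ h)) hv
    have ht2 : PerfTilingOn F G (U.biUnion fun v => insert v (T v)) := by
      refine tile_biUnion U _ (fun v hv => tile_of_spans (hT v hv).1.2.2) ?_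
      intro v hv v' hv' hne
      rw [disjoint_insert_left, disjoint_insert_right, mem_insert, not_or]
      exact ⟨⟨hne, fun h => hUX v hv ((hT v' hv').1.1 h)⟩,
        fun h => hUX v' hv' ((hT v hv).1.1 h), hTd v hv v' hv' hne⟩
    have ht3 : PerfTilingOn F G (J.biUnion C) :=
      tile_biUnion J C (fun i _ => tile_of_spans (hC i (mem_univ i)).1.2)
        (fun i _ j _ hij => hCd i (mem_univ i) j (mem_univ j) hij)
    have hUT : (U.biUnion fun v => insert v (T v)) = U ∪ U.biUnion T := by
      ext v
      simp only [mem_biUnion, mem_insert, mem_union]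
      constructor
      · rintro ⟨w, hw, rfl | h⟩
        · exact Or.inl hw
        · exact Or.inr ⟨w, hw, h⟩
      · rintro (h | ⟨w, hw, h⟩)
        · exact ⟨v, h, Or.inl rfl⟩
        · exact ⟨w, hw, Or.inr h⟩
    rw [hUT] at ht2
    have hUJ : Disjoint (U ∪ U.biUnion T) (J.biUnion C) := by
      rw [disjoint_union_left]
      refine ⟨?_, hTJ⟩
      exact (disjoint_of_subset_left (hJX.trans (subset_union_right.trans subset_union_left)) hUA).symm
    have ht4 := tile_union ht2 ht3 hUJ
    have hfin := tile_union ht1 ht4 (by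
      rw [disjoint_union_left]
      constructor
      · rw [union_assoc, disjoint_union_right]
        refine ⟨?_, sdiff_disjoint⟩
        exact disjoint_of_subset_left (sdiff_subset.trans subset_union_left) hUA
      · rw [union_assoc, disjoint_union_right]
        exact ⟨disjoint_of_subset_left subset_union_right hUA,
          disjoint_of_subset_right hTJX hXR.symm⟩)
    convert hfin using 1
    exact set_aux hTJX

/-- the absorbing lemma inside one closed part -/
lemma absorb_lem {k : ℕ} (hk : 3 ≤ k) (F : SimpleGraph (Fin k)) (x0 : Fin k) (t : ℕ) (ht : 1 ≤ t)
    (β' θ₁ γ₁ ε₁ κ : ℝ) (hβ' : 0 < β') (hθ₁ : 0 < θ₁) (hγ₁ : 0 < γ₁) (hε₁ : 0 < ε₁)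
    (hκ1 : 2 * κ ≤ β') (hκ2 : 2 * κ ≤ θ₁) :
    ∃ ε ξ : ℝ, 0 < ε ∧ 0 < ξ ∧ ∃ N : ℕ, ∀ n : ℕ, N ≤ n → ∀ G : SimpleGraph (Fin n),
      HH1 F G x0 ε → ∀ P D W : Finset (Fin n), FClosed F G (β' * n) t P →
      (∀ W : Finset (Fin n), (W.card : ℝ) ≤ β' * n → ∃ S1 ⊆ P, Disjoint S1 W ∧ SpansCopy F G S1) →
      (∀ v ∈ D, θ₁ * n ≤ ((nb G v ∩ P).card : ℝ)) → (W.card : ℝ) ≤ κ * n →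
      ∃ A D' : Finset (Fin n), Disjoint A W ∧ (A.card : ℝ) ≤ γ₁ * n ∧
        (D'.card : ℝ) ≤ ε₁ * n ∧ ∀ V' ⊆ D \ D', IsAbsorbingSet F G ξ V' A := by
  classical
  have hkR : (3:ℝ) ≤ k := by exact_mod_cast hk
  have htR : (1:ℝ) ≤ t := by exact_mod_cast ht
  obtain ⟨L, hL⟩ : ∃ L : ℝ, L = 133 * (k ^ 2 * t) := ⟨_, rfl⟩
  have hLpos : 0 < L := by rw [hL]; positivity
  obtain ⟨γ₂, hγ2⟩ : ∃ x : ℝ, x = min γ₁ (β' / 4) := ⟨_, rfl⟩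
  have hγ2pos : 0 < γ₂ := by rw [hγ2]; exact lt_min hγ₁ (by linarith)
  have hγ21 : γ₂ ≤ γ₁ := by rw [hγ2]; exact min_le_left _ _
  have hγ2β : γ₂ ≤ β' / 4 := by rw [hγ2]; exact min_le_right _ _
  obtain ⟨ε', hε', N1, hN1⟩ := sample (θ₁ / 4) (γ₂ / L) ε₁ (by linarith) (by positivity) hε₁
  obtain ⟨N2, hN2⟩ := exists_nat_gt ((4 * (2 * k + (k * t : ℕ) * k)) / β' + 2 * k / ε')
  refine ⟨ε' / 2, ε' / (2 * k), by positivity, by positivity, max N1 N2, ?_⟩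
  intro n hn G hH P D W hcl hrob hD hW
  have hnN : (N2:ℝ) ≤ n := by exact_mod_cast (le_max_right N1 N2).trans hn
  have hbig := hN2.trans_le hnN
  have hp1 : 0 ≤ (4 * (2 * (k:ℝ) + (k * t : ℕ) * k)) / β' := by positivity
  have hp2 : 0 ≤ 2 * (k:ℝ) / ε' := by positivity
  have hb1 : 4 * (2 * (k:ℝ) + (k * t : ℕ) * k) ≤ β' * n := by
    have : (4 * (2 * (k:ℝ) + (k * t : ℕ) * k)) / β' ≤ n := by linarith
    rw [div_le_iff₀ hβ'] at this
    linarith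
  have hb2 : 2 * (k:ℝ) ≤ ε' * n := by
    have : 2 * (k:ℝ) / ε' ≤ n := by linarith
    rw [div_le_iff₀ hε'] at this
    linarith
  have hn0 : (0:ℝ) ≤ n := by positivity
  obtain ⟨X0, hX0, hX0c, D', hD'D, hD'c, hD'⟩ := hN1 n ((le_max_left _ _).trans hn) G (P \ W) D (by
    intro v hv
    have h1 := hD v hv
    have h2 : (nb G v ∩ P).card ≤ (nb G v ∩ (P \ W)).card + W.card := by
      have h3 : nb G v ∩ P ⊆ (nb G v ∩ (P \ W)) ∪ W := by
        intro w hw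
        by_cases hwW : w ∈ W
        · exact mem_union_right _ hwW
        · rw [mem_inter] at hw
          exact mem_union_left _ (mem_inter.2 ⟨hw.1, mem_sdiff.2 ⟨hw.2, hwW⟩⟩)
      exact (card_le_card h3).trans (card_union_le _ _)
    have h4 : ((nb G v ∩ P).card : ℝ) ≤ (nb G v ∩ (P \ W)).card + W.card := by exact_mod_cast h2
    have h5 : 2 * κ * n ≤ θ₁ * n := mul_le_mul_of_nonneg_right hκ2 hn0
    linarith)
  by_cases hemp : D \ D' = ∅
  · refine ⟨∅, D', disjoint_empty_left _, by rw [card_empty]; push_cast; positivity, hD'c, ?_⟩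
    intro V' hV' U hU _ _
    rw [hemp] at hV'
    have : U = ∅ := by
      rw [← subset_empty]; exact (hU.trans sdiff_subset).trans hV'
    rw [this, empty_union]
    exact tile_empty F G
  obtain ⟨v0, hv0⟩ := nonempty_iff_ne_empty.2 hemp
  have hXlow : ε' * n ≤ (X0.card : ℝ) :=
    (hD' v0 hv0).trans (by exact_mod_cast card_le_card inter_subset_right)
  have hLX : L * X0.card ≤ γ₂ * n := by
    have := mul_le_mul_of_nonneg_left hX0c hLpos.le
    have h2 : L * (γ₂ / L * n) = γ₂ * n := by field_simp
    linarith
  obtain ⟨A, hAW, hAc, hA⟩ := absorb_det hk ht (ε' := ε') (ξ := ε' / (2 * k)) hH hcl hrob X0 W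
    (D \ D') (hX0.trans sdiff_subset)
    (disjoint_of_subset_left hX0 sdiff_disjoint) X0.card (by
      have : (1:ℝ) ≤ X0.card := by linarith
      exact_mod_cast this) rfl hD' (by
      have : (k:ℝ) * (ε' / (2 * k)) = ε' / 2 := by field_simp
      linarith) (by
      have h1 : X0.card < k * (X0.card / k + 1) := Nat.lt_mul_div_succ _ (by omega)
      have h2 : (X0.card : ℝ) ≤ k * (((X0.card / k : ℕ) : ℝ) + 1) := by exact_mod_cast h1.le
      have h3 : ε' / (2 * k) * n = ε' * n / (2 * k) := by ring
      rw [h3, div_le_iff₀ (by positivity)]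
      nlinarith) (by
      rw [← hL]
      have h5 : 2 * κ * n ≤ β' * n := mul_le_mul_of_nonneg_right hκ1 hn0
      have h6 : γ₂ * n ≤ β' / 4 * n := mul_le_mul_of_nonneg_right hγ2β hn0
      linarith)
  rw [← hL] at hAc
  refine ⟨A, D', hAW, ?_, hD'c, hA⟩
  have h6 : γ₂ * n ≤ γ₁ * n := mul_le_mul_of_nonneg_right hγ21 hn0
  linarith

end RTT

namespace RTT

lemma HH1_mono {k n : ℕ} {F : SimpleGraph (Fin k)} {G : SimpleGraph (Fin n)} {x0 : Fin k}
    {ε ε' : ℝ} (h : ε ≤ ε') (hH : HH1 F G x0 ε) : HH1 F G x0 ε' := fun S hS =>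
  hH S ((mul_le_mul_of_nonneg_right h (Nat.cast_nonneg n)).trans hS)

/-- final assembly, with the part structure given -/
lemma assemble {k n c d : ℕ} {F : SimpleGraph (Fin k)} {G : SimpleGraph (Fin n)} {x0 : Fin k}
    {P D As D' : Fin d → Finset (Fin n)} {η μ γ δ γ₁ ε₁ ε τ ξ : ℝ} (hk : 3 ≤ k) (hd : d ≤ c)
    (hη : 0 < η) (hδ : 0 < δ) (hδγ : δ ≤ γ) (hδμ : δ ≤ μ)
    (hH : HH1 F G x0 ε) (hε : ε ≤ δ / 8) (hmin : MinDegGE G ((η + μ) * n))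
    (hdis : ∀ a b, a ≠ b → Disjoint (P a) (P b)) (hDP : ∀ i, D i ⊆ P i)
    (hD : ((univ \ univ.biUnion D).card : ℝ) ≤ τ * n)
    (hAsd : ∀ i j, i ≠ j → Disjoint (As i) (As j))
    (hγ₁ : 0 ≤ γ₁) (hε₁ : 0 ≤ ε₁)
    (hAsc : ∀ i, ((As i).card : ℝ) ≤ γ₁ * n) (hD'c : ∀ i, ((D' i).card : ℝ) ≤ ε₁ * n)
    (habs : ∀ i, ∀ V' ⊆ D i \ D' i, IsAbsorbingSet F G ξ V' (As i))
    (q1 : c * γ₁ ≤ δ / 8) (q2 : (k + 1) * (τ + c * ε₁) ≤ δ / 2) :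
    ∃ Vs : Fin d → Finset (Fin n), ∃ B : Finset (Fin n),
      (∀ i j, i ≠ j → Disjoint (Vs i) (Vs j)) ∧
      (∀ i j, Disjoint (Vs i) (As j)) ∧
      (∀ i, Disjoint (Vs i) B) ∧
      (∀ i, Disjoint (As i) B) ∧
      (Finset.univ.biUnion Vs ∪ Finset.univ.biUnion As ∪ B = Finset.univ) ∧
      ((Finset.univ.biUnion As ∪ B).card : ℝ) ≤ γ * n ∧
      (∀ i, IsAbsorbingSet F G ξ (Vs i) (As i)) ∧
      PerfTilingOn F G B := by
  classical
  have hn0 : (0:ℝ) ≤ n := by positivity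
  have hkR : (3:ℝ) ≤ k := by exact_mod_cast hk
  obtain ⟨A, hA⟩ : ∃ A, A = univ.biUnion As := ⟨_, rfl⟩
  have hAin : ∀ i, As i ⊆ A := fun i => by rw [hA]; exact subset_biUnion_of_mem As (mem_univ i)
  have hAc : (A.card : ℝ) ≤ c * (γ₁ * n) := by
    rw [hA]; exact card_biUnion_bound hd univ As _ (by positivity) (fun i _ => hAsc i)
  have hD'U : ((univ.biUnion D').card : ℝ) ≤ c * (ε₁ * n) :=
    card_biUnion_bound hd univ D' _ (by positivity) (fun i _ => hD'c i)
  obtain ⟨E0, hE0⟩ : ∃ E0, E0 = univ \ (univ.biUnion (fun i => D i \ D' i) ∪ A) := ⟨_, rfl⟩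
  have hE0c : (E0.card : ℝ) ≤ (τ + c * ε₁) * n := by
    have h1 : E0 ⊆ (univ \ univ.biUnion D) ∪ univ.biUnion D' := by
      intro v hv
      rw [hE0] at hv
      simp only [mem_sdiff, mem_univ, true_and, mem_union, mem_biUnion, not_or, not_exists] at hv ⊢
      by_cases h : ∃ i, v ∈ D i
      · obtain ⟨i, hi⟩ := h
        right
        refine ⟨i, ?_⟩
        by_contra h2
        exact hv.1 i ⟨hi, h2⟩
      · left; exact fun i hi => h ⟨i, hi⟩
    have h2 : (E0.card : ℝ) ≤ (univ \ univ.biUnion D).card + (univ.biUnion D').card := by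
      exact_mod_cast (card_le_card h1).trans (card_union_le _ _)
    linarith
  have hE0A : Disjoint E0 A := by
    rw [hE0]; exact disjoint_of_subset_right subset_union_right sdiff_disjoint
  have hAc' : (A.card : ℝ) ≤ δ / 8 * n := by
    have := mul_le_mul_of_nonneg_right q1 hn0
    linarith
  have hEk : ((k:ℝ) + 1) * E0.card ≤ δ / 2 * n := by
    have h1 := mul_le_mul_of_nonneg_left hE0c (by linarith : (0:ℝ) ≤ (k:ℝ) + 1)
    have h2 := mul_le_mul_of_nonneg_right q2 hn0
    linarith
  have hW0 : ((A ∪ E0).card : ℝ) ≤ A.card + E0.card := by exact_mod_cast card_union_le _ _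
  obtain ⟨Q, hQ, hQd⟩ := greedy E0 (fun e Q => SpansCopy F G (insert e Q)) (A ∪ E0) k
    (δ * 5 / 8 * n) (by positivity) (by
      intro e _ W _ hW
      have h1 : ((nb G e).card : ℝ) ≤ (nb G e \ W).card + W.card := by
        exact_mod_cast (by
          have := le_card_sdiff W (nb G e)
          omega : (nb G e).card ≤ (nb G e \ W).card + W.card)
      have h2 := hmin e
      rw [← nb_card] at h2
      have h3 : ε * n ≤ δ / 8 * n := mul_le_mul_of_nonneg_right hε hn0
      have h4 : δ * n ≤ μ * n := mul_le_mul_of_nonneg_right hδμ hn0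
      have h5 : 0 ≤ η * n := by positivity
      have h6 : 0 ≤ δ * n := by positivity
      obtain ⟨T, hT, hTc, hTg⟩ := hH (nb G e \ W) (by linarith)
      obtain ⟨g, _, hg, _, _, hgi⟩ := hTg e (fun w hw => mem_nb.1 (mem_sdiff.1 (hT hw)).1)
      refine ⟨T, ?_, ?_, by rw [← hgi]; exact hg⟩
      · rw [disjoint_left]; intro w hw; exact (mem_sdiff.1 (hT hw)).2
      · rw [hTc]; exact_mod_cast Nat.sub_le _ _) (by linarith)
  obtain ⟨B, hB⟩ : ∃ B, B = E0.biUnion fun e => insert e (Q e) := ⟨_, rfl⟩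
  have hEB : E0 ⊆ B := by
    intro e he
    rw [hB, mem_biUnion]; exact ⟨e, he, mem_insert_self _ _⟩
  have hQA : ∀ e ∈ E0, Disjoint (Q e) A ∧ Disjoint (Q e) E0 := fun e he =>
    disjoint_union_right.1 (hQ e he).2.1
  have hBA : Disjoint B A := by
    rw [hB, disjoint_biUnion_left]; intro e he
    rw [disjoint_insert_left]
    exact ⟨disjoint_left.1 hE0A he, (hQA e he).1⟩
  have hBc : (B.card : ℝ) ≤ (k + 1) * E0.card := by
    have h1 : B.card ≤ ∑ e ∈ E0, (k + 1) := by
      rw [hB]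
      refine card_biUnion_le.trans (sum_le_sum fun e he => ?_)
      have h2 : (Q e).card ≤ k := by exact_mod_cast (hQ e he).2.2
      have := card_insert_le e (Q e)
      omega
    rw [sum_const, smul_eq_mul] at h1
    have h2 : (B.card : ℝ) ≤ ((E0.card * (k + 1) : ℕ) : ℝ) := by exact_mod_cast h1
    push_cast at h2
    linarith
  refine ⟨fun i => (D i \ D' i) \ (A ∪ B), B, ?_, ?_, ?_, ?_, ?_, ?_, ?_, ?_⟩
  · intro i j hij
    exact disjoint_of_subset_left (sdiff_subset.trans (sdiff_subset.trans (hDP i)))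
      (disjoint_of_subset_right (sdiff_subset.trans (sdiff_subset.trans (hDP j))) (hdis i j hij))
  · intro i j
    exact disjoint_of_subset_right ((hAin j).trans subset_union_left) sdiff_disjoint
  · intro i
    exact disjoint_of_subset_right subset_union_right sdiff_disjoint
  · intro i
    exact disjoint_of_subset_left (hAin i) hBA.symm
  · rw [← hA]
    apply eq_univ_of_forall
    intro v
    by_cases hvA : v ∈ A
    · exact mem_union_left _ (mem_union_right _ hvA)
    by_cases hvB : v ∈ B
    · exact mem_union_right _ hvB
    have hvE : v ∉ E0 := fun h => hvB (hEB h)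
    rw [hE0] at hvE
    simp only [mem_sdiff, mem_univ, true_and, not_not, mem_union, hvA, or_false] at hvE
    obtain ⟨i, _, hi⟩ := mem_biUnion.1 hvE
    refine mem_union_left _ (mem_union_left _ (mem_biUnion.2 ⟨i, mem_univ i, ?_⟩))
    rw [mem_sdiff]
    refine ⟨hi, ?_⟩
    rw [mem_union, not_or]
    exact ⟨hvA, hvB⟩
  · rw [← hA]
    have h1 : ((A ∪ B).card : ℝ) ≤ A.card + B.card := by exact_mod_cast card_union_le _ _
    have h4 : δ * n ≤ γ * n := mul_le_mul_of_nonneg_right hδγ hn0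
    have h6 : 0 ≤ δ * n := by positivity
    linarith
  · intro i
    exact habs i _ sdiff_subset
  · rw [hB]
    refine tile_biUnion E0 _ (fun e he => tile_of_spans (hQ e he).1) ?_
    intro e he e' he' hne
    rw [disjoint_insert_left, disjoint_insert_right, mem_insert, not_or]
    exact ⟨⟨hne, fun h => disjoint_left.1 (hQA e' he').2 h he⟩,
      fun h => disjoint_left.1 (hQA e he).2 h he', hQd e he e' he' hne⟩

end RTT



namespace RTT

lemma consts_lem {k c K δ μ : ℝ} (hkR : 3 ≤ k) (hc0 : 0 ≤ c) (hK : K = c + 1) (hδ : 0 < δ)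
    (hδμ : δ ≤ μ) (hδ1 : δ ≤ 1) :
    ∃ lam β ρ τ : ℝ, 0 < lam ∧ 0 < β ∧ 0 < ρ ∧ lam ≤ 1 ∧ 3 * (c + 1) * β ≤ μ ∧
      c ^ 2 * β + c * lam ≤ μ / 2 ∧ ρ * lam / 2 ≤ lam ∧ ρ * lam / 2 ≤ ρ ∧
      ρ * lam = 8 * β ∧ c * ρ + 2 * β ≤ lam ∧ 4 * k * β < μ ∧
      c ^ 2 * β + 2 * c * lam ≤ τ ∧ (k + 1) * (τ + c * (4 * lam)) ≤ δ / 2 := by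
  have hK1 : 1 ≤ K := by linarith
  have hcK : c ≤ K := by linarith
  obtain ⟨lam, hlam⟩ : ∃ x : ℝ, x = δ / (32 * k * K) := ⟨_, rfl⟩
  have hlam0 : 0 < lam := by rw [hlam]; positivity
  have hlamK : lam * K * k = δ / 32 := by rw [hlam]; field_simp
  have hlk : lam * K ≤ δ / 96 := by
    have : 0 < lam * K := by positivity
    nlinarith
  have hlamK1 : lam ≤ lam * K := by nlinarith
  have hclam : c * lam ≤ lam * K := by nlinarith
  obtain ⟨β, hβe⟩ : ∃ x : ℝ, x = lam ^ 2 / (16 * K) := ⟨_, rfl⟩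
  have hβ : 0 < β := by rw [hβe]; positivity
  have hβK : β * K = lam * lam / 16 := by rw [hβe]; field_simp
  have hβKK : β * K * K ≤ lam / 16 := by
    rw [hβK]
    nlinarith
  have hββ : β ≤ β * K := by nlinarith
  have hββ2 : β * K ≤ β * K * K := by nlinarith [mul_pos hβ (by linarith : (0:ℝ) < K)]
  have hc2β : (c:ℝ) ^ 2 * β ≤ lam / 16 := by
    have : (c:ℝ) ^ 2 ≤ K * K := by nlinarith
    nlinarith
  obtain ⟨ρ, hρe⟩ : ∃ x : ℝ, x = lam / (2 * K) := ⟨_, rfl⟩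
  have hρ : 0 < ρ := by rw [hρe]; positivity
  have hρK : ρ * K = lam / 2 := by rw [hρe]; field_simp
  have hρβ : ρ * lam = 8 * β := by rw [hρe, hβe]; field_simp; norm_num
  have hρlam : ρ ≤ lam / 2 := by nlinarith
  have hcρ : c * ρ ≤ lam / 2 := by nlinarith
  obtain ⟨τ, hτ⟩ : ∃ x : ℝ, x = δ / (8 * k) := ⟨_, rfl⟩
  have hτ' : τ = 4 * (lam * K) := by rw [hτ, hlam]; field_simp; norm_num
  have hlam1 : lam ≤ 1 := by linarith
  refine ⟨lam, β, ρ, τ, hlam0, hβ, hρ, hlam1, ?_, ?_, ?_, ?_, hρβ, ?_, ?_, ?_, ?_⟩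
  · rw [← hK]; linarith
  · linarith
  · nlinarith
  · nlinarith
  · linarith
  · have h1 : k * β ≤ k * lam := by
      apply mul_le_mul_of_nonneg_left _ (by linarith)
      linarith
    have h2 : k * lam ≤ δ / 32 := by
      rw [← hlamK, mul_comm]
      exact mul_le_mul_of_nonneg_right hlamK1 (by linarith)
    linarith
  · rw [hτ']; linarith
  · have h9 : τ + c * (4 * lam) ≤ 8 * (lam * K) := by rw [hτ']; linarith
    have h10 : (k + 1) * (τ + c * (4 * lam)) ≤ (k + 1) * (8 * (lam * K)) :=
      mul_le_mul_of_nonneg_left h9 (by linarith)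
    linarith

end RTT

open RTT in
/-- Existence of an absorbing-set partition. -/
theorem absorbing_set_partition :
    ∀ k r : ℕ, 3 ≤ k → ∀ F : SimpleGraph (Fin k), ∀ η : ℝ, 0 < η →
    ((F = ⊤ ∧ r = k) ∨
     (F = ⊤ ∧ r = k - 1 ∧ 1 / (k : ℝ) ≤ η) ∨
     (F.IsTree ∧ r = 2) ∨
     (F = SimpleGraph.cycleGraph k ∧ r = 2 ∧ 1 / (k : ℝ) ≤ η)) →
    ∀ γ μ : ℝ, 0 < γ → 0 < μ →
    ∃ α ξ : ℝ, 0 < α ∧ 0 < ξ ∧ ∃ N : ℕ, ∀ n : ℕ, N ≤ n →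
      ∀ G : SimpleGraph (Fin n),
        MinDegGE G ((η + μ) * n) → IndepBound G r (α * n) →
        ∃ C : ℕ, C ≤ ⌊1 / η⌋₊ ∧
        ∃ Vs As : Fin C → Finset (Fin n), ∃ B : Finset (Fin n),
          (∀ i j, i ≠ j → Disjoint (Vs i) (Vs j)) ∧
          (∀ i j, i ≠ j → Disjoint (As i) (As j)) ∧
          (∀ i j, Disjoint (Vs i) (As j)) ∧
          (∀ i, Disjoint (Vs i) B) ∧
          (∀ i, Disjoint (As i) B) ∧
          (Finset.univ.biUnion Vs ∪ Finset.univ.biUnion As ∪ B = Finset.univ) ∧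
          ((Finset.univ.biUnion As ∪ B).card : ℝ) ≤ γ * n ∧
          (∀ i, IsAbsorbingSet F G ξ (Vs i) (As i)) ∧
          PerfTilingOn F G B := by
  classical
  intro k r hk F η hη hcase γ μ hγ hμ
  obtain ⟨x0, x1, hx, hmain⟩ := main_H hk hcase
  have hkR : (3:ℝ) ≤ k := by exact_mod_cast hk
  obtain ⟨c, hc⟩ : ∃ c, c = ⌊1 / η⌋₊ := ⟨_, rfl⟩
  obtain ⟨K, hK⟩ : ∃ K : ℝ, K = c + 1 := ⟨_, rfl⟩
  have hc0 : (0:ℝ) ≤ c := Nat.cast_nonneg c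
  have hK1 : 1 ≤ K := by linarith
  have hcK : (c:ℝ) ≤ K := by linarith
  obtain ⟨δ, hδe⟩ : ∃ δ : ℝ, δ = min γ (min μ 1) := ⟨_, rfl⟩
  have hδ : 0 < δ := by rw [hδe]; exact lt_min hγ (lt_min hμ one_pos)
  have hδγ : δ ≤ γ := by rw [hδe]; exact min_le_left _ _
  have hδμ : δ ≤ μ := by rw [hδe]; exact (min_le_right _ _).trans (min_le_left _ _)
  have hδ1 : δ ≤ 1 := by rw [hδe]; exact (min_le_right _ _).trans (min_le_right _ _)
  obtain ⟨lam, β, ρ, τ, hlam0, hβ, hρ, hlam1, c1, c2, c3, c4, c5, c6, c7, c8, hτl⟩ :=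
    consts_lem hkR hc0 hK hδ hδμ hδ1
  obtain ⟨β', hβ'e⟩ : ∃ x : ℝ, x = β / 2 ^ (c + 1) := ⟨_, rfl⟩
  have hβ' : 0 < β' := by rw [hβ'e]; positivity
  have hβ'β : β' ≤ β := by
    rw [hβ'e]; exact div_le_self hβ.le (one_le_pow₀ (by norm_num))
  obtain ⟨κ, hκe⟩ : ∃ x : ℝ, x = min (β' / 2) (η / 2) := ⟨_, rfl⟩
  have hκ : 0 < κ := by rw [hκe]; exact lt_min (by linarith) (by linarith)
  have hκ1 : κ ≤ β' / 2 := by rw [hκe]; exact min_le_left _ _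
  have hκ2 : κ ≤ η / 2 := by rw [hκe]; exact min_le_right _ _
  obtain ⟨γ₁, hγ₁e⟩ : ∃ x : ℝ, x = min (δ / 8) κ / K := ⟨_, rfl⟩
  have hγ₁ : 0 < γ₁ := by
    rw [hγ₁e]; exact div_pos (lt_min (by linarith) hκ) (by linarith)
  have hγ₁K : γ₁ * K = min (δ / 8) κ := by rw [hγ₁e]; field_simp
  have hcγ : c * γ₁ ≤ γ₁ * K := by
    rw [mul_comm γ₁]; exact mul_le_mul_of_nonneg_right hcK hγ₁.le
  have hcγ1 : c * γ₁ ≤ δ / 8 := by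
    rw [hγ₁K] at hcγ; exact hcγ.trans (min_le_left _ _)
  have hcγ2 : c * γ₁ ≤ κ := by
    rw [hγ₁K] at hcγ; exact hcγ.trans (min_le_right _ _)
  have hε₁ : 0 < 4 * lam := by linarith
  have ht : 1 ≤ (k + 3) ^ c := Nat.one_le_pow _ _ (by omega)
  obtain ⟨εa, ξ, hεa, hξ, N1, hN1⟩ := absorb_lem hk F x0 ((k + 3) ^ c) ht β' η γ₁ (4 * lam) κ hβ' hη hγ₁
    hε₁ (by linarith) (by linarith)
  obtain ⟨ε, hεe⟩ : ∃ x : ℝ, x = min β (min εa (δ / 8)) := ⟨_, rfl⟩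
  have hε : 0 < ε := by rw [hεe]; exact lt_min hβ (lt_min hεa (by linarith))
  have hεβ : ε ≤ β := by rw [hεe]; exact min_le_left _ _
  have hεεa : ε ≤ εa := by rw [hεe]; exact (min_le_right _ _).trans (min_le_left _ _)
  have hεδ : ε ≤ δ / 8 := by rw [hεe]; exact (min_le_right _ _).trans (min_le_right _ _)
  obtain ⟨α, hα, hmain⟩ := hmain ε hε
  obtain ⟨N2, hN2⟩ := exists_nat_gt ((10 * (k : ℝ) + k * (k + 3) ^ c * (k + 1)) / β')
  refine ⟨α, ξ, hα, hξ, N1 + N2 + 1, ?_⟩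
  intro n hn G hmin hind
  obtain ⟨hH1, hH⟩ := hmain n (by omega) G hind
  have hnpos : (0:ℝ) < n := by exact_mod_cast (by omega : 0 < n)
  have hnN2 : (N2:ℝ) ≤ n := by exact_mod_cast (by omega : N2 ≤ n)
  obtain ⟨d, hd, P, hcl, hdis, hV0, hno⟩ := partition hk hη hμ hβ c hc
    c1 hεβ hH1 hmin (by
      have h1 := hN2.le.trans hnN2
      rw [div_le_iff₀ hβ'] at h1
      rw [← hβ'e]; linarith)
  rw [← hβ'e] at hcl
  obtain ⟨D, hDP, hDD, hDc⟩ := structure_lem (θ := lam) (ρ := ρ) (lam := lam) (θ' := ρ * lam / 2)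
    (ρ' := ρ * lam / 2) (τ := τ) hk hx hnpos hη hμ hd hH1 hH hmin hdis hV0 hno hlam0 hρ
    (by positivity) hβ hε c2 le_rfl (by linarith) c3 c4
    (by linarith) (by linarith) (by linarith) c7 hεβ c8
  obtain ⟨As, hAs, hAsd⟩ := greedy (univ : Finset (Fin d)) (fun i A => ∃ D' : Finset (Fin n),
      (D'.card : ℝ) ≤ (4 * lam) * n ∧ ∀ V' ⊆ D i \ D', IsAbsorbingSet F G ξ V' A) ∅ (γ₁ * n) (κ * n)
      (by positivity) (by
      intro i _ W _ hW
      by_cases hDi : D i = ∅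
      · refine ⟨∅, disjoint_empty_left _, by rw [card_empty]; push_cast; positivity, ∅,
          by rw [card_empty]; push_cast; positivity, ?_⟩
        intro V' hV' U hU _ _
        rw [hDi, empty_sdiff] at hV'
        have : U = ∅ := by
          rw [← subset_empty]; exact (hU.trans sdiff_subset).trans hV'
        rw [this, empty_union]
        exact tile_empty F G
      · obtain ⟨v0, hv0⟩ := nonempty_iff_ne_empty.2 hDi
        have hrob := (hDD i v0 hv0).1
        obtain ⟨A, D', h1, h2, h3, h4⟩ := hN1 n (by omega) G (HH1_mono hεεa hH1) (P i) (D i) W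
          (hcl i) (by
            intro W' hW'
            obtain ⟨g, _, hg, hgP⟩ := hrob W' (hW'.trans
              (mul_le_mul_of_nonneg_right hβ'β hnpos.le))
            refine ⟨univ.image g, ?_, ?_, hg⟩
            · intro w hw
              obtain ⟨a, _, rfl⟩ := mem_image.1 hw
              exact (hgP a).1
            · rw [disjoint_left]
              intro w hw
              obtain ⟨a, _, rfl⟩ := mem_image.1 hw
              exact (hgP a).2)
          (fun v hv => by
            have h5 := (hDD i v hv).2
            have h6 : 0 ≤ μ / 2 * n := by positivity
            linarith) hW
        exact ⟨A, h1, h2, D', h3, h4⟩) (by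
      rw [card_empty, card_univ, Fintype.card_fin]
      have h1 : (d:ℝ) ≤ c := by exact_mod_cast hd
      have h2 : (d:ℝ) * γ₁ ≤ c * γ₁ := mul_le_mul_of_nonneg_right h1 hγ₁.le
      have h3 := mul_le_mul_of_nonneg_right (h2.trans hcγ2) hnpos.le
      push_cast
      linarith)
  choose D' hD'c hD'abs using fun i => (hAs i (mem_univ i)).1
  have hAsd' : ∀ i j, i ≠ j → Disjoint (As i) (As j) := fun i j hij =>
    hAsd i (mem_univ i) j (mem_univ j) hij
  obtain ⟨Vs, B, h1, h2, h3, h4, h5, h6, h7, h8⟩ := assemble (τ := τ) (γ := γ) hk hd hη hδ hδγ hδμ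
    hH1 hεδ hmin hdis hDP hDc hAsd' hγ₁.le hε₁.le (fun i => (hAs i (mem_univ i)).2.2) hD'c hD'abs
    hcγ1 hτl
  exact ⟨d, hc ▸ hd, Vs, As, B, h1, hAsd', h2, h3, h4, h5, h6, h7, h8⟩
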